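/- arXiv:2507.05792 — 6 statements merged into one kernel-verified Lean document; each statement's English description precedes it below -/
import Mathlib

section
/- Let F be a field with at least 4 elements and let x, y ∈ F♭ = F ∖ {0,1}. Then [x] + [1 − x] = [y] + [1 − y] in the pre-Bloch group P(F); that is, the element c_F := [x] + [1 − x] of P(F) is independent of the choice of x ∈ F♭. -/
open FreeAbelianGroup

/-- The set of five-term relators in the free abelian group on `F \ {0,1}`. -/
def fiveTermSet (F : Type*) [Field F] :
    Set (FreeAbelianGroup {x : F // x ≠ 0 ∧ x ≠ 1}) :=
  { z | ∃ (x y : F) (hx : x ≠ 0 ∧ x ≠ 1) (hy : y ≠ 0 ∧ y ≠ 1)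
      (_ : x ≠ y)
      (h1 : y / x ≠ 0 ∧ y / x ≠ 1)
      (h2 : (1 - x⁻¹) / (1 - y⁻¹) ≠ 0 ∧ (1 - x⁻¹) / (1 - y⁻¹) ≠ 1)
      (h3 : (1 - x) / (1 - y) ≠ 0 ∧ (1 - x) / (1 - y) ≠ 1),
      z = of (⟨x, hx⟩ : {x : F // x ≠ 0 ∧ x ≠ 1}) - of ⟨y, hy⟩ + of ⟨y / x, h1⟩
          - of ⟨(1 - x⁻¹) / (1 - y⁻¹), h2⟩ + of ⟨(1 - x) / (1 - y), h3⟩ }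

/-- The pre-Bloch group `P(F)`. -/
abbrev PreBloch (F : Type*) [Field F] :=
  FreeAbelianGroup {x : F // x ≠ 0 ∧ x ≠ 1} ⧸ AddSubgroup.closure (fiveTermSet F)

/-- The generator `[x]` of `P(F)`, for `x ∈ F \ {0,1}`. -/
def pb {F : Type*} [Field F] (x : F) (hx : x ≠ 0 ∧ x ≠ 1) : PreBloch F :=
  QuotientAddGroup.mk (of ⟨x, hx⟩)

/-- The five-term relation in `P(F)`, with its arguments given up to equality. -/
theorem pb_five_term {F : Type*} [Field F] {x y a b c : F} (hx : x ≠ 0 ∧ x ≠ 1)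
    (hy : y ≠ 0 ∧ y ≠ 1) (hxy : x ≠ y) (ha : a ≠ 0 ∧ a ≠ 1) (hb : b ≠ 0 ∧ b ≠ 1)
    (hc : c ≠ 0 ∧ c ≠ 1) (ea : a = y / x) (eb : b = (1 - x⁻¹) / (1 - y⁻¹))
    (ec : c = (1 - x) / (1 - y)) :
    pb x hx - pb y hy + pb a ha - pb b hb + pb c hc = 0 := by
  subst ea eb ec
  exact (QuotientAddGroup.eq_zero_iff _).2
    (AddSubgroup.subset_closure ⟨x, y, hx, hy, hxy, ha, hb, hc, rfl⟩)

/-- In a field with at least 4 elements, `[x] + [1-x]` is independent of `x ∈ F \ {0,1}`. -/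
theorem cF_independent (F : Type*) [Field F]
    (h4 : ∃ a b c d : F, a ≠ b ∧ a ≠ c ∧ a ≠ d ∧ b ≠ c ∧ b ≠ d ∧ c ≠ d)
    (x y : F) (hx : x ≠ 0 ∧ x ≠ 1) (hy : y ≠ 0 ∧ y ≠ 1)
    (hx' : 1 - x ≠ 0 ∧ 1 - x ≠ 1) (hy' : 1 - y ≠ 0 ∧ 1 - y ≠ 1) :
    pb x hx + pb (1 - x) hx' = pb y hy + pb (1 - y) hy' := by
  obtain rfl | hxy := eq_or_ne x y
  · rfl
  obtain ⟨hx0, hx1⟩ := id hx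
  obtain ⟨hy0, hy1⟩ := id hy
  have ux := hx'.1
  have uy := hy'.1
  have hc : (1 - x) / (1 - y) ≠ 0 ∧ (1 - x) / (1 - y) ≠ 1 :=
    ⟨div_ne_zero ux uy, fun h => hxy (sub_right_injective ((div_eq_one_iff_eq uy).1 h))⟩
  have ha : y / x ≠ 0 ∧ y / x ≠ 1 :=
    ⟨div_ne_zero hy0 hx0, fun h => hxy ((div_eq_one_iff_eq hx0).1 h).symm⟩
  have vx : 1 - x⁻¹ ≠ 0 := sub_ne_zero.2 (inv_ne_one.2 hx1).symm
  have vy : 1 - y⁻¹ ≠ 0 := sub_ne_zero.2 (inv_ne_one.2 hy1).symm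
  have hb : (1 - x⁻¹) / (1 - y⁻¹) ≠ 0 ∧ (1 - x⁻¹) / (1 - y⁻¹) ≠ 1 :=
    ⟨div_ne_zero vx vy,
      fun h => hxy (inv_injective (sub_right_injective ((div_eq_one_iff_eq vy).1 h)))⟩
  have one_sub_inv_one_sub : ∀ t : F, 1 - t ≠ 0 → 1 - (1 - t)⁻¹ = -t / (1 - t) := by
    intro t ht
    field_simp
    ring
  have one_sub_inv : ∀ t : F, t ≠ 0 → 1 - t⁻¹ = -(1 - t) / t := by
    intro t ht
    field_simp
    ring
  have eb : (1 - x⁻¹) / (1 - y⁻¹) = (1 - (1 - y)⁻¹) / (1 - (1 - x)⁻¹) := by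
    rw [one_sub_inv_one_sub x ux, one_sub_inv_one_sub y uy, one_sub_inv x hx0, one_sub_inv y hy0]
    field_simp
  have h₁ := pb_five_term hx hy hxy ha hb hc rfl rfl rfl
  have h₂ := pb_five_term hy' hx' (fun h => hxy (sub_right_injective h).symm) hc hb ha
    rfl eb (by simp)
  rw [← sub_eq_zero, ← sub_eq_zero.2 (h₁.trans h₂.symm)]
  abel
end

section
/- Let F be a field with at least 4 elements. For every x ∈ F♭ = F ∖ {0,1}, the element ⟨x⟩ := [x] + [x⁻¹] of the pre-Bloch group P(F) satisfies 2⟨x⟩ = 0, i.e. 2([x] + [x⁻¹]) = 0 in P(F). -/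
open FreeAbelianGroup

/-- The five-term relation in `P(F)`, with the last three arguments given up to equality. -/
theorem pb_five_term_s1 {F : Type*} [Field F] {x y u v w : F}
    (hx : x ≠ 0 ∧ x ≠ 1) (hy : y ≠ 0 ∧ y ≠ 1) (hxy : x ≠ y)
    (hu : u ≠ 0 ∧ u ≠ 1) (hv : v ≠ 0 ∧ v ≠ 1) (hw : w ≠ 0 ∧ w ≠ 1)
    (eu : u = y / x) (ev : v = (1 - x⁻¹) / (1 - y⁻¹)) (ew : w = (1 - x) / (1 - y)) :
    pb x hx - pb y hy + pb u hu - pb v hv + pb w hw = 0 := by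
  subst eu ev ew
  exact (QuotientAddGroup.eq_zero_iff _).2
    (AddSubgroup.subset_closure ⟨x, y, hx, hy, hxy, hu, hv, hw, rfl⟩)

/-- Multiplicativity of `⟨a⟩ = [a] + [a⁻¹]`, where `c` stands for `a * b`. -/
theorem pb_add_pb_inv_mul {F : Type*} [Field F] {a b c : F}
    (ha : a ≠ 0 ∧ a ≠ 1) (hb : b ≠ 0 ∧ b ≠ 1) (hc : c ≠ 0 ∧ c ≠ 1)
    (ha' : a⁻¹ ≠ 0 ∧ a⁻¹ ≠ 1) (hb' : b⁻¹ ≠ 0 ∧ b⁻¹ ≠ 1) (hc' : c⁻¹ ≠ 0 ∧ c⁻¹ ≠ 1)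
    (h : c = a * b) :
    (pb a ha + pb a⁻¹ ha') + (pb b hb + pb b⁻¹ hb') = pb c hc + pb c⁻¹ hc' := by
  obtain ⟨ha0, ha1⟩ := id ha
  obtain ⟨hb0, hb1⟩ := id hb
  have hc1 : c - 1 ≠ 0 := sub_ne_zero.2 hc.2
  have hb1' : b - 1 ≠ 0 := sub_ne_zero.2 hb1
  have ha1' : a - 1 ≠ 0 := sub_ne_zero.2 ha1
  obtain ⟨x, hxdef⟩ : ∃ x, x = (b - 1) / (c - 1) := ⟨_, rfl⟩
  have hx0 : x ≠ 0 := hxdef ▸ div_ne_zero hb1' hc1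
  have hxc : x * (c - 1) = b - 1 := by rw [hxdef, div_mul_cancel₀ _ hc1]
  have e1 : (1 - x) * (c - 1) = b * (a - 1) := by linear_combination h - hxc
  have e2 : (1 - a * x) * (c - 1) = a - 1 := by linear_combination h - a * hxc
  have hx1 : 1 - x ≠ 0 := left_ne_zero_of_mul (e1 ▸ mul_ne_zero hb0 ha1')
  have hy1 : 1 - a * x ≠ 0 := left_ne_zero_of_mul (e2 ▸ ha1')
  have hy0 : a * x ≠ 0 := mul_ne_zero ha0 hx0
  have hx : x ≠ 0 ∧ x ≠ 1 := ⟨hx0, (sub_ne_zero.1 hx1).symm⟩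
  have hy : a * x ≠ 0 ∧ a * x ≠ 1 := ⟨hy0, (sub_ne_zero.1 hy1).symm⟩
  have hxy : x ≠ a * x := fun e => ha1 (mul_right_cancel₀ hx0 (by rw [← e, one_mul]))
  have ea : a = a * x / x := (mul_div_cancel_right₀ _ hx0).symm
  have eb : b = (1 - x) / (1 - a * x) := by
    rw [eq_div_iff hy1]
    exact mul_right_cancel₀ hc1 (by linear_combination b * e2 - e1)
  have ec : c = (1 - x⁻¹) / (1 - (a * x)⁻¹) := by
    have k1 : 1 - x⁻¹ = -(1 - x) / x := by field_simp; ring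
    have k2 : 1 - (a * x)⁻¹ = -(1 - a * x) / (a * x) := by
      rw [eq_div_iff hy0, sub_mul, inv_mul_cancel₀ hy0]; ring
    rw [k1, k2, h]
    nth_rewrite 1 [eb]
    field_simp
  have r1 := pb_five_term_s1 hx hy hxy ha hc hb ea ec eb
  have r2 := pb_five_term_s1 hy hx hxy.symm ha' hc' hb'
    (by rw [← inv_div, ← ea]) (by rw [← inv_div, ← ec]) (by rw [← inv_div, ← eb])
  rw [← sub_eq_zero, ← add_zero (0 : PreBloch F)]
  nth_rewrite 1 [← r1]
  rw [← r2]
  abel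

/-- In a field with at least 4 elements, `2([x] + [x⁻¹]) = 0` in `P(F)`. -/
theorem two_smul_inv_elem_eq_zero (F : Type*) [Field F]
    (h4 : ∃ a b c d : F, a ≠ b ∧ a ≠ c ∧ a ≠ d ∧ b ≠ c ∧ b ≠ d ∧ c ≠ d)
    (x : F) (hx : x ≠ 0 ∧ x ≠ 1) (hx' : x⁻¹ ≠ 0 ∧ x⁻¹ ≠ 1) :
    (2 : ℤ) • (pb x hx + pb x⁻¹ hx') = 0 := by
  obtain ⟨b, hb0, hb1, hbx⟩ : ∃ b : F, b ≠ 0 ∧ b ≠ 1 ∧ b ≠ x⁻¹ := by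
    by_contra! H
    obtain ⟨p, q, r, s, h⟩ := h4
    have cover (b : F) : b = 0 ∨ b = 1 ∨ b = x⁻¹ := by
      have := H b
      tauto
    have hp := cover p
    have hq := cover q
    have hr := cover r
    have hs := cover s
    clear H cover hx hx'
    generalize x⁻¹ = t at *
    grind
  have inv_mem {z : F} (hz : z ≠ 0 ∧ z ≠ 1) : z⁻¹ ≠ 0 ∧ z⁻¹ ≠ 1 :=
    ⟨inv_ne_zero hz.1, inv_ne_one.2 hz.2⟩
  have hb : b ≠ 0 ∧ b ≠ 1 := ⟨hb0, hb1⟩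
  have hc : x * b ≠ 0 ∧ x * b ≠ 1 :=
    ⟨mul_ne_zero hx.1 hb0, fun e => hbx (eq_inv_of_mul_eq_one_right e)⟩
  have m1 := pb_add_pb_inv_mul hx hb hc hx' (inv_mem hb) (inv_mem hc) rfl
  have m2 := pb_add_pb_inv_mul hx' hc hb (inv_mem hx') (inv_mem hc) (inv_mem hb)
    (inv_mul_cancel_left₀ hx.1 b).symm
  simp only [inv_inv] at m2
  rw [← m1, ← add_assoc, add_eq_right] at m2
  rw [two_zsmul, ← m2]
  abel
end

section
/- Let F be a field with at least 4 elements and characteristic different from 2, and let c_F = [x] + [1 − x] ∈ P(F) for any x ∈ F♭ = F ∖ {0,1}. Then 3 c_F = 2[−1] in the pre-Bloch group P(F), and consequently 6 c_F = 0. -/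
open FreeAbelianGroup

open Classical in
/-- The generator `[x]` of `P(F)`, extended by zero to all of `F`. -/
noncomputable def pbExt {F : Type*} [Field F] (x : F) : PreBloch F :=
  if hx : x ≠ 0 ∧ x ≠ 1 then pb x hx else 0

theorem pbExt_eq_pb {F : Type*} [Field F] {x : F} (hx : x ≠ 0 ∧ x ≠ 1) : pbExt x = pb x hx :=
  dif_pos hx

theorem pbExt_one {F : Type*} [Field F] : pbExt (1 : F) = 0 :=
  dif_neg fun h => h.2 rfl

theorem pbExt_five_term {F : Type*} [Field F] {x y : F} (hx0 : x ≠ 0) (hx1 : x ≠ 1)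
    (hy0 : y ≠ 0) (hy1 : y ≠ 1) (hxy : x ≠ y) :
    pbExt x - pbExt y + pbExt (y / x) - pbExt ((1 - x⁻¹) / (1 - y⁻¹))
      + pbExt ((1 - x) / (1 - y)) = 0 := by
  have hx2 : 1 - x ≠ 0 := sub_ne_zero.2 hx1.symm
  have hy2 : 1 - y ≠ 0 := sub_ne_zero.2 hy1.symm
  have hx3 : 1 - x⁻¹ ≠ 0 := sub_ne_zero.2 fun h => hx1 (inv_eq_one.1 h.symm)
  have hy3 : 1 - y⁻¹ ≠ 0 := sub_ne_zero.2 fun h => hy1 (inv_eq_one.1 h.symm)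
  have h1 : y / x ≠ 0 ∧ y / x ≠ 1 :=
    ⟨div_ne_zero hy0 hx0, fun h => hxy ((div_eq_one_iff_eq hx0).1 h).symm⟩
  have h2 : (1 - x⁻¹) / (1 - y⁻¹) ≠ 0 ∧ (1 - x⁻¹) / (1 - y⁻¹) ≠ 1 :=
    ⟨div_ne_zero hx3 hy3,
      fun h => hxy (inv_injective (sub_right_injective ((div_eq_one_iff_eq hy3).1 h)))⟩
  have h3 : (1 - x) / (1 - y) ≠ 0 ∧ (1 - x) / (1 - y) ≠ 1 :=
    ⟨div_ne_zero hx2 hy2, fun h => hxy (sub_right_injective ((div_eq_one_iff_eq hy2).1 h))⟩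
  rw [pbExt_eq_pb ⟨hx0, hx1⟩, pbExt_eq_pb ⟨hy0, hy1⟩, pbExt_eq_pb h1, pbExt_eq_pb h2,
    pbExt_eq_pb h3]
  exact (QuotientAddGroup.eq_zero_iff _).2 (AddSubgroup.subset_closure
    ⟨x, y, ⟨hx0, hx1⟩, ⟨hy0, hy1⟩, hxy, h1, h2, h3, rfl⟩)

/-- The element `c_F = [x] + [1 - x]` does not depend on `x`. -/
theorem pbExt_add_pbExt_one_sub {F : Type*} [Field F] {x y : F} (hx0 : x ≠ 0) (hx1 : x ≠ 1)
    (hy0 : y ≠ 0) (hy1 : y ≠ 1) :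
    pbExt x + pbExt (1 - x) = pbExt y + pbExt (1 - y) := by
  by_cases hxy : x = y
  · rw [hxy]
  have hx2 : 1 - x ≠ 0 := sub_ne_zero.2 (Ne.symm hx1)
  have hy2 : 1 - y ≠ 0 := sub_ne_zero.2 (Ne.symm hy1)
  have e1 := pbExt_five_term hx0 hx1 hy0 hy1 hxy
  have e2 := pbExt_five_term (x := 1 - y) (y := 1 - x) hy2 (by simpa using hy0) hx2
    (by simpa using hx0) (by simpa [eq_comm] using hxy)
  have hx3 : x - 1 ≠ 0 := sub_ne_zero.2 hx1
  have hy3 : y - 1 ≠ 0 := sub_ne_zero.2 hy1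
  have k : (1 - (1 - y)⁻¹) / (1 - (1 - x)⁻¹) = (1 - x⁻¹) / (1 - y⁻¹) := by
    have k1 : 1 - (1 - y)⁻¹ = -y / (1 - y) := by field_simp; ring
    have k2 : 1 - (1 - x)⁻¹ = -x / (1 - x) := by field_simp; ring
    have k3 : 1 - y⁻¹ = -(1 - y) / y := by field_simp; ring
    have k4 : 1 - x⁻¹ = -(1 - x) / x := by field_simp; ring
    rw [k1, k2, k3, k4]
    field_simp
  rw [k, sub_sub_cancel, sub_sub_cancel] at e2
  rw [← sub_eq_zero]
  linear_combination (norm := abel) e1 - e2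

/-- The element `[x] + [x⁻¹]` of `P(F)`, which vanishes at `1`. -/
noncomputable def pbInvSum {F : Type*} [Field F] (x : F) : PreBloch F :=
  pbExt x + pbExt x⁻¹

theorem pbInvSum_one {F : Type*} [Field F] : pbInvSum (1 : F) = 0 := by
  simp [pbInvSum, pbExt_one]

theorem pbInvSum_inv {F : Type*} [Field F] (x : F) : pbInvSum x⁻¹ = pbInvSum x := by
  rw [pbInvSum, pbInvSum, inv_inv, add_comm]

theorem pbInvSum_mul_of_ne_one {F : Type*} [Field F] {a b : F} (ha0 : a ≠ 0) (ha1 : a ≠ 1)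
    (hb0 : b ≠ 0) (hb1 : b ≠ 1) (hab : a * b ≠ 1) :
    pbInvSum (a * b) = pbInvSum a + pbInvSum b := by
  have hd : a * b - 1 ≠ 0 := sub_ne_zero.2 hab
  have ha2 : a - 1 ≠ 0 := sub_ne_zero.2 ha1
  have hb2 : b - 1 ≠ 0 := sub_ne_zero.2 hb1
  have hd' : b * a - 1 ≠ 0 := mul_comm a b ▸ hd
  obtain ⟨x, hx⟩ : ∃ x, x = (b - 1) / (a * b - 1) := ⟨_, rfl⟩
  have hx0 : x ≠ 0 := hx ▸ div_ne_zero hb2 hd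
  have hx2 : 1 - x = b * (a - 1) / (a * b - 1) := by rw [hx]; field_simp; ring
  have hy2 : 1 - a * x = (a - 1) / (a * b - 1) := by rw [hx]; field_simp; ring
  have hx3 : 1 - x ≠ 0 := by rw [hx2]; positivity
  have hy3 : 1 - a * x ≠ 0 := by rw [hy2]; positivity
  have hx1 : x ≠ 1 := (sub_ne_zero.1 hx3).symm
  have hy1 : a * x ≠ 1 := (sub_ne_zero.1 hy3).symm
  have hy0 : a * x ≠ 0 := mul_ne_zero ha0 hx0
  have hxy : x ≠ a * x := fun h => ha1 (mul_right_cancel₀ hx0 (by rw [one_mul, ← h]))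
  have e1 := pbExt_five_term hx0 hx1 hy0 hy1 hxy
  have e2 := pbExt_five_term hy0 hy1 hx0 hx1 hxy.symm
  have k1 : a * x / x = a := mul_div_cancel_right₀ a hx0
  have k2 : (1 - x) / (1 - a * x) = b := by rw [hx2, hy2]; field_simp
  have k3 : (1 - x⁻¹) / (1 - (a * x)⁻¹) = a * b := by
    have k4 : 1 - x⁻¹ = -(1 - x) / x := by field_simp; ring
    have k5 : 1 - (a * x)⁻¹ = -(1 - a * x) / (a * x) := by field_simp; ring
    rw [k4, k5, ← k2]
    field_simp
  rw [k1, k2, k3] at e1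
  rw [← inv_div (a * x), ← inv_div (1 - x), ← inv_div (1 - x⁻¹), k1, k2, k3] at e2
  unfold pbInvSum
  rw [← sub_eq_zero]
  linear_combination (norm := abel) -e1 - e2

theorem pbInvSum_add_self {F : Type*} [Field F]
    (h4 : ∃ a b c d : F, a ≠ b ∧ a ≠ c ∧ a ≠ d ∧ b ≠ c ∧ b ≠ d ∧ c ≠ d) {a : F} (ha0 : a ≠ 0) :
    pbInvSum a + pbInvSum a = 0 := by
  by_cases ha1 : a = 1
  · rw [ha1, pbInvSum_one, add_zero]
  obtain ⟨c, hc0, hc1, hca⟩ : ∃ c : F, c ≠ 0 ∧ c ≠ 1 ∧ c ≠ a⁻¹ := by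
    by_contra! h
    obtain ⟨p, q, r, s, hp⟩ := h4
    have hF (t : F) : t = 0 ∨ t = 1 ∨ t = a⁻¹ := by
      by_contra! ht
      exact ht.2.2 (h t ht.1 ht.2.1)
    have h1 := hF p
    have h2 := hF q
    have h3 := hF r
    have h4 := hF s
    clear h hF
    grind
  have hac : a * c ≠ 1 := fun h => hca (eq_inv_of_mul_eq_one_right h)
  have e1 := pbInvSum_mul_of_ne_one ha0 ha1 hc0 hc1 hac
  have e2 := pbInvSum_mul_of_ne_one (a := a⁻¹) (b := a * c) (inv_ne_zero ha0)
    (fun h => ha1 (inv_eq_one.1 h)) (mul_ne_zero ha0 hc0) hac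
    (by rwa [inv_mul_cancel_left₀ ha0])
  rw [inv_mul_cancel_left₀ ha0, pbInvSum_inv, e1, ← add_assoc] at e2
  exact right_eq_add.1 e2

theorem pbInvSum_mul {F : Type*} [Field F]
    (h4 : ∃ a b c d : F, a ≠ b ∧ a ≠ c ∧ a ≠ d ∧ b ≠ c ∧ b ≠ d ∧ c ≠ d) {a b : F}
    (ha0 : a ≠ 0) (hb0 : b ≠ 0) : pbInvSum (a * b) = pbInvSum a + pbInvSum b := by
  by_cases ha1 : a = 1
  · rw [ha1, pbInvSum_one, one_mul, zero_add]
  by_cases hb1 : b = 1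
  · rw [hb1, pbInvSum_one, mul_one, add_zero]
  by_cases hab : a * b = 1
  · rw [hab, pbInvSum_one, eq_inv_of_mul_eq_one_right hab, pbInvSum_inv,
      pbInvSum_add_self h4 ha0]
  exact pbInvSum_mul_of_ne_one ha0 ha1 hb0 hb1 hab

/-- Summing `[t] + [t⁻¹]` over half of the anharmonic orbit of `x` gives `3 c_F`. -/
theorem three_zsmul_pbExt_add_pbExt_one_sub {F : Type*} [Field F] {x : F} (hx0 : x ≠ 0)
    (hx1 : x ≠ 1) :
    (3 : ℤ) • (pbExt x + pbExt (1 - x))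
      = pbInvSum x + pbInvSum (1 - x) + pbInvSum (1 - x⁻¹) := by
  have hx2 : 1 - x ≠ 0 := sub_ne_zero.2 hx1.symm
  have e1 := pbExt_add_pbExt_one_sub hx0 hx1 (inv_ne_zero hx0) fun h => hx1 (inv_eq_one.1 h)
  have e2 := pbExt_add_pbExt_one_sub hx0 hx1 (inv_ne_zero hx2)
    fun h => hx0 (by simpa using inv_eq_one.1 h)
  have k : 1 - (1 - x)⁻¹ = (1 - x⁻¹)⁻¹ := by
    have hx3 : x - 1 ≠ 0 := sub_ne_zero.2 hx1
    have k1 : 1 - (1 - x)⁻¹ = -x / (1 - x) := by field_simp; ring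
    have k2 : 1 - x⁻¹ = (1 - x) / -x := by field_simp; ring
    rw [k1, k2, inv_div]
  rw [k] at e2
  unfold pbInvSum
  linear_combination (norm := abel) e1 + e2

/-- If `char F ≠ 2` then `3 c_F = 2[-1]` in `P(F)`, hence `6 c_F = 0`. -/
theorem three_cF_eq_two_neg_one (F : Type*) [Field F]
    (h4 : ∃ a b c d : F, a ≠ b ∧ a ≠ c ∧ a ≠ d ∧ b ≠ c ∧ b ≠ d ∧ c ≠ d)
    (hchar : ringChar F ≠ 2)
    (x : F) (hx : x ≠ 0 ∧ x ≠ 1) (hx' : 1 - x ≠ 0 ∧ 1 - x ≠ 1)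
    (hneg : (-1 : F) ≠ 0 ∧ (-1 : F) ≠ 1) :
    (3 : ℤ) • (pb x hx + pb (1 - x) hx') = (2 : ℤ) • pb (-1 : F) hneg ∧
      (6 : ℤ) • (pb x hx + pb (1 - x) hx') = 0 := by
  have hx2 : 1 - x⁻¹ ≠ 0 := sub_ne_zero.2 fun h => hx.2 (inv_eq_one.1 h.symm)
  have key : (3 : ℤ) • (pb x hx + pb (1 - x) hx') = (2 : ℤ) • pb (-1 : F) hneg := by
    have k : x * (1 - x⁻¹) = -1 * (1 - x) := by
      rw [mul_sub, mul_inv_cancel₀ hx.1]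
      ring
    have e1 : pbInvSum x + pbInvSum (1 - x⁻¹) = pbInvSum (-1) + pbInvSum (1 - x) := by
      rw [← pbInvSum_mul h4 hx.1 hx2, k, pbInvSum_mul h4 hneg.1 hx'.1]
    rw [← pbExt_eq_pb hx, ← pbExt_eq_pb hx', three_zsmul_pbExt_add_pbExt_one_sub hx.1 hx.2,
      add_right_comm, e1, add_assoc, pbInvSum_add_self h4 hx'.1, add_zero, pbInvSum,
      inv_neg_one, pbExt_eq_pb hneg, two_zsmul]
  refine ⟨key, ?_⟩
  have e := pbInvSum_add_self h4 hneg.1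
  rw [pbInvSum, inv_neg_one, pbExt_eq_pb hneg, ← two_zsmul (pb (-1) hneg), ← key, ← add_zsmul] at e
  exact e
end

section
/- Let F be a field with at least 4 elements and let c_F = [x] + [1 − x] ∈ P(F) for any x ∈ F♭ = F ∖ {0,1}. Then: (i) 3 c_F = 0 in P(F) if and only if char F = 2 or there exists i ∈ F with i² = −1; (ii) 2 c_F = 0 in P(F) if and only if there exists ω ∈ F with ω² = ω − 1 (in particular this holds automatically when char F = 3, where ω = −1 works). -/
open FreeAbelianGroup

namespace PreBloch

section FiveTerm

variable {F A : Type*} [Field F] [AddCommGroup A]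

/-- A function on `F` satisfying the five-term relation away from degenerate arguments. -/
def IsFiveTerm (b : F → A) : Prop :=
  ∀ x y : F, x ≠ 0 → x ≠ 1 → y ≠ 0 → y ≠ 1 → x ≠ y →
    b x - b y + b (y / x) - b ((1 - x⁻¹) / (1 - y⁻¹)) + b ((1 - x) / (1 - y)) = 0

variable {b : F → A}

theorem IsFiveTerm.add_one_sub (hb : IsFiveTerm b) {x y : F} (hx : x ≠ 0) (hx1 : x ≠ 1)
    (hy : y ≠ 0) (hy1 : y ≠ 1) : b x + b (1 - x) = b y + b (1 - y) := by
  by_cases hxy : x = y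
  · rw [hxy]
  have hx' : 1 - x ≠ 0 := sub_ne_zero.2 hx1.symm
  have hy' : 1 - y ≠ 0 := sub_ne_zero.2 hy1.symm
  have hyy : y - 1 ≠ 0 := sub_ne_zero.2 hy1
  have h1 := hb x y hx hx1 hy hy1 hxy
  have h2 := hb (1 - y) (1 - x) hy' (by simpa using hy) hx' (by simpa using hx)
    (by intro h; exact hxy (sub_right_injective h).symm)
  have e1 : (1 - (1 - y)⁻¹) / (1 - (1 - x)⁻¹) = (1 - x⁻¹) / (1 - y⁻¹) := by
    have h3 : 1 - (1 - x)⁻¹ = - x / (1 - x) := by field_simp; ring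
    have h4 : 1 - y⁻¹ = (y - 1) / y := by field_simp
    rw [h3, h4]
    field_simp
    ring
  rw [e1] at h2
  simp only [sub_sub_cancel] at h2
  have h3 := h1.trans h2.symm
  rw [← sub_eq_zero] at h3 ⊢
  rw [← h3]
  abel

/-- The sum of the values at `z` and `z⁻¹`. -/
def invSum (b : F → A) (z : F) : A := b z + b z⁻¹

theorem invSum_inv (b : F → A) (z : F) : invSum b z⁻¹ = invSum b z := by
  simp [invSum, add_comm]

theorem IsFiveTerm.invSum_div (hb : IsFiveTerm b) {x y : F} (hx : x ≠ 0) (hx1 : x ≠ 1)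
    (hy : y ≠ 0) (hy1 : y ≠ 1) (hxy : x ≠ y) :
    invSum b (y / x) = invSum b y - invSum b x := by
  have h1 := hb x y hx hx1 hy hy1 hxy
  have h2 := hb x⁻¹ y⁻¹ (inv_ne_zero hx) (by simpa using hx1) (inv_ne_zero hy)
    (by simpa using hy1) (by simpa using hxy)
  have e1 : y⁻¹ / x⁻¹ = (y / x)⁻¹ := by field_simp
  rw [e1, inv_inv, inv_inv] at h2
  simp only [invSum]
  rw [← sub_eq_zero]
  have h3 := congrArg₂ (· + ·) h1 h2
  simp only [add_zero] at h3
  rw [← h3]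
  abel

theorem exists_avoiding_three {α : Type*}
    (h4 : ∃ a b c d : α, a ≠ b ∧ a ≠ c ∧ a ≠ d ∧ b ≠ c ∧ b ≠ d ∧ c ≠ d)
    (u v w : α) : ∃ x : α, x ≠ u ∧ x ≠ v ∧ x ≠ w := by
  by_contra! h
  obtain ⟨a, b, c, d, h1, h2, h3, h4, h5, h6⟩ := h4
  have h' : ∀ x, x = u ∨ x = v ∨ x = w := fun x => by
    by_contra! hx
    exact hx.2.2 (h x hx.1 hx.2.1)
  rcases h' a with rfl | rfl | rfl <;> rcases h' b with rfl | rfl | rfl <;>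
    rcases h' c with rfl | rfl | rfl <;> rcases h' d with rfl | rfl | rfl <;> contradiction

theorem IsFiveTerm.two_invSum (hb : IsFiveTerm b)
    (h4 : ∃ a b c d : F, a ≠ b ∧ a ≠ c ∧ a ≠ d ∧ b ≠ c ∧ b ≠ d ∧ c ≠ d)
    {z : F} (hz : z ≠ 0) (hz1 : z ≠ 1) : invSum b z + invSum b z = 0 := by
  obtain ⟨x, hx0, hx1, hx2⟩ := exists_avoiding_three h4 0 1 z⁻¹
  have hy1 : z * x ≠ 1 := fun h => hx2 (eq_inv_of_mul_eq_one_right h)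
  have hxy : x ≠ z * x := fun h => hz1 (by field_simp at h; exact h.symm)
  have h1 := hb.invSum_div hx0 hx1 (mul_ne_zero hz hx0) hy1 hxy
  have h2 := hb.invSum_div (mul_ne_zero hz hx0) hy1 hx0 hx1 hxy.symm
  rw [mul_div_assoc, div_self hx0, mul_one] at h1
  have e : x / (z * x) = z⁻¹ := by field_simp
  rw [e, invSum_inv] at h2
  nth_rewrite 1 [h1]
  rw [h2]
  abel

theorem IsFiveTerm.three_smul (hb : IsFiveTerm b) {x : F} (hx : x ≠ 0) (hx1 : x ≠ 1) :
    (3 : ℤ) • (b x + b (1 - x)) = invSum b x + invSum b (1 - x) + invSum b (1 - x⁻¹) := by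
  have hx' : 1 - x ≠ 0 := sub_ne_zero.2 hx1.symm
  have h1 := hb.add_one_sub hx hx1 (inv_ne_zero hx) (by simpa using hx1)
  have h2 := hb.add_one_sub hx hx1 (inv_ne_zero hx') (by simpa using hx)
  have e : 1 - (1 - x)⁻¹ = (1 - x⁻¹)⁻¹ := by
    have h3 : 1 - x⁻¹ = (x - 1) / x := by field_simp
    have : x - 1 ≠ 0 := sub_ne_zero.2 hx1
    rw [h3]; field_simp; ring
  rw [e] at h2
  have : (3 : ℤ) • (b x + b (1 - x)) =
      (b x + b (1 - x)) + (b x + b (1 - x)) + (b x + b (1 - x)) := by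
    abel
  rw [this]
  nth_rewrite 2 [h1]
  nth_rewrite 2 [h2]
  simp only [invSum]
  abel

theorem IsFiveTerm.three_smul_of_sq_eq_neg_one (hb : IsFiveTerm b)
    (h4 : ∃ a b c d : F, a ≠ b ∧ a ≠ c ∧ a ≠ d ∧ b ≠ c ∧ b ≠ d ∧ c ≠ d)
    (h2 : (2 : F) ≠ 0) {i : F} (hi : i ^ 2 = -1) :
    (3 : ℤ) • (b (-1) + b (1 - -1)) = 0 := by
  have hi0 : i ≠ 0 := by rintro rfl; simp at hi
  have hm1 : (-1 : F) ≠ 1 := fun h => h2 (by linear_combination -h)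
  have hi1 : i ≠ 1 := by rintro rfl; exact hm1 (by simpa using hi.symm)
  have hi2 : i ≠ -1 := by rintro rfl; exact hm1 (by simpa using hi.symm)
  rw [hb.three_smul (by simp) hm1]
  have e : (1 : F) - (-1)⁻¹ = 1 - -1 := by simp [inv_neg]
  rw [e, add_assoc, hb.two_invSum h4 (by norm_num [h2])
    (fun h => one_ne_zero (α := F) (by linear_combination h)), add_zero]
  have h := hb.invSum_div hi0 hi1 (neg_ne_zero.2 hi0) (fun h => hi2 (by rw [← h]; simp))
    (fun h => hi0 (by
      have : (2 : F) * i = 0 := by linear_combination h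
      simpa [h2] using this))
  have e1 : -i / i = -1 := by field_simp
  have e2 : -i = i⁻¹ := by field_simp; linear_combination -hi
  rw [e1, e2, invSum_inv] at h
  rw [h, sub_self]

theorem IsFiveTerm.three_smul_of_two_eq_zero (hb : IsFiveTerm b)
    (h4 : ∃ a b c d : F, a ≠ b ∧ a ≠ c ∧ a ≠ d ∧ b ≠ c ∧ b ≠ d ∧ c ≠ d)
    (h2 : (2 : F) = 0) {x : F} (hx : x ≠ 0) (hx1 : x ≠ 1) :
    (3 : ℤ) • (b x + b (1 - x)) = 0 := by
  have hx' : 1 - x ≠ 0 := sub_ne_zero.2 hx1.symm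
  have h := hb.invSum_div hx hx1 hx' (by simpa using hx)
    (fun h => one_ne_zero (α := F) (by linear_combination x * h2 - h))
  have e : 1 - x⁻¹ = (1 - x) / x := by field_simp; linear_combination (x - 1) * h2
  rw [hb.three_smul hx hx1, e, h]
  have := hb.two_invSum h4 hx' (by simpa using hx)
  rw [← this]
  abel

theorem IsFiveTerm.two_smul_of_sq (hb : IsFiveTerm b)
    (h4 : ∃ a b c d : F, a ≠ b ∧ a ≠ c ∧ a ≠ d ∧ b ≠ c ∧ b ≠ d ∧ c ≠ d)
    {ω : F} (hω : ω ^ 2 = ω - 1) : (2 : ℤ) • (b ω + b (1 - ω)) = 0 := by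
  have h0 : ω ≠ 0 := by rintro rfl; simp at hω
  have h1 : ω ≠ 1 := by rintro rfl; simp at hω
  have e : 1 - ω = ω⁻¹ := by field_simp; linear_combination -hω
  have := hb.two_invSum h4 h0 h1
  rw [e, two_zsmul]
  exact this

end FiveTerm

section Generators

variable {F : Type*} [Field F]

open Classical in
/-- The generator `[x]` of the pre-Bloch group, extended by zero to all of `F`. -/
noncomputable def gen (x : F) : PreBloch F := if h : x ≠ 0 ∧ x ≠ 1 then pb x h else 0

theorem pb_eq_gen (x : F) (hx : x ≠ 0 ∧ x ≠ 1) : pb x hx = gen x := by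
  rw [gen, dif_pos hx]

/-- The five terms attached to admissible arguments are admissible. -/
theorem five_term_admissible {x y : F} (hx : x ≠ 0 ∧ x ≠ 1) (hy : y ≠ 0 ∧ y ≠ 1) (hxy : x ≠ y) :
    (y / x ≠ 0 ∧ y / x ≠ 1) ∧
      ((1 - x⁻¹) / (1 - y⁻¹) ≠ 0 ∧ (1 - x⁻¹) / (1 - y⁻¹) ≠ 1) ∧
      ((1 - x) / (1 - y) ≠ 0 ∧ (1 - x) / (1 - y) ≠ 1) := by
  have hx' : 1 - x ≠ 0 := sub_ne_zero.2 hx.2.symm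
  have hy' : 1 - y ≠ 0 := sub_ne_zero.2 hy.2.symm
  have hxi : 1 - x⁻¹ ≠ 0 := sub_ne_zero.2 (by simpa using hx.2)
  have hyi : 1 - y⁻¹ ≠ 0 := sub_ne_zero.2 (by simpa using hy.2)
  refine ⟨⟨div_ne_zero hy.1 hx.1, ?_⟩, ⟨div_ne_zero hxi hyi, ?_⟩, ⟨div_ne_zero hx' hy', ?_⟩⟩
  · rw [Ne, div_eq_one_iff_eq hx.1]; exact hxy.symm
  · rw [Ne, div_eq_one_iff_eq hyi]
    intro h; exact hxy (inv_injective (sub_right_injective h))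
  · rw [Ne, div_eq_one_iff_eq hy']
    intro h; exact hxy (sub_right_injective h)

theorem isFiveTerm_gen : IsFiveTerm (gen : F → PreBloch F) := by
  intro x y hx0 hx1 hy0 hy1 hxy
  have hx : x ≠ 0 ∧ x ≠ 1 := ⟨hx0, hx1⟩
  have hy : y ≠ 0 ∧ y ≠ 1 := ⟨hy0, hy1⟩
  obtain ⟨h1, h2, h3⟩ := five_term_admissible hx hy hxy
  rw [← pb_eq_gen x hx, ← pb_eq_gen y hy, ← pb_eq_gen _ h1, ← pb_eq_gen _ h2, ← pb_eq_gen _ h3]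
  have : (QuotientAddGroup.mk (of (⟨x, hx⟩ : {x : F // x ≠ 0 ∧ x ≠ 1}) - of ⟨y, hy⟩
      + of ⟨y / x, h1⟩ - of ⟨(1 - x⁻¹) / (1 - y⁻¹), h2⟩ + of ⟨(1 - x) / (1 - y), h3⟩) :
      PreBloch F) = 0 := by
    rw [QuotientAddGroup.eq_zero_iff]
    exact AddSubgroup.subset_closure ⟨x, y, hx, hy, hxy, h1, h2, h3, rfl⟩
  exact this

end Generators

end PreBloch

namespace CyclicDilog

open Matrix Finset

section Cocycle

variable {M : Type*} [Field M] {n : ℕ} [NeZero n]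

/-- A function on `ZMod n` with multiplicative increments `u`. -/
def cumProd (u : ZMod n → M) (k : ZMod n) : M := ∏ j ∈ range k.val, u j

theorem prod_range_natCast (u : ZMod n → M) : ∏ j ∈ range n, u j = ∏ k, u k := by
  refine prod_bij' (fun j _ => (j : ZMod n)) (fun k _ => k.val) (by simp)
    (fun k _ => mem_range.2 k.val_lt) (fun j hj => ?_) (by simp) (by simp)
  exact ZMod.val_cast_of_lt (mem_range.1 hj)

theorem cumProd_add_one (u : ZMod n → M) (hu : ∏ j ∈ range n, u j = 1) (k : ZMod n) :
    cumProd u (k + 1) = cumProd u k * u k := by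
  have hk : cumProd u k * u k = ∏ j ∈ range (k.val + 1), u j := by
    rw [prod_range_succ, ZMod.natCast_zmod_val]; rfl
  rw [hk]
  rcases (Nat.succ_le_of_lt k.val_lt).lt_or_eq with h | h
  · have h1 : (1 : ZMod n).val = 1 := ZMod.val_one'' (by omega)
    rw [cumProd, ZMod.val_add_of_lt (by rwa [h1]), h1]
  · have h' : k.val + 1 = n := h
    have : k + 1 = 0 := by
      rw [← ZMod.natCast_zmod_val k, ← Nat.cast_one, ← Nat.cast_add, h', ZMod.natCast_self]
    rw [this, h', hu, cumProd]
    simp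

theorem cumProd_ne_zero (u : ZMod n → M) (hu : ∏ j ∈ range n, u j = 1) (k : ZMod n) :
    cumProd u k ≠ 0 := by
  refine prod_ne_zero_iff.2 fun j hj => ?_
  refine prod_ne_zero_iff.1 (hu ▸ one_ne_zero) j (mem_range.2 ((mem_range.1 hj).trans k.val_lt))

theorem prod_prod_range_mul (v : ℕ → M) (n : ℕ) :
    (∏ k ∈ range n, ∏ j ∈ range k, v j) * ∏ j ∈ range n, v j ^ (j + 1) =
      (∏ j ∈ range n, v j) ^ n := by
  induction n with
  | zero => simp
  | succ n ih =>
    rw [prod_range_succ, prod_range_succ (fun j => v j ^ (j + 1)), prod_range_succ v, mul_pow,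
      pow_succ (∏ j ∈ range n, v j), ← ih]
    ring

theorem prod_cumProd_mul (u : ZMod n → M) (hu : ∏ j ∈ range n, u j = 1) :
    (∏ k, cumProd u k) * ∏ j ∈ range n, u j ^ j = 1 := by
  have h := prod_prod_range_mul (fun j => u (j : ZMod n)) n
  simp only [pow_succ, prod_mul_distrib, hu, one_pow, mul_one] at h
  rw [← h, ← prod_range_natCast]
  congr 1
  refine prod_congr rfl fun k hk => ?_
  rw [cumProd, ZMod.val_cast_of_lt (mem_range.1 hk)]

end Cocycle

section Abstract

variable {M R : Type*} [Field M] [Ring R] [Algebra M R]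

/-- The first commutation relation behind the noncommutative pentagon identity. -/
theorem pentagon_mul_U {U V A B C : R} {s t p r q : M} (hp : p ≠ 0) (hr : r ≠ 0) (hq : q ≠ 0)
    (hAU : A * U = U * A)
    (hVA : (p / q) • (V * A) = A * (1 - (s / r) • U) * V)
    (hBU : (r / q) • (B * U) = U * (1 - (t / p) • V) * B)
    (hCW : C * (U * V) = U * V * C)
    (hCU : q • (C * U) = U * (1 + (s * t * q / (p * r)) • (U * V)) * C) :
    r • (A * C * B * U) = U * (1 - t • V) * (A * C * B) := by
  have hVA' : V * A = (q / p) • (A * V) - (q / p * (s / r)) • (U * (A * V)) := by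
    have : V * A = (q / p) • ((p / q) • (V * A)) := by
      rw [smul_smul, div_mul_div_cancel₀ hp, div_self hq, one_smul]
    rw [this, hVA]
    simp only [mul_sub, sub_mul, mul_one, mul_smul_comm, smul_mul_assoc, smul_sub, smul_smul, hAU,
      mul_assoc]
  have hBU' : B * U = (q / r) • (U * B) - (q / r * (t / p)) • (U * (V * B)) := by
    have : B * U = (q / r) • ((r / q) • (B * U)) := by
      rw [smul_smul, div_mul_div_cancel₀ hr, div_self hq, one_smul]
    rw [this, hBU]
    simp only [mul_sub, sub_mul, mul_one, mul_smul_comm, smul_mul_assoc, smul_sub, smul_smul,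
      mul_assoc]
  have hCU' : C * U = q⁻¹ • (U * C) + (q⁻¹ * (s * t * q / (p * r))) • (U * (U * (V * C))) := by
    have : C * U = q⁻¹ • (q • (C * U)) := by rw [smul_smul, inv_mul_cancel₀ hq, one_smul]
    rw [this, hCU]
    simp only [mul_add, add_mul, mul_one, mul_smul_comm, smul_mul_assoc, smul_add, smul_smul,
      mul_assoc]
  have e1 : C * (U * B) = q⁻¹ • (U * (C * B))
      + (q⁻¹ * (s * t * q / (p * r))) • (U * (U * (V * (C * B)))) := by
    rw [← mul_assoc, hCU']
    simp only [add_mul, smul_mul_assoc, mul_assoc]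
  have e2 : C * (U * (V * B)) = U * (V * (C * B)) := by
    rw [← mul_assoc U V B, ← mul_assoc C, hCW]
    simp only [mul_assoc]
  have e3 : ∀ X, A * (U * X) = U * (A * X) := fun X => by
    rw [← mul_assoc, hAU, mul_assoc]
  have e4 : V * (A * (C * B)) = (q / p) • (A * (V * (C * B)))
      - (q / p * (s / r)) • (U * (A * (V * (C * B)))) := by
    rw [← mul_assoc, hVA']
    simp only [sub_mul, smul_mul_assoc, mul_assoc]
  have hl : A * C * B * U = A * (C * (B * U)) := by simp only [mul_assoc]
  rw [hl, hBU']
  simp only [mul_sub, sub_mul, mul_add, mul_one, mul_smul_comm, smul_mul_assoc, mul_assoc, e1, e2,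
    e3, e4]
  match_scalars <;> field_simp

/-- The second commutation relation behind the noncommutative pentagon identity. -/
theorem V_mul_pentagon {U V A B C : R} {s t p r q : M} (hp : p ≠ 0) (hr : r ≠ 0) (hq : q ≠ 0)
    (hVA : (p / q) • (V * A) = A * (1 - (s / r) • U) * V)
    (hBV : B * V = V * B)
    (hBU : (r / q) • (B * U) = U * (1 - (t / p) • V) * B)
    (hCW : C * (U * V) = U * V * C)
    (hCV : q • (V * C) = C * (1 + (s * t * q / (p * r)) • (U * V)) * V) :
    p • (V * (A * C * B)) = A * C * B * (1 - s • U) * V := by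
  have hVA' : V * A = (q / p) • (A * V) - (q / p * (s / r)) • (A * (U * V)) := by
    have : V * A = (q / p) • ((p / q) • (V * A)) := by
      rw [smul_smul, div_mul_div_cancel₀ hp, div_self hq, one_smul]
    rw [this, hVA]
    simp only [mul_sub, sub_mul, mul_one, mul_smul_comm, smul_mul_assoc, smul_sub, smul_smul,
      mul_assoc]
  have hBU' : B * U = (q / r) • (U * B) - (q / r * (t / p)) • (U * (B * V)) := by
    have : B * U = (q / r) • ((r / q) • (B * U)) := by
      rw [smul_smul, div_mul_div_cancel₀ hr, div_self hq, one_smul]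
    rw [this, hBU, hBV]
    simp only [mul_sub, sub_mul, mul_one, mul_smul_comm, smul_mul_assoc, smul_sub, smul_smul,
      mul_assoc]
  have hCV' : V * C = q⁻¹ • (C * V) + (q⁻¹ * (s * t * q / (p * r))) • (C * (U * (V * V))) := by
    have : V * C = q⁻¹ • (q • (V * C)) := by rw [smul_smul, inv_mul_cancel₀ hq, one_smul]
    rw [this, hCV]
    simp only [mul_add, add_mul, mul_one, mul_smul_comm, smul_mul_assoc, smul_add, smul_smul,
      mul_assoc]
  have e1 : V * (C * B) = q⁻¹ • (C * (B * V))
      + (q⁻¹ * (s * t * q / (p * r))) • (C * (U * (B * (V * V)))) := by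
    have h3 : V * (V * B) = B * (V * V) := by rw [← hBV, ← mul_assoc, ← hBV, mul_assoc]
    rw [← mul_assoc, hCV']
    simp only [add_mul, smul_mul_assoc, mul_assoc, h3]
    rw [← hBV]
  have e2 : U * (V * (C * B)) = C * (U * (B * V)) := by
    rw [← mul_assoc U V, ← mul_assoc, ← hCW, mul_assoc, mul_assoc, ← hBV]
  have e4 : V * (A * (C * B)) = (q / p) • (A * (V * (C * B)))
      - (q / p * (s / r)) • (A * (U * (V * (C * B)))) := by
    rw [← mul_assoc, hVA']
    simp only [sub_mul, smul_mul_assoc, mul_assoc]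
  have e5 : B * (U * V) = (q / r) • (U * (B * V)) - (q / r * (t / p)) • (U * (B * (V * V))) := by
    rw [← mul_assoc, hBU']
    simp only [sub_mul, smul_mul_assoc, mul_assoc]
  rw [mul_assoc A C B, e4, e2, e1]
  simp only [mul_sub, sub_mul, mul_add, mul_one, mul_smul_comm, smul_mul_assoc, mul_assoc, e5]
  match_scalars <;> field_simp

end Abstract

section Shift

variable {M : Type*} [Field M] {n : ℕ} {ζ : M}

theorem one_sub_pow_mul_ne_zero (hζ : IsPrimitiveRoot ζ n) {a : M} (ha : a ^ n ≠ 1) (i : ℕ) :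
    1 - ζ ^ i * a ≠ 0 := by
  intro h
  apply ha
  rw [sub_eq_zero] at h
  rw [← one_pow n, h, mul_pow, ← pow_mul, mul_comm i, pow_mul, hζ.pow_eq_one, one_pow, one_mul]

/-- The cyclic dilogarithm product `∏ i < n, (1 - ζ ^ i * a) ^ i`. -/
def dilogProd (ζ : M) (n : ℕ) (a : M) : M := ∏ i ∈ range n, (1 - ζ ^ i * a) ^ i

theorem dilogProd_ne_zero (hζ : IsPrimitiveRoot ζ n) {a : M} (ha : a ^ n ≠ 1) :
    dilogProd ζ n a ≠ 0 :=
  prod_ne_zero_iff.2 fun i _ => pow_ne_zero i (one_sub_pow_mul_ne_zero hζ ha i)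

variable [NeZero n]

/-- The character `k ↦ ζ ^ k` of `ZMod n`. -/
noncomputable abbrev rootChar (hζ : IsPrimitiveRoot ζ n) : AddChar (ZMod n) M :=
  AddChar.zmodChar n hζ.pow_eq_one

theorem rootChar_natCast (hζ : IsPrimitiveRoot ζ n) (k : ℕ) :
    rootChar hζ (k : ZMod n) = ζ ^ k := AddChar.zmodChar_apply' _ _

theorem rootChar_injective (hζ : IsPrimitiveRoot ζ n) : Function.Injective (rootChar hζ) := by
  intro a b h
  rw [AddChar.zmodChar_apply, AddChar.zmodChar_apply] at h
  exact ZMod.val_injective n (hζ.pow_inj a.val_lt b.val_lt h)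

theorem rootChar_mul_neg (hζ : IsPrimitiveRoot ζ n) (k : ZMod n) :
    rootChar hζ k * rootChar hζ (-k) = 1 := by
  rw [← AddChar.map_add_eq_mul, add_neg_cancel, AddChar.map_zero_eq_one]

/-- The diagonal clock matrix. -/
noncomputable def clock (hζ : IsPrimitiveRoot ζ n) : Matrix (ZMod n) (ZMod n) M :=
  diagonal (rootChar hζ)

/-- The inverse of the clock matrix. -/
noncomputable def clockInv (hζ : IsPrimitiveRoot ζ n) : Matrix (ZMod n) (ZMod n) M :=
  diagonal fun k => rootChar hζ (-k)

variable (M n) in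
/-- The cyclic shift matrix. -/
def shift : Matrix (ZMod n) (ZMod n) M := fun i j => if j = i + 1 then 1 else 0

theorem clock_mul_clockInv (hζ : IsPrimitiveRoot ζ n) : clock hζ * clockInv hζ = 1 := by
  rw [clock, clockInv, diagonal_mul_diagonal, ← diagonal_one]
  congr 1
  funext k
  exact rootChar_mul_neg hζ k

theorem clockInv_mul_clock (hζ : IsPrimitiveRoot ζ n) : clockInv hζ * clock hζ = 1 := by
  rw [mul_eq_one_comm, clock_mul_clockInv]

theorem shift_mul_diagonal (g : ZMod n → M) :
    shift M n * diagonal g = diagonal (fun k => g (k + 1)) * shift M n := by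
  ext i j
  rw [mul_diagonal, diagonal_mul, shift]
  split_ifs with h <;> simp [h]

theorem diagonal_mul_clock (hζ : IsPrimitiveRoot ζ n) (g : ZMod n → M) :
    diagonal g * clock hζ = clock hζ * diagonal g := by
  simp only [clock, diagonal_mul_diagonal, mul_comm]

theorem isScalar_of_commute (hζ : IsPrimitiveRoot ζ n) {N : Matrix (ZMod n) (ZMod n) M}
    (hU : N * clock hζ = clock hζ * N) (hV : N * shift M n = shift M n * N) :
    ∃ c : M, N = c • 1 := by
  have hdiag : ∀ i j, i ≠ j → N i j = 0 := by
    intro i j hij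
    have h := congrFun (congrFun hU i) j
    rw [clock, mul_diagonal, diagonal_mul, ← sub_eq_zero] at h
    have h2 : N i j * (rootChar hζ j - rootChar hζ i) = 0 := by rw [← h]; ring
    exact (mul_eq_zero.1 h2).resolve_right
      (sub_ne_zero.2 fun h3 => hij (rootChar_injective hζ h3).symm)
  have hN : N = diagonal fun k => N k k := by
    ext i j
    by_cases h : i = j
    · rw [h, diagonal_apply_eq]
    · rw [hdiag i j h, diagonal_apply_ne _ h]
  have hstep : ∀ k, N (k + 1) (k + 1) = N k k := by
    intro k
    rw [hN, shift_mul_diagonal] at hV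
    have h := congrFun (congrFun hV k) (k + 1)
    rw [diagonal_mul, diagonal_mul, shift, if_pos rfl, mul_one, mul_one] at h
    exact h.symm
  have hconst : ∀ k : ℕ, N (k : ZMod n) k = N 0 0 := by
    intro k
    induction k with
    | zero => simp
    | succ k ih => rw [Nat.cast_succ, hstep, ih]
  refine ⟨N 0 0, ?_⟩
  rw [hN, smul_one_eq_diagonal]
  congr 1
  funext k
  rw [← ZMod.natCast_zmod_val k, hconst, diagonal_apply_eq]

/-- The discrete Fourier transform matrix conjugates the clock to the shift. -/
theorem exists_fourier (hζ : IsPrimitiveRoot ζ n) (hn : (n : M) ≠ 0) :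
    ∃ P : (Matrix (ZMod n) (ZMod n) M)ˣ, P.val * clock hζ = shift M n * P.val ∧
      P.val * shift M n = clockInv hζ * P.val := by
  let P : Matrix (ZMod n) (ZMod n) M := Matrix.of fun i j => rootChar hζ (i * j)
  let P' : Matrix (ZMod n) (ZMod n) M := Matrix.of fun i j => rootChar hζ (-(i * j))
  have hprim : (rootChar hζ).IsPrimitive := AddChar.zmodChar_primitive_of_primitive_root n hζ
  have hPP : P * P' = (n : M) • 1 := by
    ext i j
    rw [mul_apply, Matrix.smul_apply, one_apply]
    have : ∀ k ∈ univ, P i k * P' k j = rootChar hζ (k * (i - j)) := by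
      intro k _
      simp only [P, P', Matrix.of_apply]
      rw [← AddChar.map_add_eq_mul]
      congr 1
      ring
    rw [sum_congr rfl this, AddChar.sum_mulShift _ hprim]
    by_cases h : i = j
    · simp [h, ZMod.card]
    · simp [h, sub_ne_zero.2 h]
  have h1 : P * ((n : M)⁻¹ • P') = 1 := by
    rw [mul_smul_comm, hPP, smul_smul, inv_mul_cancel₀ hn, one_smul]
  refine ⟨⟨P, (n : M)⁻¹ • P', h1, mul_eq_one_comm.1 h1⟩, ?_, ?_⟩
  · ext i j
    rw [clock, mul_diagonal, mul_apply]
    simp only [shift, ite_mul, one_mul, zero_mul,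
      Finset.sum_ite_eq', mem_univ, if_true, P, Matrix.of_apply]
    rw [← AddChar.map_add_eq_mul]
    congr 1
    ring
  · ext i j
    rw [clockInv, diagonal_mul, mul_apply]
    simp only [shift, mul_ite, mul_one, mul_zero, P, Matrix.of_apply]
    have : ∀ k : ZMod n, j = k + 1 ↔ k = j - 1 := fun k =>
      ⟨fun h => by rw [h]; ring, fun h => by rw [h]; ring⟩
    simp only [this, Finset.sum_ite_eq', mem_univ, if_true]
    rw [← AddChar.map_add_eq_mul]
    congr 1
    ring

theorem prod_sub_pow_mul (hζ : IsPrimitiveRoot ζ n) (x y : M) :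
    ∏ i ∈ range n, (x - ζ ^ i * y) = x ^ n - y ^ n := by
  rw [hζ.pow_sub_pow_eq_prod_sub_mul x y (NeZero.pos n)]
  refine prod_nbij (ζ ^ ·) (fun i _ => ?_) (fun i hi j hj h => ?_) (fun x hx => ?_)
    (fun _ _ => rfl)
  · rw [Polynomial.mem_nthRootsFinset (NeZero.pos n), ← pow_mul, mul_comm, pow_mul, hζ.pow_eq_one,
      one_pow]
  · exact hζ.pow_inj (mem_range.1 hi) (mem_range.1 hj) h
  · rw [mem_coe, Polynomial.mem_nthRootsFinset (NeZero.pos n)] at hx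
    obtain ⟨i, hi, rfl⟩ := hζ.eq_pow_of_pow_eq_one hx
    exact ⟨i, mem_coe.2 (mem_range.2 hi), rfl⟩

theorem prod_one_sub_pow_mul (hζ : IsPrimitiveRoot ζ n) (a : M) :
    ∏ i ∈ range n, (1 - ζ ^ i * a) = 1 - a ^ n := by
  rw [prod_sub_pow_mul hζ, one_pow]

theorem one_sub_smul_clock (hζ : IsPrimitiveRoot ζ n) (s : M) :
    1 - s • clock hζ = diagonal fun k => 1 - rootChar hζ k * s := by
  rw [clock, ← diagonal_one, ← diagonal_smul, diagonal_sub]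
  congr 1
  funext k
  simp [mul_comm]

theorem isUnit_one_sub_smul_clock (hζ : IsPrimitiveRoot ζ n) {s : M} (hs : s ^ n ≠ 1) :
    IsUnit (1 - s • clock hζ) := by
  rw [one_sub_smul_clock, isUnit_iff_isUnit_det, det_diagonal, isUnit_iff_ne_zero]
  refine prod_ne_zero_iff.2 fun k _ => ?_
  rw [AddChar.zmodChar_apply]
  exact one_sub_pow_mul_ne_zero hζ hs _

theorem exists_dilogMatrix (hζ : IsPrimitiveRoot ζ n) {s p : M} (hp : p ≠ 0)
    (hsp : s ^ n + p ^ n = 1) :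
    ∃ A : (Matrix (ZMod n) (ZMod n) M)ˣ, A.val * clock hζ = clock hζ * A.val ∧
      p • (shift M n * A.val) = A.val * (1 - s • clock hζ) * shift M n ∧
      A.val.det * dilogProd ζ n s = p ^ (n * (n - 1) / 2) := by
  let u : ZMod n → M := fun k => (1 - rootChar hζ k * s) / p
  have hu1 : ∀ j : ℕ, u j = (1 - ζ ^ j * s) / p := fun j => by simp only [u, rootChar_natCast]
  have hu : ∏ j ∈ range n, u j = 1 := by
    simp only [hu1, prod_div_distrib, prod_const, card_range]
    rw [prod_one_sub_pow_mul hζ, div_eq_one_iff_eq (pow_ne_zero n hp)]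
    linear_combination -hsp
  have hdet : (diagonal (cumProd u)).det * dilogProd ζ n s = p ^ (n * (n - 1) / 2) := by
    have h := prod_cumProd_mul u hu
    have h2 : ∏ j ∈ range n, u j ^ j = dilogProd ζ n s / p ^ (n * (n - 1) / 2) := by
      simp only [hu1, div_pow, prod_div_distrib, dilogProd]
      rw [prod_pow_eq_pow_sum, Finset.sum_range_id]
    rw [h2, ← mul_div_assoc, div_eq_one_iff_eq (pow_ne_zero _ hp)] at h
    rw [det_diagonal, h]
  have hunit : IsUnit (diagonal (cumProd u)) := by
    rw [isUnit_iff_isUnit_det, det_diagonal, isUnit_iff_ne_zero]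
    exact prod_ne_zero_iff.2 fun k _ => cumProd_ne_zero u hu k
  refine ⟨hunit.unit, diagonal_mul_clock hζ _, ?_, hdet⟩
  rw [IsUnit.unit_spec, shift_mul_diagonal, ← smul_mul_assoc]
  congr 1
  rw [one_sub_smul_clock, diagonal_mul_diagonal, ← diagonal_smul]
  congr 1
  funext k
  rw [Pi.smul_apply, smul_eq_mul, cumProd_add_one u hu]
  generalize cumProd u k = c
  simp only [u]
  field_simp

end Shift

section Conj

variable {M R : Type*} [Field M] [Ring R] [Algebra M R]

theorem conj_commute {A Q : Rˣ} {U X : R} (hQ : Q.val * U = X * Q.val)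
    (hA : A.val * U = U * A.val) :
    (Q * A * Q⁻¹).val * X = X * (Q * A * Q⁻¹).val := by
  have hQ' : Q⁻¹.val * X = U * Q⁻¹.val := by
    rw [Units.inv_mul_eq_iff_eq_mul, ← mul_assoc, hQ, mul_assoc, Units.mul_inv, mul_one]
  simp only [Units.val_mul]
  rw [mul_assoc, hQ', ← mul_assoc, mul_assoc Q.val, hA, ← mul_assoc Q.val, hQ, mul_assoc, mul_assoc]
  simp only [mul_assoc]

theorem conj_dilog {A Q : Rˣ} {U V X Y : R} {s p : M} (hU : Q.val * U = X * Q.val)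
    (hV : Q.val * V = Y * Q.val)
    (hA : p • (V * A.val) = A.val * (1 - s • U) * V) :
    p • (Y * (Q * A * Q⁻¹).val) = (Q * A * Q⁻¹).val * (1 - s • X) * Y := by
  have hU' : Q⁻¹.val * X = U * Q⁻¹.val := by
    rw [Units.inv_mul_eq_iff_eq_mul, ← mul_assoc, hU, mul_assoc, Units.mul_inv, mul_one]
  have hV' : Q⁻¹.val * Y = V * Q⁻¹.val := by
    rw [Units.inv_mul_eq_iff_eq_mul, ← mul_assoc, hV, mul_assoc, Units.mul_inv, mul_one]
  simp only [Units.val_mul]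
  have e1 : Q⁻¹.val * (1 - s • X) = (1 - s • U) * Q⁻¹.val := by
    simp only [mul_sub, sub_mul, mul_one, one_mul, mul_smul_comm, smul_mul_assoc, hU']
  rw [mul_assoc (Q.val * A.val), e1, mul_assoc, mul_assoc, mul_assoc (1 - s • U), hV', ← mul_assoc Y,
    ← hV, mul_assoc Q.val V, ← mul_assoc V, ← mul_smul_comm, ← smul_mul_assoc, hA]
  simp only [mul_assoc]

end Conj

section Pentagon

variable {M : Type*} [Field M] {n : ℕ} [NeZero n] {ζ : M}

theorem neg_one_pow_mul_root (hζ : IsPrimitiveRoot ζ n) :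
    (-1) ^ n * ζ ^ (n * (n - 1) / 2) = -1 := by
  have h := prod_sub_pow_mul hζ 0 1
  simp only [mul_one, zero_sub, one_pow, zero_pow (NeZero.ne n), prod_neg, card_range] at h
  rw [prod_pow_eq_pow_sum, Finset.sum_range_id] at h
  exact h

/-- A diagonal matrix conjugating the shift to a multiple of clock times shift. -/
theorem exists_twist (hζ : IsPrimitiveRoot ζ n) {φ : M}
    (hφ : φ ^ n * ζ ^ (n * (n - 1) / 2) = 1) :
    ∃ G : (Matrix (ZMod n) (ZMod n) M)ˣ, G.val * clock hζ = clock hζ * G.val ∧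
      G.val * shift M n = (φ • (clock hζ * shift M n)) * G.val := by
  let u : ZMod n → M := fun k => (φ * rootChar hζ k)⁻¹
  have hφ0 : φ ≠ 0 := by
    rintro rfl
    rw [zero_pow (NeZero.ne n), zero_mul] at hφ
    exact zero_ne_one hφ
  have hχ : ∀ k, rootChar hζ k ≠ 0 := fun k => left_ne_zero_of_mul_eq_one (rootChar_mul_neg hζ k)
  have hu : ∏ j ∈ range n, u j = 1 := by
    simp only [u, rootChar_natCast, prod_inv_distrib, prod_mul_distrib, prod_const, card_range]
    rw [prod_pow_eq_pow_sum, Finset.sum_range_id, hφ, inv_one]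
  have hunit : IsUnit (diagonal (cumProd u)) := by
    rw [isUnit_iff_isUnit_det, det_diagonal, isUnit_iff_ne_zero]
    exact prod_ne_zero_iff.2 fun k _ => cumProd_ne_zero u hu k
  refine ⟨hunit.unit, diagonal_mul_clock hζ _, ?_⟩
  rw [IsUnit.unit_spec, smul_mul_assoc, mul_assoc, shift_mul_diagonal, ← mul_assoc,
    ← smul_mul_assoc]
  congr 1
  rw [clock, diagonal_mul_diagonal, ← diagonal_smul]
  congr 1
  funext k
  rw [Pi.smul_apply, smul_eq_mul, cumProd_add_one u hu]
  generalize cumProd u k = c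
  have := hχ k
  simp only [u]
  field_simp

theorem mul_clock_of_shift_mul (hζ : IsPrimitiveRoot ζ n) {B W : Matrix (ZMod n) (ZMod n) M} {t r : M}
    (hBW : B * W = W * B)
    (h : r • (clockInv hζ * B) = B * (1 - t • W) * clockInv hζ) :
    r • (B * clock hζ) = clock hζ * (1 - t • W) * B := by
  have e : clock hζ * (r • (clockInv hζ * B)) * clock hζ
      = clock hζ * (B * (1 - t • W) * clockInv hζ) * clock hζ := by rw [h]
  have hc : B * (1 - t • W) = (1 - t • W) * B := by
    simp only [mul_sub, sub_mul, mul_one, one_mul, mul_smul_comm, smul_mul_assoc, hBW]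
  rw [mul_smul_comm, ← mul_assoc, clock_mul_clockInv, one_mul, smul_mul_assoc, ← mul_assoc,
    mul_assoc _ (clockInv hζ), clockInv_mul_clock, mul_one, hc, ← mul_assoc] at e
  exact e

theorem dilogProd_pentagon (hζ : IsPrimitiveRoot ζ n) (hn : (n : M) ≠ 0) {s t p r q w φ : M}
    (hp : p ≠ 0) (hr : r ≠ 0) (hq : q ≠ 0) (hφ : φ ^ n * ζ ^ (n * (n - 1) / 2) = 1)
    (hsp : s ^ n + p ^ n = 1) (htr : t ^ n + r ^ n = 1)
    (hstq : q ^ n * (1 - s ^ n - t ^ n) = p ^ n * r ^ n)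
    (hw : w * φ = -(s * t * q / (p * r))) (hwq : w ^ n + q ^ n = 1) :
    ∃ c : M, c ≠ 0 ∧ dilogProd ζ n s * dilogProd ζ n t =
      c ^ n * q ^ (n * (n - 1) / 2) *
        (dilogProd ζ n (s / r) * dilogProd ζ n (t / p) * dilogProd ζ n w) := by
  have hpn := pow_ne_zero n hp
  have hrn := pow_ne_zero n hr
  have hqn := pow_ne_zero n hq
  have hsp' : (s / r) ^ n + (p / q) ^ n = 1 := by
    have e : (p / q) ^ n = (1 - s ^ n - t ^ n) / r ^ n := by
      rw [div_pow, div_eq_div_iff hqn hrn, ← hstq]; ring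
    rw [e, div_pow, ← add_div, div_eq_one_iff_eq hrn]
    linear_combination -htr
  have htr' : (t / p) ^ n + (r / q) ^ n = 1 := by
    have e : (r / q) ^ n = (1 - s ^ n - t ^ n) / p ^ n := by
      rw [div_pow, div_eq_div_iff hqn hpn]; linear_combination -hstq
    rw [e, div_pow, ← add_div, div_eq_one_iff_eq hpn]
    linear_combination -hsp
  obtain ⟨P, hPU, hPV⟩ := exists_fourier hζ hn
  obtain ⟨G, hGU, hGV⟩ := exists_twist hζ hφ
  obtain ⟨A, hAU, hAV, hAd⟩ := exists_dilogMatrix hζ hp hsp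
  obtain ⟨B, hBU, hBV, hBd⟩ := exists_dilogMatrix hζ hr htr
  obtain ⟨A', hAU', hAV', hAd'⟩ := exists_dilogMatrix hζ (div_ne_zero hp hq) hsp'
  obtain ⟨B', hBU', hBV', hBd'⟩ := exists_dilogMatrix hζ (div_ne_zero hr hq) htr'
  obtain ⟨C, hCU, hCV, hCd⟩ := exists_dilogMatrix hζ hq hwq
  have hQU : (G * P).val * clock hζ = (φ • (clock hζ * shift M n)) * (G * P).val := by
    rw [Units.val_mul, mul_assoc, hPU, ← mul_assoc, hGV, mul_assoc]
  have hGUi : G.val * clockInv hζ = clockInv hζ * G.val := by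
    have : G.val = clock hζ * G.val * clockInv hζ := by
      rw [← hGU, mul_assoc, clock_mul_clockInv, mul_one]
    nth_rewrite 2 [this]
    rw [mul_assoc, ← mul_assoc (clockInv hζ), clockInv_mul_clock, one_mul]
  have hQV : (G * P).val * shift M n = clockInv hζ * (G * P).val := by
    rw [Units.val_mul, mul_assoc, hPV, ← mul_assoc, hGUi, mul_assoc]
  have hφ0 : φ ≠ 0 := by
    rintro rfl
    rw [zero_pow (NeZero.ne n), zero_mul] at hφ
    exact zero_ne_one hφ
  have b1 := conj_commute hPU hBU
  have b2 := mul_clock_of_shift_mul hζ b1 (conj_dilog hPU hPV hBV)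
  have b1' := conj_commute hPU hBU'
  have b2' := mul_clock_of_shift_mul hζ b1' (conj_dilog hPU hPV hBV')
  have c1φ := conj_commute hQU hCU
  have c1 : (G * P * C * (G * P)⁻¹).val * (clock hζ * shift M n)
      = clock hζ * shift M n * (G * P * C * (G * P)⁻¹).val := by
    rw [mul_smul_comm, smul_mul_assoc] at c1φ
    exact smul_right_injective _ hφ0 c1φ
  have c2 := mul_clock_of_shift_mul hζ c1φ (conj_dilog hQU hQV hCV)
  have c3 := conj_dilog hQU hQV hCV
  rw [smul_smul, hw, neg_smul, sub_neg_eq_add] at c2 c3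
  set BB := P * B * P⁻¹
  set BB' := P * B' * P⁻¹
  set CC := G * P * C * (G * P)⁻¹
  have c4 : q • (shift M n * CC.val) =
      CC.val * (1 + (s * t * q / (p * r)) • (clock hζ * shift M n)) * shift M n := by
    have e1 : shift M n * CC.val = clockInv hζ * CC.val * (clock hζ * shift M n) := by
      rw [mul_assoc, c1, ← mul_assoc, ← mul_assoc, clockInv_mul_clock, one_mul]
    rw [e1, ← smul_mul_assoc, c3, mul_assoc, ← mul_assoc (clockInv hζ), clockInv_mul_clock, one_mul]
  have R1 := pentagon_mul_U hp hr hq hAU' hAV' b2' c1 c2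
  have R2 := V_mul_pentagon hp hr hq hAV' b1' b2' c1 c4
  have L1 : r • (BB.val * A.val * clock hζ)
      = clock hζ * (1 - t • shift M n) * (BB.val * A.val) := by
    rw [mul_assoc, hAU, ← mul_assoc, ← smul_mul_assoc, b2, mul_assoc, mul_assoc]
  have L2 : p • (shift M n * (BB.val * A.val))
      = BB.val * A.val * (1 - s • clock hζ) * shift M n := by
    rw [← mul_assoc, ← b1, mul_assoc, ← mul_smul_comm, hAV]
    simp only [mul_assoc]
  obtain ⟨c, hc⟩ : ∃ c : M, ((BB * A)⁻¹ * (A' * CC * BB')).val = c • 1 := by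
    set L := BB * A with hL
    have hL' : BB.val * A.val = L.val := rfl
    set R := A' * CC * BB' with hR
    have hR' : A'.val * CC.val * BB'.val = R.val := rfl
    rw [hL'] at L1 L2
    rw [hR'] at R1 R2
    have hsn : s ^ n ≠ 1 := fun h => hpn (by linear_combination hsp - h)
    have hU : (L⁻¹ * R).val * clock hζ = clock hζ * (L⁻¹ * R).val := by
      have key : ∀ X : (Matrix (ZMod n) (ZMod n) M)ˣ, r • (X.val * clock hζ)
          = clock hζ * (1 - t • shift M n) * X.val → X.val * clock hζ =
            (r⁻¹ • (clock hζ * (1 - t • shift M n))) * X.val := fun X hX => by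
        rw [smul_mul_assoc, ← hX, smul_smul, inv_mul_cancel₀ hr, one_smul]
      rw [Units.val_mul, mul_assoc, key _ R1, Units.inv_mul_eq_iff_eq_mul, ← mul_assoc,
        ← mul_assoc, key _ L1, mul_assoc _ L.val, Units.mul_inv, mul_one]
    refine isScalar_of_commute hζ hU ?_
    have hY : (L⁻¹ * R).val * ((1 - s • clock hζ) * shift M n) =
        (1 - s • clock hζ) * shift M n * (L⁻¹ * R).val := by
      rw [Units.val_mul, mul_assoc, ← mul_assoc R.val, ← R2, Units.inv_mul_eq_iff_eq_mul,
        ← mul_assoc, ← mul_assoc, ← mul_assoc, ← L2, smul_mul_assoc, mul_assoc, Units.mul_inv,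
        mul_one, smul_mul_assoc]
    have hU1 : (L⁻¹ * R).val * (1 - s • clock hζ) = (1 - s • clock hζ) * (L⁻¹ * R).val := by
      simp only [mul_sub, sub_mul, mul_one, one_mul, mul_smul_comm, smul_mul_assoc, hU]
    rw [← mul_assoc, hU1, mul_assoc, mul_assoc] at hY
    exact (isUnit_one_sub_smul_clock hζ hsn).mul_left_cancel hY
  have hc0 : c ≠ 0 := by
    rintro rfl
    rw [zero_smul] at hc
    exact Units.ne_zero _ hc
  have hdet : (A' * CC * BB').val.det = ((BB * A).val * (c • 1)).det := by
    rw [← hc, ← Units.val_mul, mul_inv_cancel_left]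
  have hconj : ∀ X Q : (Matrix (ZMod n) (ZMod n) M)ˣ, (Q * X * Q⁻¹).val.det = X.val.det :=
    fun X Q => by rw [Units.val_mul, Units.val_mul, det_units_conj]
  have dBB : BB.val.det = B.val.det := hconj _ _
  have dBB' : BB'.val.det = B'.val.det := hconj _ _
  have dCC : CC.val.det = C.val.det := hconj _ _
  clear_value BB BB' CC
  rw [Units.val_mul, Units.val_mul, Units.val_mul, det_mul, det_mul, det_mul, det_mul, det_smul,
    det_one, mul_one, ZMod.card, dBB, dBB', dCC] at hdet
  refine ⟨c, hc0, ?_⟩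
  generalize n * (n - 1) / 2 = N at *
  generalize dilogProd ζ n = Y at *
  have hdA : A.val.det ≠ 0 := ((isUnit_iff_isUnit_det _).1 A.isUnit).ne_zero
  have hdB : B.val.det ≠ 0 := ((isUnit_iff_isUnit_det _).1 B.isUnit).ne_zero
  generalize A.val.det = dA at *
  generalize B.val.det = dB at *
  generalize A'.val.det = dA' at *
  generalize B'.val.det = dB' at *
  generalize C.val.det = dC at *
  rw [div_pow, eq_div_iff (pow_ne_zero _ hq)] at hAd' hBd'
  refine mul_left_cancel₀ (mul_ne_zero hdA hdB) ?_
  linear_combination hAd * (dB * Y t) + p ^ N * hBd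
    + hdet * q ^ N * (Y (s / r) * Y (t / p) * Y w)
    - hCd * (dA' * dB' * q ^ N * Y (s / r) * Y (t / p)) - hAd' * (dB' * Y (t / p) * q ^ N)
    - p ^ N * hBd'

end Pentagon

section PowerSeriesRoot

variable {M : Type*} [Field M]

theorem exists_powerSeries_root {n : ℕ} (hn : (n : M) ≠ 0) {g : PowerSeries M}
    (hg : PowerSeries.constantCoeff g = 1) :
    ∃ f : PowerSeries M, f ^ n = g ∧ PowerSeries.constantCoeff f = 1 := by
  have hn0 : n ≠ 0 := by rintro rfl; simp at hn
  have hI : ∀ f : PowerSeries M, f ∈ Ideal.span {(PowerSeries.X : PowerSeries M)} ↔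
      PowerSeries.constantCoeff f = 0 := fun f => by
    rw [Ideal.mem_span_singleton, PowerSeries.X_dvd_iff]
  obtain ⟨f, hf, hf1⟩ := HenselianRing.is_henselian
    (I := Ideal.span {(PowerSeries.X : PowerSeries M)})
    (Polynomial.X ^ n - Polynomial.C g) (Polynomial.monic_X_pow_sub_C g hn0) 1
    (by rw [hI]; simp [hg])
    (by
      refine IsUnit.map _ ?_
      rw [PowerSeries.isUnit_iff_constantCoeff]
      rw [Polynomial.derivative_sub, Polynomial.derivative_C, Polynomial.derivative_X_pow]
      simp [hn])
  refine ⟨f, ?_, ?_⟩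
  · simpa [sub_eq_zero] using hf
  · rw [hI] at hf1
    simpa [sub_eq_zero] using hf1

end PowerSeriesRoot

section Map

variable {M L : Type*} [Field M] [CommRing L]

/-- The product defining `dilogProd`, over a commutative ring. -/
def ringDilogProd (ζ : L) (n : ℕ) (a : L) : L := ∏ i ∈ range n, (1 - ζ ^ i * a) ^ i

theorem map_ringDilogProd {L' : Type*} [CommRing L'] (φ : L →+* L') (ζ : L) (n : ℕ) (a : L) :
    φ (ringDilogProd ζ n a) = ringDilogProd (φ ζ) n (φ a) := by
  simp [ringDilogProd, map_prod]

theorem ringDilogProd_eq (ζ : M) (n : ℕ) (a : M) : ringDilogProd ζ n a = dilogProd ζ n a := rfl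

variable {n : ℕ} {ζ : M}

theorem dilogProd_zero : dilogProd ζ n 0 = 1 := by simp [dilogProd]

theorem dilogProd_one_ne_zero (hζ : IsPrimitiveRoot ζ n) : dilogProd ζ n 1 ≠ 0 := by
  refine prod_ne_zero_iff.2 fun i hi => ?_
  rcases Nat.eq_zero_or_pos i with rfl | h
  · simp
  · refine pow_ne_zero i ?_
    rw [mul_one, sub_ne_zero]
    exact (hζ.pow_ne_one_of_pos_of_lt h.ne' (mem_range.1 hi)).symm

variable [NeZero n]

theorem dilogProd_inv_mul_inv_of_isFractionRing (K : Type*) [Field K]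
    [Algebra (PowerSeries M) K] [IsFractionRing (PowerSeries M) K] (hζ : IsPrimitiveRoot ζ n) (hn : (n : M) ≠ 0) {α γ ε : M}
    (hα : α ≠ 0) (hγ : γ ≠ 0) (hε : ε ^ n = -1) (hαγ : α ^ n + γ ^ n = 1) :
    ∃ c : M, c ^ n * (α / (ε * γ)) ^ (n * (n - 1) / 2) *
      (dilogProd ζ n α⁻¹ * dilogProd ζ n γ⁻¹) = 1 := by
  have hn0 : n ≠ 0 := NeZero.ne n
  have hε0 : ε ≠ 0 := by
    rintro rfl
    rw [zero_pow hn0] at hε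
    simp at hε
  obtain ⟨p, hp, hp1⟩ := exists_powerSeries_root hn (g := 1 - PowerSeries.X ^ n)
    (by simp [hn0])
  obtain ⟨t, ht, ht1⟩ := exists_powerSeries_root hn
    (g := 1 - PowerSeries.C (α ^ n) * PowerSeries.X ^ n) (by simp [hn0])
  let ι : PowerSeries M →+* K := algebraMap (PowerSeries M) K
  have hι : Function.Injective ι := IsFractionRing.injective (PowerSeries M) K
  let j : M →+* K := ι.comp PowerSeries.C
  have hj : Function.Injective j := j.injective
  have hζK : IsPrimitiveRoot (j ζ) n := hζ.map_of_injective hj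
  have hnK : (n : K) ≠ 0 := by
    rw [← map_natCast j]; exact (map_ne_zero j).2 hn
  have hX : ι PowerSeries.X ≠ 0 := by
    rw [Ne, map_eq_zero_iff ι hι]; exact PowerSeries.X_ne_zero
  have hpu : p ≠ 0 := by rintro rfl; simp at hp1
  have hp0 : ι p ≠ 0 := by rwa [Ne, map_eq_zero_iff ι hι]
  have hα' : j α ≠ 0 := by simpa using hα
  have hγ' : j γ ≠ 0 := by simpa using hγ
  have hε' : j ε ≠ 0 := by simpa using hε0
  have hεn : j ε ^ n = -1 := by rw [← map_pow, hε]; simp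
  have hφ : (j ε ^ (n - 1)) ^ n * (j ζ) ^ (n * (n - 1) / 2) = 1 := by
    have h := neg_one_pow_mul_root hζK
    have h2 : (j ε ^ (n - 1)) ^ n * (-1) = (-1) ^ n := by
      rw [← pow_mul, Nat.mul_comm, pow_mul, hεn, ← pow_succ, Nat.sub_add_cancel
        (Nat.one_le_iff_ne_zero.2 hn0)]
    have h3 : ((-1 : K) ^ n) * (-1) ^ n = 1 := by
      rw [← mul_pow]; simp
    linear_combination (-(j ζ) ^ (n * (n - 1) / 2)) * h2 + (-1) * h
  have hpn : ι p ^ n = 1 - ι PowerSeries.X ^ n := by rw [← map_pow, hp]; simp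
  have htn : ι t ^ n = 1 - j α ^ n * ι PowerSeries.X ^ n := by
    rw [← map_pow, ht]; simp [j]
  have hγn : j γ ^ n = 1 - j α ^ n := by
    rw [← map_pow, ← map_pow, ← map_one j, ← map_sub]; congr 1; linear_combination hαγ
  have h := dilogProd_pentagon hζK hnK (s := ι PowerSeries.X) (t := ι t) (p := ι p)
    (r := j α * ι PowerSeries.X) (q := ι p * (j α / (j ε * j γ))) (w := ι t * (j γ)⁻¹)
    (φ := j ε ^ (n - 1)) hp0 (mul_ne_zero hα' hX)
    (mul_ne_zero hp0 (div_ne_zero hα' (mul_ne_zero hε' hγ'))) hφ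
    (by rw [hpn]; ring) (by rw [htn, mul_pow]; ring)
    (by
      rw [mul_pow, mul_pow, div_pow, mul_pow, htn, hεn, hγn]
      have : 1 - j α ^ n ≠ 0 := by rw [← hγn]; exact pow_ne_zero n hγ'
      field_simp
      ring)
    (by
      have : j ε ^ (n - 1) = - (j ε)⁻¹ := by
        rw [eq_neg_iff_add_eq_zero, ← mul_left_inj' hε', add_mul, ← pow_succ,
          Nat.sub_add_cancel (Nat.one_le_iff_ne_zero.2 hn0), hεn, inv_mul_cancel₀ hε']
        ring
      rw [this]
      field_simp)
    (by
      rw [mul_pow, mul_pow, div_pow, mul_pow, inv_pow, htn, hεn, hγn, hpn]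
      have : 1 - j α ^ n ≠ 0 := by rw [← hγn]; exact pow_ne_zero n hγ'
      field_simp
      ring)
  obtain ⟨c, hc0, hc⟩ := h
  have e1 : ι PowerSeries.X / (j α * ι PowerSeries.X) = ι (PowerSeries.C α⁻¹) := by
    have : ι (PowerSeries.C α⁻¹) = (j α)⁻¹ := map_inv₀ j α
    rw [this]; field_simp
  have e2 : ι t / ι p = ι (t * p⁻¹) := by
    rw [div_eq_iff hp0, ← map_mul, mul_assoc, PowerSeries.inv_mul_cancel, mul_one]
    simp [hp1]
  have e3 : ι t * (j γ)⁻¹ = ι (t * PowerSeries.C γ⁻¹) := by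
    rw [map_mul]; congr 1; exact (map_inv₀ j γ).symm
  have e4 : ι p * (j α / (j ε * j γ)) = ι (p * PowerSeries.C (α / (ε * γ))) := by
    have : ι (PowerSeries.C (α / (ε * γ))) = j α / (j ε * j γ) := by
      rw [← map_mul]; exact map_div₀ j _ _
    rw [map_mul, this]
  have e5 : j ζ = ι (PowerSeries.C ζ) := rfl
  rw [e1, e2, e3, e4, e5] at hc
  simp only [← ringDilogProd_eq, ← map_ringDilogProd, ← map_mul, ← map_pow] at hc
  have cY : ∀ a : PowerSeries M, PowerSeries.constantCoeff (ringDilogProd (PowerSeries.C ζ) n a)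
      = dilogProd ζ n (PowerSeries.constantCoeff a) := fun a => by
    rw [map_ringDilogProd, PowerSeries.constantCoeff_C, ringDilogProd_eq]
  set D := ringDilogProd (PowerSeries.C ζ) n PowerSeries.X * ringDilogProd (PowerSeries.C ζ) n t
    with hD
  have hD1 : PowerSeries.constantCoeff D = dilogProd ζ n 1 := by
    rw [hD, map_mul, cY, cY, ht1, PowerSeries.constantCoeff_X, dilogProd_zero, one_mul]
  rw [mul_assoc, ← map_mul] at hc
  set E := (p * PowerSeries.C (α / (ε * γ))) ^ (n * (n - 1) / 2) *
    (PowerSeries.C (ringDilogProd ζ n α⁻¹) *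
      ringDilogProd (PowerSeries.C ζ) n (t * p⁻¹) *
      ringDilogProd (PowerSeries.C ζ) n (t * PowerSeries.C γ⁻¹)) with hE
  have hE1 : PowerSeries.constantCoeff E = (α / (ε * γ)) ^ (n * (n - 1) / 2) *
      (dilogProd ζ n α⁻¹ * dilogProd ζ n 1 * dilogProd ζ n γ⁻¹) := by
    rw [hE, map_mul, map_mul, map_mul, cY, cY, PowerSeries.constantCoeff_C, ringDilogProd_eq, map_pow, map_mul, map_mul, map_mul,
      PowerSeries.constantCoeff_inv]
    simp [hp1, ht1]
  have hY1 := dilogProd_one_ne_zero hζ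
  have hDu : IsUnit D := by
    rw [PowerSeries.isUnit_iff_constantCoeff, hD1]; exact hY1.isUnit
  obtain ⟨u, hu⟩ := hDu
  have hci : c⁻¹ ^ n = ι (E * (↑u⁻¹ : PowerSeries M)) := by
    rw [inv_pow, map_mul]
    apply inv_eq_of_mul_eq_one_right
    have : ι (↑u⁻¹ : PowerSeries M) * ι D = 1 := by
      rw [← map_mul, ← hu, Units.inv_mul, map_one]
    rw [hc] at this
    linear_combination this
  obtain ⟨b, hb⟩ := IsIntegrallyClosed.exists_algebraMap_eq_of_isIntegral_pow
    (R := PowerSeries M) (K := K) (x := c⁻¹) (Nat.pos_of_ne_zero hn0)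
    (by rw [hci]; exact isIntegral_algebraMap)
  have hbE : b ^ n * D = E := by
    apply hι
    rw [map_mul, map_pow, hc]
    change (algebraMap _ K b) ^ n * _ = _
    rw [hb, inv_pow, inv_mul_cancel_left₀ (pow_ne_zero n hc0)]
  have hfin := congrArg PowerSeries.constantCoeff hbE
  rw [map_mul, map_pow, hD1, hE1] at hfin
  set b0 := PowerSeries.constantCoeff b
  have hfin' : b0 ^ n = (α / (ε * γ)) ^ (n * (n - 1) / 2) *
      (dilogProd ζ n α⁻¹ * dilogProd ζ n γ⁻¹) := by
    apply mul_right_cancel₀ hY1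
    linear_combination hfin
  have hα1 : α⁻¹ ^ n ≠ 1 := fun h => by
    rw [inv_pow, inv_eq_one] at h
    rw [h] at hαγ
    exact pow_ne_zero n hγ (by linear_combination hαγ)
  have hγ1 : γ⁻¹ ^ n ≠ 1 := fun h => by
    rw [inv_pow, inv_eq_one] at h
    rw [h] at hαγ
    exact pow_ne_zero n hα (by linear_combination hαγ)
  have hne : b0 ^ n ≠ 0 := by
    rw [hfin']
    exact mul_ne_zero (pow_ne_zero _ (div_ne_zero hα (mul_ne_zero hε0 hγ)))
      (mul_ne_zero (dilogProd_ne_zero hζ hα1) (dilogProd_ne_zero hζ hγ1))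
  exact ⟨b0⁻¹, by rw [mul_assoc, ← hfin', inv_pow, inv_mul_cancel₀ hne]⟩

theorem dilogProd_inv_mul_inv (hζ : IsPrimitiveRoot ζ n) (hn : (n : M) ≠ 0) {α γ ε : M}
    (hα : α ≠ 0) (hγ : γ ≠ 0) (hε : ε ^ n = -1) (hαγ : α ^ n + γ ^ n = 1) :
    ∃ c : M, c ^ n * (α / (ε * γ)) ^ (n * (n - 1) / 2) *
      (dilogProd ζ n α⁻¹ * dilogProd ζ n γ⁻¹) = 1 :=
  dilogProd_inv_mul_inv_of_isFractionRing (FractionRing (PowerSeries M)) hζ hn hα hγ hε hαγ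

end Map

section PowerClass

variable {M : Type*} [Field M]

/-- The group of nonzero elements of `M` modulo `n`-th powers, written additively. -/
def PowerClass (M : Type*) [Field M] (n : ℕ) : Type _ :=
  Additive (Mˣ ⧸ (powMonoidHom n : Mˣ →* Mˣ).range)

noncomputable instance (M : Type*) [Field M] (n : ℕ) : AddCommGroup (PowerClass M n) :=
  inferInstanceAs (AddCommGroup (Additive (Mˣ ⧸ (powMonoidHom n : Mˣ →* Mˣ).range)))

open Classical in
/-- The class of `z` modulo `n`-th powers, with value `0` at `z = 0`. -/
noncomputable def powerClass (n : ℕ) (z : M) : PowerClass M n :=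
  if h : z ≠ 0 then Additive.ofMul (QuotientGroup.mk (Units.mk0 z h)) else 0

theorem powerClass_of_ne_zero (n : ℕ) {z : M} (h : z ≠ 0) :
    powerClass n z = Additive.ofMul (QuotientGroup.mk (Units.mk0 z h)) := dif_pos h

theorem powerClass_mul (n : ℕ) {z w : M} (hz : z ≠ 0) (hw : w ≠ 0) :
    powerClass n (z * w) = powerClass n z + powerClass n w := by
  rw [powerClass_of_ne_zero n hz, powerClass_of_ne_zero n hw,
    powerClass_of_ne_zero n (mul_ne_zero hz hw), Units.mk0_mul, QuotientGroup.mk_mul]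
  rfl

theorem powerClass_eq_zero_iff (n : ℕ) {z : M} (hz : z ≠ 0) :
    powerClass n z = 0 ↔ ∃ c : M, c ^ n = z := by
  have h0 : powerClass n z = 0 ↔
      (QuotientGroup.mk (Units.mk0 z hz) : Mˣ ⧸ (powMonoidHom n : Mˣ →* Mˣ).range) = 1 := by
    rw [powerClass_of_ne_zero n hz]
    exact Iff.rfl
  rw [h0, QuotientGroup.eq_one_iff, MonoidHom.mem_range]
  constructor
  · rintro ⟨u, hu⟩
    refine ⟨u, ?_⟩
    have := congrArg (Units.val) hu
    simpa using this
  · rintro ⟨c, hc⟩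
    rcases Nat.eq_zero_or_pos n with rfl | hn
    · refine ⟨1, Units.ext ?_⟩
      simpa using hc
    · have hc0 : c ≠ 0 := by
        rintro rfl
        rw [zero_pow hn.ne'] at hc
        exact hz hc.symm
      exact ⟨Units.mk0 c hc0, Units.ext (by simpa using hc)⟩

theorem powerClass_pow_self (n : ℕ) (c : M) : powerClass n (c ^ n) = 0 := by
  by_cases h : c ^ n = 0
  · simp [powerClass, h]
  · exact (powerClass_eq_zero_iff n h).2 ⟨c, rfl⟩

theorem powerClass_one (n : ℕ) : powerClass n (1 : M) = 0 := by
  simpa using powerClass_pow_self n (1 : M)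

end PowerClass

section Inversion

variable {M : Type*} [Field M] {n : ℕ} [NeZero n] {ζ : M}

theorem prod_one_sub_pow_reflect (hζ : ζ ^ n = 1) (a : M) :
    (∏ i ∈ range n, (1 - (ζ ^ i)⁻¹ * a) ^ i) * dilogProd ζ n a =
      (∏ i ∈ range (n - 1), (1 - ζ ^ (i + 1) * a)) ^ n := by
  obtain ⟨m, rfl⟩ : ∃ m, n = m + 1 := ⟨n - 1, (Nat.succ_pred (NeZero.ne n)).symm⟩
  have hζ0 : ζ ≠ 0 := by rintro rfl; simp at hζ
  rw [dilogProd, prod_range_succ', prod_range_succ', ← prod_range_reflect, pow_zero, pow_zero,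
    mul_one, mul_one, ← prod_mul_distrib, Nat.add_sub_cancel, ← prod_pow]
  refine prod_congr rfl fun i hi => ?_
  have hi' := mem_range.1 hi
  have e : m - 1 - i + 1 = m - i := by omega
  have e2 : (ζ ^ (m - i))⁻¹ = ζ ^ (i + 1) := by
    apply inv_eq_of_mul_eq_one_right
    rw [← pow_add, ← hζ]
    congr 1; omega
  rw [e, e2, ← pow_add]
  congr 1; omega

theorem dilogProd_inv_mul (hζ : ζ ^ n = 1) {a : M} (ha : a ≠ 0) :
    dilogProd ζ n a⁻¹ * a ^ (n * (n - 1) / 2) * dilogProd ζ n a =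
      ((-1) ^ (n * (n - 1) / 2) * ζ ^ (∑ i ∈ range n, i * i)) *
        (∏ i ∈ range (n - 1), (1 - ζ ^ (i + 1) * a)) ^ n := by
  have hζ0 : ζ ≠ 0 := by
    rintro rfl; rw [zero_pow (NeZero.ne n)] at hζ; simp at hζ
  rw [← prod_one_sub_pow_reflect hζ, ← mul_assoc]
  congr 1
  rw [← sum_range_id, ← prod_pow_eq_pow_sum, ← prod_pow_eq_pow_sum, ← prod_pow_eq_pow_sum,
    dilogProd, ← prod_mul_distrib, ← prod_mul_distrib, ← prod_mul_distrib]
  refine prod_congr rfl fun i _ => ?_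
  rw [pow_mul, ← mul_pow, ← mul_pow, ← mul_pow]
  congr 1
  have := pow_ne_zero i hζ0
  field_simp
  ring

theorem dilogProd_root_mul (hζ : IsPrimitiveRoot ζ n) (a : M) :
    dilogProd ζ n (ζ * a) * (1 - a ^ n) = dilogProd ζ n a * (1 - a) ^ n := by
  rw [← prod_one_sub_pow_mul hζ]
  have h : ∏ i ∈ range n, (1 - ζ ^ (i + 1) * a) = ∏ i ∈ range n, (1 - ζ ^ i * a) := by
    have h1 := prod_range_succ (fun i => 1 - ζ ^ i * a) n
    rw [prod_range_succ', hζ.pow_eq_one, pow_zero] at h1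
    rw [prod_one_sub_pow_mul hζ a] at h1 ⊢
    have h2 := prod_one_sub_pow_mul hζ (ζ * a)
    rw [mul_pow, hζ.pow_eq_one, one_mul] at h2
    rw [← h2]
    refine prod_congr rfl fun i _ => ?_
    ring
  rw [← h, dilogProd, dilogProd, ← prod_mul_distrib]
  have h3 := prod_range_succ (fun i => (1 - ζ ^ i * a) ^ i) n
  rw [prod_range_succ', hζ.pow_eq_one, pow_zero, mul_one, one_mul] at h3
  rw [← h3]
  refine prod_congr rfl fun i _ => ?_
  ring

end Inversion

theorem pow_sub_one_pow_mul_root {M : Type*} [Field M] {n : ℕ} [NeZero n] {ζ : M}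
    (hζ : IsPrimitiveRoot ζ n) {ε : M} (hε : ε ^ n = -1) :
    (ε ^ (n - 1)) ^ n * ζ ^ (n * (n - 1) / 2) = 1 := by
  have h := neg_one_pow_mul_root hζ
  have h2 : (ε ^ (n - 1)) ^ n * (-1) = (-1) ^ n := by
    rw [← pow_mul, Nat.mul_comm, pow_mul, hε, ← pow_succ, Nat.sub_add_cancel
      (Nat.one_le_iff_ne_zero.2 (NeZero.ne n))]
  have h3 : ((-1 : M) ^ n) * (-1) ^ n = 1 := by
    rw [← mul_pow]; simp
  linear_combination (-ζ ^ (n * (n - 1) / 2)) * h2 + (-1) * h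

section Lift

variable {F₀ M : Type*} [Field F₀] [Field M] [Algebra F₀ M] {n : ℕ} [NeZero n] {ζ : M}

theorem exists_eq_pow_mul_of_pow_eq (hζ : IsPrimitiveRoot ζ n) {a b : M} (hb : b ≠ 0)
    (h : a ^ n = b ^ n) : ∃ k : ℕ, a = ζ ^ k * b := by
  obtain ⟨k, -, hk⟩ := hζ.eq_pow_of_pow_eq_one (ξ := a / b)
    (by rw [div_pow, h, div_self (pow_ne_zero n hb)])
  exact ⟨k, by rw [hk, div_mul_cancel₀ a hb]⟩

theorem algebraMap_ne_one {x : F₀} (h : x ≠ 1) : algebraMap F₀ M x ≠ 1 := by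
  rwa [Ne, ← map_one (algebraMap F₀ M), (algebraMap F₀ M).injective.eq_iff]

theorem algebraMap_ne_zero {x : F₀} (h : x ≠ 0) : algebraMap F₀ M x ≠ 0 := by
  rwa [Ne, ← map_zero (algebraMap F₀ M), (algebraMap F₀ M).injective.eq_iff]

theorem root_ne_zero {a : M} {x : F₀} (ha : a ^ n = algebraMap F₀ M x) (h : x ≠ 0) : a ≠ 0 := by
  rintro rfl
  rw [zero_pow (NeZero.ne n)] at ha
  exact algebraMap_ne_zero (M := M) h ha.symm

theorem dilogProd_root_ne_zero (hζ : IsPrimitiveRoot ζ n) {a : M} {x : F₀}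
    (ha : a ^ n = algebraMap F₀ M x) (h : x ≠ 1) : dilogProd ζ n a ≠ 0 :=
  dilogProd_ne_zero hζ (by rw [ha]; exact algebraMap_ne_one h)

theorem exists_dilogProd_class (hζ : IsPrimitiveRoot ζ n)
    (hroot : ∀ x : F₀, ∃ a : M, a ^ n = algebraMap F₀ M x) :
    ∃ h : F₀ → PowerClass M n, ∀ (a : M) (x : F₀), a ^ n = algebraMap F₀ M x → x ≠ 1 →
      powerClass n (dilogProd ζ n a) = h x := by
  choose ρ hρ using hroot
  refine ⟨fun x => powerClass n (dilogProd ζ n (ρ x)), fun a x ha hx => ?_⟩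
  rcases eq_or_ne x 0 with rfl | hx0
  · have h1 := hρ 0
    rw [map_zero] at ha h1
    rw [pow_eq_zero_iff (NeZero.ne n)] at ha h1
    simp only [ha, h1]
  obtain ⟨k, rfl⟩ := exists_eq_pow_mul_of_pow_eq hζ (root_ne_zero (hρ x) hx0)
    (ha.trans (hρ x).symm)
  clear ha
  have key : ∀ b : M, b ^ n = algebraMap F₀ M x →
      powerClass n (dilogProd ζ n (ζ * b)) = powerClass n (dilogProd ζ n b) := by
    intro b hb
    have hb' : (ζ * b) ^ n = algebraMap F₀ M x := by rw [mul_pow, hζ.pow_eq_one, one_mul, hb]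
    have h1 := congrArg (powerClass n) (dilogProd_root_mul hζ b)
    obtain ⟨d, hd⟩ : ∃ d : M, d ^ n = 1 - b ^ n := ⟨ρ (1 - x), by rw [hρ, hb, map_sub, map_one]⟩
    have hne : 1 - b ^ n ≠ 0 := by
      rw [hb, sub_ne_zero]; exact (algebraMap_ne_one hx).symm
    have hb1 : 1 - b ≠ 0 := by
      simpa using one_sub_pow_mul_ne_zero hζ (a := b) (by rw [hb]; exact algebraMap_ne_one hx) 0
    rw [powerClass_mul n (dilogProd_root_ne_zero hζ hb' hx) hne,
      powerClass_mul n (dilogProd_root_ne_zero hζ hb hx) (pow_ne_zero n hb1),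
      powerClass_pow_self, ← hd, powerClass_pow_self, add_zero, add_zero] at h1
    exact h1
  induction k with
  | zero => simp
  | succ k ih =>
    rw [← ih, pow_succ', mul_assoc]
    exact key _ (by rw [mul_pow, ← pow_mul, mul_comm k, pow_mul, hζ.pow_eq_one, one_pow, one_mul, hρ])

theorem exists_root_class (hζ : IsPrimitiveRoot ζ n)
    (hroot : ∀ x : F₀, ∃ a : M, a ^ n = algebraMap F₀ M x) :
    ∃ A : F₀ → PowerClass M n, ∀ (a : M) (x : F₀), a ^ n = algebraMap F₀ M x → x ≠ 0 →
      powerClass n (a ^ (n * (n - 1) / 2)) = A x := by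
  choose ρ hρ using hroot
  refine ⟨fun x => powerClass n (ρ x ^ (n * (n - 1) / 2)), fun a x ha hx => ?_⟩
  have h0 := root_ne_zero (hρ x) hx
  obtain ⟨k, rfl⟩ := exists_eq_pow_mul_of_pow_eq hζ h0 (ha.trans (hρ x).symm)
  have hζ0 : ζ ≠ 0 := hζ.ne_zero (NeZero.ne n)
  have hε : (ρ (-1)) ^ n = -1 := by rw [hρ]; simp
  have h1 : (-ρ (-1)) ^ n = ζ ^ (n * (n - 1) / 2) := by
    have h := neg_one_pow_mul_root hζ
    have h3 : ((-1 : M) ^ n) * (-1) ^ n = 1 := by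
      rw [← mul_pow]; simp
    rw [neg_pow, hε]
    linear_combination ζ ^ (n * (n - 1) / 2) * h3 - (-1) ^ n * h
  rw [mul_pow, powerClass_mul n (pow_ne_zero _ (pow_ne_zero k hζ0)) (pow_ne_zero _ h0), ← pow_mul,
    mul_comm k, pow_mul, ← h1, ← pow_mul, mul_comm n, pow_mul, powerClass_pow_self, zero_add]

variable {h A : F₀ → PowerClass M n}

theorem rootClass_mul (hroot : ∀ x : F₀, ∃ a : M, a ^ n = algebraMap F₀ M x)
    (hA : ∀ (a : M) (x : F₀), a ^ n = algebraMap F₀ M x → x ≠ 0 →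
      powerClass n (a ^ (n * (n - 1) / 2)) = A x) {x y : F₀} (hx : x ≠ 0) (hy : y ≠ 0) :
    A (x * y) = A x + A y := by
  obtain ⟨a, ha⟩ := hroot x
  obtain ⟨b, hb⟩ := hroot y
  rw [← hA a x ha hx, ← hA b y hb hy, ← powerClass_mul n (pow_ne_zero _ (root_ne_zero ha hx))
    (pow_ne_zero _ (root_ne_zero hb hy)), ← mul_pow]
  exact (hA _ _ (by rw [mul_pow, ha, hb, map_mul]) (mul_ne_zero hx hy)).symm

theorem rootClass_add_self (hroot : ∀ x : F₀, ∃ a : M, a ^ n = algebraMap F₀ M x)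
    (hA : ∀ (a : M) (x : F₀), a ^ n = algebraMap F₀ M x → x ≠ 0 →
      powerClass n (a ^ (n * (n - 1) / 2)) = A x) {x : F₀} (hx : x ≠ 0) :
    A x + A x = 0 := by
  obtain ⟨a, ha⟩ := hroot x
  have h0 := root_ne_zero ha hx
  have e : n * (n - 1) / 2 + n * (n - 1) / 2 = (n - 1) * n := by
    have := Nat.two_dvd_mul_sub_one n
    rw [mul_comm (n - 1)]
    omega
  rw [← hA a x ha hx, ← powerClass_mul n (pow_ne_zero _ h0) (pow_ne_zero _ h0), ← pow_add, e,
    pow_mul, powerClass_pow_self]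

theorem dilogClass_pentagon (hζ : IsPrimitiveRoot ζ n) (hn : (n : M) ≠ 0)
    (hroot : ∀ x : F₀, ∃ a : M, a ^ n = algebraMap F₀ M x)
    (hh : ∀ (a : M) (x : F₀), a ^ n = algebraMap F₀ M x → x ≠ 1 →
      powerClass n (dilogProd ζ n a) = h x)
    (hA : ∀ (a : M) (x : F₀), a ^ n = algebraMap F₀ M x → x ≠ 0 →
      powerClass n (a ^ (n * (n - 1) / 2)) = A x) {S T Q : F₀} (hS : S ≠ 1) (hT : T ≠ 1)
    (hST : S + T ≠ 1) (hQ : Q = (1 - S) * (1 - T) / (1 - S - T)) :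
    h S + h T = A Q + (h (S / (1 - T)) + h (T / (1 - S)) + h (1 - Q)) := by
  obtain ⟨s, hs⟩ := hroot S
  obtain ⟨t, ht⟩ := hroot T
  obtain ⟨p, hp⟩ := hroot (1 - S)
  obtain ⟨r, hr⟩ := hroot (1 - T)
  obtain ⟨q, hq⟩ := hroot Q
  obtain ⟨ε, hε'⟩ := hroot (-1)
  have hε : ε ^ n = -1 := by rw [hε']; simp
  have hS' : 1 - S ≠ 0 := sub_ne_zero.2 hS.symm
  have hT' : 1 - T ≠ 0 := sub_ne_zero.2 hT.symm
  have hST' : 1 - S - T ≠ 0 := fun H => hST (by linear_combination -H)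
  have hQ0 : Q ≠ 0 := by rw [hQ]; exact div_ne_zero (mul_ne_zero hS' hT') hST'
  have hp0 := root_ne_zero hp hS'
  have hr0 := root_ne_zero hr hT'
  have hq0 := root_ne_zero hq hQ0
  have hQ2 : 1 - Q = -(S * T * Q / ((1 - S) * (1 - T))) := by
    rw [hQ]; field_simp; ring
  have hw : (ε * (s * t * q / (p * r))) ^ n = algebraMap F₀ M (1 - Q) := by
    rw [hQ2, mul_pow, hε, div_pow, mul_pow, mul_pow, mul_pow, hs, ht, hq, hp, hr]
    simp only [map_neg, map_div₀, map_mul]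
    ring
  have hsr : (s / r) ^ n = algebraMap F₀ M (S / (1 - T)) := by rw [div_pow, hs, hr, map_div₀]
  have htp : (t / p) ^ n = algebraMap F₀ M (T / (1 - S)) := by rw [div_pow, ht, hp, map_div₀]
  have hsr1 : S / (1 - T) ≠ 1 := by
    rw [Ne, div_eq_one_iff_eq hT']; exact fun H => hST (by linear_combination H)
  have htp1 : T / (1 - S) ≠ 1 := by
    rw [Ne, div_eq_one_iff_eq hS']; exact fun H => hST (by linear_combination H)
  have hw1 : 1 - Q ≠ 1 := fun H => hQ0 (by linear_combination -H)
  obtain ⟨c, hc0, hc⟩ := dilogProd_pentagon hζ hn hp0 hr0 hq0 (pow_sub_one_pow_mul_root hζ hε)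
    (s := s) (t := t) (w := ε * (s * t * q / (p * r)))
    (by rw [hs, hp]; simp) (by rw [ht, hr]; simp)
    (by
      rw [hq, hs, ht, hp, hr, ← map_one (algebraMap F₀ M), ← map_sub, ← map_sub, ← map_mul,
        ← map_mul, hQ]
      congr 1
      field_simp)
    (by
      have : ε * ε ^ (n - 1) = -1 := by
        rw [← pow_succ', Nat.sub_add_cancel (Nat.one_le_iff_ne_zero.2 (NeZero.ne n)), hε]
      linear_combination (s * t * q / (p * r)) * this)
    (by rw [hw, hq]; simp)
  have hY1 := dilogProd_root_ne_zero hζ hsr hsr1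
  have hY2 := dilogProd_root_ne_zero hζ htp htp1
  have hY3 := dilogProd_root_ne_zero hζ hw hw1
  have := congrArg (powerClass n) hc
  rw [powerClass_mul n (dilogProd_root_ne_zero hζ hs hS) (dilogProd_root_ne_zero hζ ht hT),
    powerClass_mul n (mul_ne_zero (pow_ne_zero n hc0) (pow_ne_zero _ hq0))
      (mul_ne_zero (mul_ne_zero hY1 hY2) hY3),
    powerClass_mul n (pow_ne_zero n hc0) (pow_ne_zero _ hq0),
    powerClass_mul n (mul_ne_zero hY1 hY2) hY3, powerClass_mul n hY1 hY2, powerClass_pow_self,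
    zero_add, hh _ _ hs hS, hh _ _ ht hT, hh _ _ hsr hsr1, hh _ _ htp htp1, hh _ _ hw hw1,
    hA _ _ hq hQ0] at this
  exact this

theorem dilogClass_inv (hζ : IsPrimitiveRoot ζ n)
    (hroot : ∀ x : F₀, ∃ a : M, a ^ n = algebraMap F₀ M x)
    (hh : ∀ (a : M) (x : F₀), a ^ n = algebraMap F₀ M x → x ≠ 1 →
      powerClass n (dilogProd ζ n a) = h x)
    (hA : ∀ (a : M) (x : F₀), a ^ n = algebraMap F₀ M x → x ≠ 0 →
      powerClass n (a ^ (n * (n - 1) / 2)) = A x) {x : F₀} (hx : x ≠ 0) (hx1 : x ≠ 1) :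
    h x⁻¹ + A x + h x =
      powerClass n ((-1) ^ (n * (n - 1) / 2) * ζ ^ (∑ i ∈ range n, i * i)) := by
  obtain ⟨a, ha⟩ := hroot x
  have ha0 := root_ne_zero ha hx
  have hi : a⁻¹ ^ n = algebraMap F₀ M x⁻¹ := by rw [inv_pow, ha, map_inv₀]
  have hx1' : x⁻¹ ≠ 1 := by rwa [Ne, inv_eq_one]
  have hY := dilogProd_root_ne_zero hζ ha hx1
  have hY' := dilogProd_root_ne_zero hζ hi hx1'
  have hζ0 : ζ ≠ 0 := hζ.ne_zero (NeZero.ne n)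
  have e := congrArg (powerClass n) (dilogProd_inv_mul hζ.pow_eq_one ha0)
  rw [powerClass_mul n (mul_ne_zero hY' (pow_ne_zero _ ha0)) hY,
    powerClass_mul n hY' (pow_ne_zero _ ha0), powerClass_mul n (z := _ * _)
      (mul_ne_zero (pow_ne_zero _ (neg_ne_zero.2 one_ne_zero)) (pow_ne_zero _ hζ0))
      (pow_ne_zero n (prod_ne_zero_iff.2 fun i _ => one_sub_pow_mul_ne_zero hζ
        (by rw [ha]; exact algebraMap_ne_one hx1) (i + 1))), powerClass_pow_self, add_zero,
    hh _ _ hi hx1', hA _ _ ha hx, hh _ _ ha hx1] at e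
  exact e

theorem dilogClass_inv_add_inv (hζ : IsPrimitiveRoot ζ n) (hn : (n : M) ≠ 0)
    (hroot : ∀ x : F₀, ∃ a : M, a ^ n = algebraMap F₀ M x)
    (hh : ∀ (a : M) (x : F₀), a ^ n = algebraMap F₀ M x → x ≠ 1 →
      powerClass n (dilogProd ζ n a) = h x)
    (hA : ∀ (a : M) (x : F₀), a ^ n = algebraMap F₀ M x → x ≠ 0 →
      powerClass n (a ^ (n * (n - 1) / 2)) = A x) {x : F₀} (hx : x ≠ 0) (hx1 : x ≠ 1) :
    A (x / (-1 * (1 - x))) + (h x⁻¹ + h (1 - x)⁻¹) = 0 := by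
  obtain ⟨a, ha⟩ := hroot x
  obtain ⟨g, hg⟩ := hroot (1 - x)
  obtain ⟨ε, hε'⟩ := hroot (-1)
  have hε : ε ^ n = -1 := by rw [hε']; simp
  have h1x : 1 - x ≠ 0 := sub_ne_zero.2 hx1.symm
  have ha0 := root_ne_zero ha hx
  have hg0 := root_ne_zero hg h1x
  have hε0 := root_ne_zero hε' (neg_ne_zero.2 one_ne_zero)
  have hi : a⁻¹ ^ n = algebraMap F₀ M x⁻¹ := by rw [inv_pow, ha, map_inv₀]
  have hx1' : x⁻¹ ≠ 1 := by rwa [Ne, inv_eq_one]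
  have hj : g⁻¹ ^ n = algebraMap F₀ M (1 - x)⁻¹ := by rw [inv_pow, hg, map_inv₀]
  have hy1' : (1 - x)⁻¹ ≠ 1 := by
    rw [Ne, inv_eq_one]; exact fun H => hx (by linear_combination -H)
  have hq : (a / (ε * g)) ^ n = algebraMap F₀ M (x / (-1 * (1 - x))) := by
    rw [div_pow, mul_pow, ha, hε', hg, map_div₀, map_mul]
  have hq0 : x / (-1 * (1 - x)) ≠ 0 :=
    div_ne_zero hx (mul_ne_zero (neg_ne_zero.2 one_ne_zero) h1x)
  obtain ⟨c, hc⟩ := dilogProd_inv_mul_inv hζ hn ha0 hg0 hε (by rw [ha, hg]; simp)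
  have hY := dilogProd_root_ne_zero hζ hi hx1'
  have hY' := dilogProd_root_ne_zero hζ hj hy1'
  have hc0 : c ^ n ≠ 0 := fun H => by rw [H] at hc; simp at hc
  have hb0 := pow_ne_zero (n * (n - 1) / 2) (root_ne_zero hq hq0)
  have e := congrArg (powerClass n) hc
  rw [powerClass_mul n (mul_ne_zero hc0 hb0) (mul_ne_zero hY hY'), powerClass_mul n hc0 hb0,
    powerClass_mul n hY hY', powerClass_pow_self, zero_add, powerClass_one, hA _ _ hq hq0,
    hh _ _ hi hx1', hh _ _ hj hy1'] at e
  exact e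

end Lift

open Finset PreBloch

theorem exists_isFiveTerm {F₀ M : Type*} [Field F₀] [Field M] [Algebra F₀ M] {n : ℕ} [NeZero n]
    {ζ ε : M} (hζ : IsPrimitiveRoot ζ n) (hn : (n : M) ≠ 0)
    (hroot : ∀ x : F₀, ∃ a : M, a ^ n = algebraMap F₀ M x) (hε : ε ^ n = -1)
    {κ : PowerClass M n}
    (hκ : κ = powerClass n ((-1) ^ (n * (n - 1) / 2) * ζ ^ (∑ i ∈ range n, i * i)))
    (h3 : κ + κ + κ = 0) :
    ∃ b : F₀ → PowerClass M n, IsFiveTerm b ∧ ∀ x : F₀, x ≠ 0 → x ≠ 1 →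
      b x + b (1 - x) = κ + powerClass n (ε ^ (n * (n - 1) / 2)) := by
  obtain ⟨h, hh⟩ := exists_dilogProd_class hζ hroot
  obtain ⟨A, hA⟩ := exists_root_class hζ hroot
  have hε' : ε ^ n = algebraMap F₀ M (-1) := by rw [hε]; simp
  have hm : (-1 : F₀) ≠ 0 := neg_ne_zero.2 one_ne_zero
  rw [hA ε (-1) hε' hm]
  have hI : ∀ x : F₀, x ≠ 0 → x ≠ 1 → h x⁻¹ + A x + h x = κ := fun x hx hx1 => by
    rw [hκ]; exact dilogClass_inv hζ hroot hh hA hx hx1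
  have hAm : ∀ x y : F₀, x ≠ 0 → y ≠ 0 → A (x * y) = A x + A y := fun x y hx hy =>
    rootClass_mul hroot hA hx hy
  have hA2 : ∀ x : F₀, x ≠ 0 → A x + A x = 0 := fun x hx => rootClass_add_self hroot hA hx
  have hAd : ∀ x y : F₀, x ≠ 0 → y ≠ 0 → A (x / y) = A x + A y := fun x y hx hy => by
    have e := hAm (x / y) y (div_ne_zero hx hy) hy
    rw [div_mul_cancel₀ x hy] at e
    rw [e, add_assoc, hA2 y hy, add_zero]
  have hC : ∀ x : F₀, x ≠ 0 → x ≠ 1 → h x + h (1 - x) = κ + κ + A (-1) := fun x hx hx1 => by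
    have h1x : 1 - x ≠ 0 := sub_ne_zero.2 hx1.symm
    have e := dilogClass_inv_add_inv hζ hn hroot hh hA hx hx1
    rw [hAd x _ hx (mul_ne_zero hm h1x), hAm _ _ hm h1x] at e
    have e1 := hI x hx hx1
    have e2 := hI (1 - x) h1x (fun H => hx (by linear_combination -H))
    linear_combination (norm := module) e1 + e2 - e
  have hB : ∀ S T Q : F₀, S ≠ 1 → T ≠ 1 → S + T ≠ 1 → Q = (1 - S) * (1 - T) / (1 - S - T) →
    h S + h T = A Q + (h (S / (1 - T)) + h (T / (1 - S)) + h (1 - Q)) :=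
    fun S T Q hS hT hST hQ => dilogClass_pentagon hζ hn hroot hh hA hS hT hST hQ
  refine ⟨fun x => h x + (κ + A (-1)), ?_, fun x hx hx1 => ?_⟩
  · intro x y hx hx1 hy hy1 hxy
    have h1x : 1 - x ≠ 0 := sub_ne_zero.2 hx1.symm
    have h1y : 1 - y ≠ 0 := sub_ne_zero.2 hy1.symm
    have hyx : y - x ≠ 0 := sub_ne_zero.2 hxy.symm
    have hy1' : y - 1 ≠ 0 := sub_ne_zero.2 hy1
    set z := (1 - x⁻¹) / (1 - y⁻¹) with hz
    have hz' : z = y * (1 - x) / (x * (1 - y)) := by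
      rw [hz]
      have : 1 - y⁻¹ ≠ 0 := by rw [sub_ne_zero, ne_comm, Ne, inv_eq_one]; exact hy1
      rw [div_eq_div_iff this (mul_ne_zero hx h1y)]
      field_simp
      ring
    have hz1 : 1 - z = (y - x) / (x * (-1 * (1 - y))) := by
      rw [hz', eq_div_iff (mul_ne_zero hx (mul_ne_zero hm h1y))]
      field_simp
      ring
    have hz0 : z ≠ 0 := by
      rw [hz']; exact div_ne_zero (mul_ne_zero hy h1x) (mul_ne_zero hx h1y)
    have hz1' : 1 - z ≠ 0 := by
      rw [hz1]; exact div_ne_zero hyx (mul_ne_zero hx (mul_ne_zero hm h1y))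
    have b1 := hB x (1 - y) (y * (1 - x) / (y - x)) hx1 (fun H => hy (by linear_combination -H))
      (fun H => hxy (by linear_combination H)) (by
        rw [show 1 - x - (1 - y) = y - x by ring]; ring)
    rw [show x / (1 - (1 - y)) = (y / x)⁻¹ by rw [inv_div]; ring,
      show (1 - y) / (1 - x) = ((1 - x) / (1 - y))⁻¹ by rw [inv_div],
      show 1 - y * (1 - x) / (y - x) = (1 - z)⁻¹ by
        rw [hz1, inv_div]; field_simp; ring,
      hAd _ _ (mul_ne_zero hy h1x) hyx, hAm _ _ hy h1x] at b1
    have b2 := hI (y / x) (div_ne_zero hy hx) (by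
      rw [Ne, div_eq_one_iff_eq hx]; exact hxy.symm)
    rw [hAd _ _ hy hx] at b2
    have b3 := hI ((1 - x) / (1 - y)) (div_ne_zero h1x h1y) (by
      rw [Ne, div_eq_one_iff_eq h1y]; exact fun H => hxy (by linear_combination -H))
    rw [hAd _ _ h1x h1y] at b3
    have b4 := hI (1 - z) hz1' (fun H => hz0 (by linear_combination -H))
    rw [show A (1 - z) = A (y - x) + (A x + (A (-1) + A (1 - y))) by
      rw [hz1, hAd _ _ hyx (mul_ne_zero hx (mul_ne_zero hm h1y)),
        hAm _ _ hx (mul_ne_zero hm h1y), hAm _ _ hm h1y]] at b4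
    have b5 := hC y hy hy1
    have b6 := hC z hz0 (fun H => hz1' (by linear_combination -H))
    dsimp only
    linear_combination (norm := module) b1 + b2 + b3 + b4 - b5 - b6 - hA2 _ hx - hA2 _ hm
      - hA2 _ h1y
  · linear_combination (norm := module) hC x hx hx1 + h3 + hA2 _ hm
theorem six_mul_sum_range_sq (n : ℕ) :
    6 * ∑ i ∈ range (n + 1), i * i = n * (n + 1) * (2 * n + 1) := by
  induction n with
  | zero => simp
  | succ n ih => rw [sum_range_succ, mul_add, ih]; ring

section Values

variable {F₀ M : Type*} [Field F₀] [Field M] [Algebra F₀ M] {ζ : M} {k : ℕ}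

theorem exists_isFiveTerm_two_smul_ne_zero (hζ : IsPrimitiveRoot ζ (3 ^ (k + 1)))
    (h3 : (3 : M) ≠ 0) (hroot : ∀ x : F₀, ∃ a : M, a ^ 3 ^ (k + 1) = algebraMap F₀ M x)
    (hno : ∀ z : M, z ^ 3 ^ (k + 1) ≠ ζ ^ 3 ^ k) :
    ∃ b : F₀ → PowerClass M (3 ^ (k + 1)), IsFiveTerm b ∧ ∀ x : F₀, x ≠ 0 → x ≠ 1 →
      (2 : ℤ) • (b x + b (1 - x)) ≠ 0 := by
  set n := 3 ^ (k + 1) with hn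
  have hodd : Odd n := Odd.pow (by decide)
  have : NeZero n := ⟨pow_ne_zero _ (by norm_num)⟩
  have hζ0 : ζ ≠ 0 := hζ.ne_zero (NeZero.ne n)
  have hneg : ∀ m : ℕ, powerClass n ((-1 : M) ^ m) = 0 := fun m => by
    have : ((-1 : M) ^ m) = ((-1) ^ m) ^ n := by rw [pow_right_comm, hodd.neg_one_pow]
    rw [this, powerClass_pow_self]
  set ω := ζ ^ 3 ^ k with hω
  have hω0 : ω ≠ 0 := pow_ne_zero _ hζ0
  have hω3 : ω ^ 3 = 1 := by rw [hω, ← pow_mul, ← pow_succ, hζ.pow_eq_one]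
  obtain ⟨v, hv⟩ : ∃ v, ∑ i ∈ range n, i * i = 3 ^ k * (3 * v + 2) := by
    obtain ⟨m, hm⟩ : ∃ m, n = m + 1 := ⟨n - 1, by have := NeZero.pos n; omega⟩
    have h6 := six_mul_sum_range_sq m
    rw [← hm] at h6
    have e : n = 3 * 3 ^ k := by rw [hn, pow_succ']
    have h2 : 2 * ∑ i ∈ range n, i * i = 3 ^ k * (m * (2 * m + 1)) := by
      rw [e] at h6 ⊢; linarith
    have hd : 3 ^ k ∣ ∑ i ∈ range n, i * i :=
      (Nat.Coprime.dvd_of_dvd_mul_left (Nat.Coprime.pow_left k (by norm_num)) ⟨_, h2⟩)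
    obtain ⟨u, hu⟩ := hd
    rw [hu] at h2
    have h2' : 2 * u = m * (2 * m + 1) := by
      have : 0 < 3 ^ k := by positivity
      apply Nat.eq_of_mul_eq_mul_left this
      linarith
    obtain ⟨q, hq⟩ : ∃ q, m = 3 * q + 2 := ⟨3 ^ k - 1, by
      have : 0 < 3 ^ k := by positivity
      omega⟩
    refine ⟨u / 3, ?_⟩
    rw [hu]
    congr 1
    have : 2 * u = 3 * (6 * q ^ 2 + 9 * q + 3) + 1 := by rw [h2', hq]; ring
    omega
  have hκ : powerClass n ((-1 : M) ^ (n * (n - 1) / 2) * ζ ^ (∑ i ∈ range n, i * i)) =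
      powerClass n (ω ^ 2) := by
    rw [powerClass_mul n (pow_ne_zero _ (neg_ne_zero.2 one_ne_zero)) (pow_ne_zero _ hζ0), hneg,
      zero_add, hv, pow_mul, pow_add, pow_mul ω, hω3, one_pow, one_mul]
  have h3κ : powerClass n (ω ^ 2) + powerClass n (ω ^ 2) + powerClass n (ω ^ 2) = 0 := by
    have h := pow_ne_zero 2 hω0
    rw [← powerClass_mul n h h, ← powerClass_mul n (mul_ne_zero h h) h, ← powerClass_one n]
    congr 1
    linear_combination (ω ^ 3 + 1) * hω3
  obtain ⟨b, hb, hb'⟩ := exists_isFiveTerm (F₀ := F₀) hζ (by simp [hn, h3]) hroot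
    hodd.neg_one_pow hκ.symm h3κ
  refine ⟨b, hb, fun x hx hx1 h => ?_⟩
  rw [hb' x hx hx1, hneg, add_zero] at h
  have h0 : powerClass n (ω ^ 2) = 0 := by
    linear_combination (norm := module) h3κ - h
  obtain ⟨c, hc⟩ := (powerClass_eq_zero_iff n (pow_ne_zero 2 hω0)).1 h0
  refine hno (c ^ 2) ?_
  rw [pow_right_comm, hc]
  linear_combination ω * hω3

theorem exists_isFiveTerm_three_smul_ne_zero (hζ : IsPrimitiveRoot ζ (2 ^ (k + 2)))
    (h2 : (2 : M) ≠ 0) (hroot : ∀ x : F₀, ∃ a : M, a ^ 2 ^ (k + 2) = algebraMap F₀ M x)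
    (hno : ∀ z i : M, i ^ 2 = -1 → z ^ 2 ^ (k + 2) ≠ i) :
    ∃ b : F₀ → PowerClass M (2 ^ (k + 2)), IsFiveTerm b ∧ ∀ x : F₀, x ≠ 0 → x ≠ 1 →
      (3 : ℤ) • (b x + b (1 - x)) ≠ 0 := by
  obtain ⟨θ, hθ'⟩ := hroot (-1)
  have hm : ∃ m, 2 ^ k = m + 1 := ⟨2 ^ k - 1, by have : 0 < 2 ^ k := by positivity
                                                 omega⟩
  obtain ⟨m, hm⟩ := hm
  set n := 2 ^ (k + 2) with hn
  have hnm : n = 4 * m + 4 := by rw [hn, pow_add, hm]; ring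
  have : NeZero n := ⟨pow_ne_zero _ (by norm_num)⟩
  have hζ0 : ζ ≠ 0 := hζ.ne_zero (NeZero.ne n)
  have hθ : θ ^ n = -1 := by rw [hθ']; simp
  have hθ0 : θ ≠ 0 := by
    rintro rfl
    rw [zero_pow (NeZero.ne n)] at hθ
    simp at hθ
  have hN : n * (n - 1) / 2 = (2 * m + 2) * (4 * m + 3) := by
    rw [hnm]
    apply Nat.div_eq_of_eq_mul_left (by norm_num)
    rw [show 4 * m + 4 - 1 = 4 * m + 3 by omega]
    ring
  have hζh : ζ ^ (2 * m + 2) = -1 := by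
    have h1 : (ζ ^ (2 * m + 2)) ^ 2 = 1 := by
      rw [← pow_mul, show (2 * m + 2) * 2 = n by omega, hζ.pow_eq_one]
    rcases sq_eq_one_iff.1 h1 with h | h
    · exact absurd h (hζ.pow_ne_one_of_pos_of_lt (by omega) (by omega))
    · exact h
  have h3S : 3 * ∑ i ∈ range n, i * i = (2 * m + 2) * (2 * ((4 * m + 3) * (4 * m + 3)) + (4 * m + 3)) := by
    have h6 := six_mul_sum_range_sq (4 * m + 3)
    rw [show 4 * m + 3 + 1 = n by omega] at h6
    have : n * (4 * m + 3) = 2 * ((2 * m + 2) * (4 * m + 3)) := by rw [hnm]; ring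
    nlinarith
  set κ := powerClass n ((-1 : M) ^ (n * (n - 1) / 2) * ζ ^ (∑ i ∈ range n, i * i)) with hκ
  have hκ' : κ = powerClass n (ζ ^ (∑ i ∈ range n, i * i)) := by
    rw [hκ, hN]
    congr 1
    rw [Even.neg_one_pow, one_mul]
    exact Even.mul_right ⟨m + 1, by ring⟩ _
  have hm1 : powerClass n (-1 : M) = 0 := by rw [← hθ, powerClass_pow_self]
  have h3κ : κ + κ + κ = 0 := by
    have h := pow_ne_zero (∑ i ∈ range n, i * i) hζ0
    rw [hκ', ← powerClass_mul n h h, ← powerClass_mul n (mul_ne_zero h h) h, ← hm1]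
    congr 1
    rw [← pow_add, ← pow_add, show ∀ a : ℕ, a + a + a = 3 * a by intro a; ring, h3S, pow_mul, hζh]
    apply Odd.neg_one_pow
    exact ⟨(4 * m + 3) * (4 * m + 3) + 2 * m + 1, by ring⟩
  obtain ⟨b, hb, hb'⟩ := exists_isFiveTerm (F₀ := F₀) hζ (by simp [hn, h2]) hroot hθ hκ h3κ
  refine ⟨b, hb, fun x hx hx1 h => ?_⟩
  rw [hb' x hx hx1] at h
  set i := θ ^ (2 * m + 2) with hi
  have hi2 : i ^ 2 = -1 := by
    rw [hi, ← pow_mul, show (2 * m + 2) * 2 = n by omega, hθ]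
  have hi0 : i ≠ 0 := pow_ne_zero _ hθ0
  have hcl : powerClass n (θ ^ (n * (n - 1) / 2)) = powerClass n (-i) := by
    have e : θ ^ (n * (n - 1) / 2) = i ^ n * (-i) := by
      have h4 : i ^ 4 = 1 := by linear_combination (i ^ 2 - 1) * hi2
      rw [hN, pow_mul, ← hi, hnm, pow_add, pow_add, pow_mul, h4]
      simp only [one_pow, one_mul]
      linear_combination i * hi2
    rw [e, powerClass_mul n (pow_ne_zero n hi0) (neg_ne_zero.2 hi0), powerClass_pow_self, zero_add]
  have h2c : powerClass n (-i) + powerClass n (-i) = 0 := by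
    rw [← powerClass_mul n (neg_ne_zero.2 hi0) (neg_ne_zero.2 hi0), ← hm1]
    congr 1
    linear_combination hi2
  rw [hcl] at h
  have h0 : powerClass n (-i) = 0 := by
    linear_combination (norm := module) h - h3κ - h2c
  obtain ⟨c, hc⟩ := (powerClass_eq_zero_iff n (neg_ne_zero.2 hi0)).1 h0
  exact hno c (-i) (by rw [neg_sq, hi2]) hc

end Values

section AlgebraicElements

variable {k E ι κ : Type*} [Field k] [Field E] [Algebra k E]

theorem linearIndependent_adjoin_of_isAlgebraic {x : ι → E} (hx : AlgebraicIndependent k x)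
    {a : κ → algebraicClosure k E} (ha : LinearIndependent k a) :
    LinearIndependent (IntermediateField.adjoin k (Set.range x)) (fun i => (a i : E)) := by
  have hxA := hx.algebraicClosure
  have h : LinearIndependent (Algebra.adjoin k (Set.range x)) (fun i => (a i : E)) := by
    rw [linearIndependent_iff']
    intro s g hg i hi
    have hP : ∀ j, ∃ P : MvPolynomial ι k, MvPolynomial.aeval x P = (g j : E) := fun j => by
      exact (SetLike.ext_iff.1 (Algebra.adjoin_range_eq_range_aeval k x) _).1 (g j).2
    choose P hP using hP
    let Q : MvPolynomial ι (algebraicClosure k E) :=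
      ∑ j ∈ s, MvPolynomial.C (a j) * MvPolynomial.map (algebraMap k (algebraicClosure k E)) (P j)
    have hQ : Q = 0 := by
      apply hxA
      rw [map_zero, map_sum, ← hg]
      refine sum_congr rfl fun j _ => ?_
      rw [map_mul, MvPolynomial.aeval_map_algebraMap, hP, MvPolynomial.aeval_C, mul_comm]
      rfl
    have hPi : P i = 0 := by
      ext m
      have hc := congrArg (MvPolynomial.coeff m) hQ
      rw [MvPolynomial.coeff_sum] at hc
      simp only [MvPolynomial.coeff_C_mul, MvPolynomial.coeff_map, MvPolynomial.coeff_zero] at hc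
      have := linearIndependent_iff'.1 ha s (fun j => MvPolynomial.coeff m (P j))
        (by
          rw [← hc]
          refine sum_congr rfl fun j _ => ?_
          rw [Algebra.smul_def, mul_comm]) i hi
      simpa using this
    apply Subtype.ext
    rw [← hP i, hPi, map_zero]
    rfl
  open scoped IntermediateField.algebraAdjoinAdjoin in
  exact (LinearIndependent.iff_fractionRing (R := Algebra.adjoin k (Set.range x))
    (K := IntermediateField.adjoin k (Set.range x))).1 h

theorem finiteDimensional_algebraicClosure [Algebra.EssFiniteType k E] :
    FiniteDimensional k (algebraicClosure k E) := by
  obtain ⟨s, hs⟩ := exists_isTranscendenceBasis k E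
  let L := IntermediateField.adjoin k (Set.range ((↑) : s → E))
  have : Algebra.IsAlgebraic L E := hs.isAlgebraic_field
  have : Algebra.EssFiniteType L E := .of_comp k L E
  have : Module.Finite L E := Algebra.finite_of_essFiniteType_of_isAlgebraic
  let b := Module.Basis.ofVectorSpace k (algebraicClosure k E)
  have hb := linearIndependent_adjoin_of_isAlgebraic hs.1 b.linearIndependent
  have := hb.finite
  exact Module.Finite.of_basis b

end AlgebraicElements

section RootsOfUnity

variable {F₀ Ω : Type*} [Field F₀] [Field Ω] [Algebra F₀ Ω]

theorem essFiniteType_of_closure_eq_top {k : Type*} [Field k] [Algebra k F₀] {S : Set F₀}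
    (hS : S.Finite) (h : Subfield.closure S = ⊤) : Algebra.EssFiniteType k F₀ := by
  rw [← IntermediateField.fg_top_iff]
  have : IntermediateField.adjoin k S = ⊤ := by
    rw [eq_top_iff]
    intro y _
    have h1 : Subfield.closure S ≤ (IntermediateField.adjoin k S).toSubfield :=
      Subfield.closure_le.2 (IntermediateField.subset_adjoin k S)
    exact h1 (by rw [h]; trivial)
  rw [← this]
  exact IntermediateField.fg_adjoin_of_finite hS

theorem eq_or_eq_inv_of_add_inv_eq {z w : Ω} (hz : z ≠ 0) (hw : w ≠ 0)
    (h : z + z⁻¹ = w + w⁻¹) : z = w ∨ z = w⁻¹ := by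
  have : (z - w) * (z * w - 1) = 0 := by
    field_simp at h
    linear_combination h
  rcases mul_eq_zero.1 this with h | h
  · exact Or.inl (sub_eq_zero.1 h)
  · exact Or.inr (eq_inv_of_mul_eq_one_left (sub_eq_zero.1 h))

theorem exists_add_inv_ne_of_finite {A : Type*} [Finite A] (f : A → Ω) {l : ℕ} (hl : 1 < l)
    {ζ : ℕ → Ω} (hζ : ∀ m, IsPrimitiveRoot (ζ m) (l ^ m)) :
    ∃ m, ∀ t : A, f t ≠ ζ m + (ζ m)⁻¹ := by
  by_contra! H
  choose t ht using H
  have hne : ∀ m, ζ m ≠ 0 := fun m => (hζ m).ne_zero (pow_ne_zero m (by omega))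
  have hinj : Function.Injective t := by
    intro m m' hmm
    have h := ht m
    rw [hmm, ht m'] at h
    have ho : l ^ m = l ^ m' := by
      rcases eq_or_eq_inv_of_add_inv_eq (hne m) (hne m') h.symm with h | h
      · exact (hζ m).unique (h ▸ hζ m')
      · exact (hζ m).unique (h ▸ (hζ m').inv)
    exact Nat.pow_right_injective hl ho
  exact not_injective_infinite_finite t hinj

theorem exists_add_inv_ne_of_finiteDimensional {A : Type*} [Field A] [Algebra ℚ A] [CharZero Ω]
    [FiniteDimensional ℚ A] [Algebra A Ω] {l : ℕ} (hl : l.Prime)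
    {ζ : ℕ → Ω} (hζ : ∀ m, IsPrimitiveRoot (ζ m) (l ^ m)) :
    ∃ m, ∀ t : A, algebraMap A Ω t ≠ ζ m + (ζ m)⁻¹ := by
  by_contra! H
  have key : ∀ m, Nat.totient (l ^ m) ≤ Module.finrank ℚ A * 2 := by
    intro m
    obtain ⟨t, ht⟩ := H m
    have hpos : 0 < l ^ m := pow_pos (hl.pos) m
    have hne : ζ m ≠ 0 := (hζ m).ne_zero hpos.ne'
    let P : Polynomial A := Polynomial.X ^ 2 - Polynomial.C t * Polynomial.X + 1
    have hPm : P.Monic := by unfold P; monicity!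
    have hP : Polynomial.aeval (ζ m) P = 0 := by
      simp only [P, map_add, map_sub, map_mul, map_pow, Polynomial.aeval_X, Polynomial.aeval_C,
        map_one, ht]
      field_simp
      ring
    have hζint : IsIntegral A (ζ m) := ⟨P, hPm, hP⟩
    have hdeg : Module.finrank A (IntermediateField.adjoin A {ζ m}) ≤ 2 := by
      rw [IntermediateField.adjoin.finrank hζint]
      refine (Polynomial.natDegree_le_natDegree (minpoly.min A (ζ m) hPm hP)).trans ?_
      unfold P; compute_degree
    have : FiniteDimensional A (IntermediateField.adjoin A {ζ m}) :=
      IntermediateField.adjoin.finiteDimensional hζint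
    let _ : Algebra ℚ (IntermediateField.adjoin A {ζ m}) := DivisionRing.toRatAlgebra
    have : IsScalarTower ℚ A (IntermediateField.adjoin A {ζ m}) :=
      IsScalarTower.of_algebraMap_eq' (RingHom.ext_rat _ _)
    have : FiniteDimensional ℚ (IntermediateField.adjoin A {ζ m}) := FiniteDimensional.trans ℚ A _
    let z : IntermediateField.adjoin A {ζ m} := IntermediateField.AdjoinSimple.gen A (ζ m)
    have hz : IsPrimitiveRoot z (l ^ m) := by
      refine IsPrimitiveRoot.of_map_of_injective
        (f := (IntermediateField.adjoin A {ζ m}).val) ?_ Subtype.val_injective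
      exact hζ m
    have hd := minpoly.natDegree_le (A := ℚ) z
    rw [← Polynomial.cyclotomic_eq_minpoly_rat hz hpos, Polynomial.natDegree_cyclotomic,
      ← Module.finrank_mul_finrank ℚ A] at hd
    exact hd.trans (Nat.mul_le_mul_left _ hdeg)
  have h := key (Module.finrank ℚ A * 2 + 1)
  have h1 : Module.finrank ℚ A * 2 < Nat.totient (l ^ (Module.finrank ℚ A * 2 + 1)) := by
    rw [Nat.totient_prime_pow_succ hl]
    exact (Nat.lt_pow_self hl.one_lt).trans_le
      (Nat.le_mul_of_pos_right _ (by have := hl.one_lt; omega))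
  omega

theorem exists_add_inv_ne_algebraMap {S : Set F₀} (hS : S.Finite) (h : Subfield.closure S = ⊤)
    {l : ℕ} (hl : l.Prime) {ζ : ℕ → Ω} (hζ : ∀ m, IsPrimitiveRoot (ζ m) (l ^ m)) :
    ∃ m, ∀ t : F₀, algebraMap F₀ Ω t ≠ ζ m + (ζ m)⁻¹ := by
  have algebraic : ∀ (k : Type) [Field k] [Algebra k F₀] (t : F₀) (m : ℕ),
      algebraMap F₀ Ω t = ζ m + (ζ m)⁻¹ → t ∈ algebraicClosure k F₀ := by
    intro k _ _ t m ht
    rw [mem_algebraicClosure_iff]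
    let _ : Algebra k Ω := ((algebraMap F₀ Ω).comp (algebraMap k F₀)).toAlgebra
    have : IsScalarTower k F₀ Ω := IsScalarTower.of_algebraMap_eq' rfl
    have hz : IsIntegral k (ζ m) := by
      refine IsIntegral.of_pow (pow_pos hl.pos m) ?_
      rw [(hζ m).pow_eq_one]
      exact isIntegral_one
    have h1 := (hz.add hz.inv).isAlgebraic
    rw [← ht] at h1
    exact (isAlgebraic_algebraMap_iff (algebraMap F₀ Ω).injective).1 h1
  obtain ⟨p, hp⟩ := CharP.exists F₀
  rcases CharP.char_is_prime_or_zero F₀ p with hpp | rfl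
  · have : Fact p.Prime := ⟨hpp⟩
    let _ : Algebra (ZMod p) F₀ := ZMod.algebra F₀ p
    have := essFiniteType_of_closure_eq_top (k := ZMod p) hS h
    have := finiteDimensional_algebraicClosure (k := ZMod p) (E := F₀)
    have : Finite (algebraicClosure (ZMod p) F₀) := Module.finite_of_finite (ZMod p)
    obtain ⟨m, hm⟩ := exists_add_inv_ne_of_finite
      (fun t : algebraicClosure (ZMod p) F₀ => algebraMap F₀ Ω t) hl.one_lt hζ
    exact ⟨m, fun t ht => hm ⟨t, algebraic (ZMod p) t m ht⟩ ht⟩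
  · have : CharZero F₀ := CharP.charP_to_charZero F₀
    have := essFiniteType_of_closure_eq_top (k := ℚ) hS h
    have := finiteDimensional_algebraicClosure (k := ℚ) (E := F₀)
    have : CharZero Ω := charZero_of_injective_algebraMap (algebraMap F₀ Ω).injective
    obtain ⟨m, hm⟩ := exists_add_inv_ne_of_finiteDimensional
      (A := algebraicClosure ℚ F₀) (Ω := Ω) hl hζ
    exact ⟨m, fun t ht => hm ⟨t, algebraic ℚ t m ht⟩ ht⟩

end RootsOfUnity

section Kummer

variable {K Ω : Type*} [Field K] [Field Ω] [Algebra K Ω]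

theorem exists_eigenvector_of_mem_adjoin {n : ℕ} {s : Ω →ₐ[K] Ω} {ζ : Ω}
    (hn : (n : Ω) ≠ 0) (hζ : IsPrimitiveRoot ζ n) (hs : s ζ = ζ) {B : Submonoid Ω}
    (hB : ∀ b ∈ B, b ≠ 0 ∧ s (b ^ n) = b ^ n) {z : Ω} (hzB : z ∈ Algebra.adjoin K (B : Set Ω))
    (hz : z ≠ 0) (hsz : s (z ^ n) = z ^ n) :
    ∃ b ∈ B, ∃ κ : Ω, s κ = κ ∧ z = b * κ := by
  have hn0 : n ≠ 0 := by rintro rfl; simp at hn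
  have : NeZero n := ⟨hn0⟩
  have eigen : ∀ v : Ω, v ≠ 0 → s (v ^ n) = v ^ n → ∃ χ : Ω, χ ≠ 0 ∧ χ ^ n = 1 ∧ s χ = χ ∧
      s v = χ * v := by
    intro v hv h
    have h1 : (s v / v) ^ n = 1 := by
      rw [div_pow, ← map_pow, h, div_self (pow_ne_zero n hv)]
    obtain ⟨i, -, hi⟩ := hζ.eq_pow_of_pow_eq_one h1
    refine ⟨s v / v, ?_, h1, ?_, by field_simp⟩
    · intro h0
      rw [h0, zero_pow hn0] at h1
      exact zero_ne_one h1
    · rw [← hi, map_pow, hs]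
  have iter : ∀ (v χ : Ω), s χ = χ → s v = χ * v → ∀ i : ℕ, (s ^ i) v = χ ^ i * v := by
    intro v χ h1 h2 i
    induction i with
    | zero => simp
    | succ i ih => rw [pow_succ', AlgHom.mul_apply, ih, map_mul, map_pow, h1, h2]; ring
  obtain ⟨ξ, hξ0, hξn, hsξ, hzξ⟩ := eigen z hz hsz
  by_cases hex : ∃ b ∈ B, s b = ξ * b
  · obtain ⟨b, hb, hb'⟩ := hex
    have hb0 := (hB b hb).1
    refine ⟨b, hb, z / b, ?_, by field_simp⟩
    rw [map_div₀, hb', hzξ]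
    field_simp
  exfalso
  let T : Ω →ₗ[K] Ω := ∑ i ∈ range n, (ξ⁻¹ ^ i) • (s ^ i).toLinearMap
  have hT : ∀ v, T v = ∑ i ∈ range n, ξ⁻¹ ^ i * (s ^ i) v := fun v => by
    simp [T, LinearMap.sum_apply]
  have hT0 : ∀ b ∈ B, T b = 0 := by
    intro b hb
    obtain ⟨χ, hχ0, hχn, hsχ, hbχ⟩ := eigen b (hB b hb).1 (hB b hb).2
    have hne : ξ⁻¹ * χ ≠ 1 := by
      intro h
      refine hex ⟨b, hb, ?_⟩
      rw [hbχ]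
      congr 1
      field_simp at h
      exact h
    have : T b = (∑ i ∈ range n, (ξ⁻¹ * χ) ^ i) * b := by
      rw [hT, sum_mul]
      refine sum_congr rfl fun i _ => ?_
      rw [iter b χ hsχ hbχ, mul_pow, mul_assoc]
    rw [this, geom_sum_eq hne, mul_pow, inv_pow, hξn, hχn]
    simp
  have hTz : T z = n * z := by
    rw [hT]
    rw [sum_congr rfl (g := fun _ => z)]
    · simp
    · intro i _
      rw [iter z ξ hsξ hzξ, inv_pow, inv_mul_cancel_left₀ (pow_ne_zero i hξ0)]
  have hz0 : T z = 0 := by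
    have h1 : z ∈ Submodule.span K (B : Set Ω) := by
      have : z ∈ Subalgebra.toSubmodule (Algebra.adjoin K (B : Set Ω)) := hzB
      rwa [Algebra.adjoin_eq_span, Submonoid.closure_eq] at this
    have h2 : Submodule.span K (B : Set Ω) ≤ LinearMap.ker T := Submodule.span_le.2 hT0
    exact h2 h1
  rw [hTz] at hz0
  exact mul_ne_zero hn hz hz0

end Kummer

section Galois

theorem exists_not_inverting {F₀ : Type*} [Field F₀] {Ω : Type*} [Field Ω] [Algebra F₀ Ω]
    [IsGalois F₀ Ω] {S : Set F₀} (hS : S.Finite) (h : Subfield.closure S = ⊤)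
    {l : ℕ} (hl : l.Prime) {ζ : ℕ → Ω} (hζ : ∀ m, IsPrimitiveRoot (ζ m) (l ^ m))
    {e : Ω} {c : F₀} (he0 : e ≠ 0) (hc : e + e⁻¹ = algebraMap F₀ Ω c)
    (he : ∀ t : F₀, algebraMap F₀ Ω t ≠ e) :
    ∃ σ : Ω ≃ₐ[F₀] Ω, σ e = e⁻¹ ∧ ∃ m, σ (ζ m) ≠ (ζ m)⁻¹ := by
  have hmove : ∀ σ : Ω ≃ₐ[F₀] Ω, σ e = e ∨ σ e = e⁻¹ := by
    intro σ
    refine eq_or_eq_inv_of_add_inv_eq ((map_ne_zero σ).2 he0) he0 ?_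
    rw [← map_inv₀, ← map_add, hc, AlgEquiv.commutes]
  by_contra! H
  obtain ⟨σ₀, hσ₀⟩ : ∃ σ₀ : Ω ≃ₐ[F₀] Ω, σ₀ e ≠ e := by
    by_contra! h1
    obtain ⟨t, ht⟩ := (InfiniteGalois.mem_range_algebraMap_iff_fixed e).2 h1
    exact he t ht
  have hσ₀' := (hmove σ₀).resolve_left hσ₀
  obtain ⟨m, hm⟩ := exists_add_inv_ne_algebraMap hS h hl hζ
  have hfix : ∀ τ : Ω ≃ₐ[F₀] Ω, τ (ζ m + (ζ m)⁻¹) = ζ m + (ζ m)⁻¹ := by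
    intro τ
    rcases hmove τ with hτ | hτ
    · have h1 : (τ * σ₀) e = e⁻¹ := by
        rw [AlgEquiv.mul_apply, hσ₀', map_inv₀, hτ]
      have h2 := H _ h1 m
      rw [AlgEquiv.mul_apply, H _ hσ₀' m, map_inv₀] at h2
      rw [map_add, map_inv₀, inv_injective h2]
    · rw [map_add, map_inv₀, H τ hτ m, inv_inv, add_comm]
  obtain ⟨t, ht⟩ := (InfiniteGalois.mem_range_algebraMap_iff_fixed _).2 hfix
  exact hm t ht

end Galois

section KummerField

theorem exists_kummer_field {F₀ : Type*} [Field F₀] {S : Set F₀} (hS : S.Finite)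
    (h : Subfield.closure S = ⊤) {l k₀ : ℕ} (hl : l.Prime) (hl0 : (l : F₀) ≠ 0) {c : F₀}
    (hc : ∀ e : SeparableClosure F₀, IsPrimitiveRoot e (l ^ k₀) →
      e + e⁻¹ = algebraMap F₀ (SeparableClosure F₀) c)
    (hsq : ∀ e : SeparableClosure F₀, IsPrimitiveRoot e (l ^ k₀) → IsPrimitiveRoot (e ^ 2) l)
    (he : ∀ t : F₀, ¬ IsPrimitiveRoot t (l ^ k₀)) :
    ∃ (M : IntermediateField F₀ (SeparableClosure F₀)) (k : ℕ) (ζ : M), k₀ ≤ k ∧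
      IsPrimitiveRoot ζ (l ^ k) ∧ (∀ x : F₀, ∃ a : M, a ^ l ^ k = algebraMap F₀ M x) ∧
      ∀ z e : M, IsPrimitiveRoot e (l ^ k₀) → z ^ l ^ k ≠ e := by
  let Ω := SeparableClosure F₀
  have : NeZero (l : F₀) := ⟨hl0⟩
  have hlΩ : (l : Ω) ≠ 0 := by
    rw [← map_natCast (algebraMap F₀ Ω)]
    exact (map_ne_zero _).2 hl0
  have hex : ∀ m, ∃ ζ : Ω, IsPrimitiveRoot ζ (l ^ m) := fun m =>
    HasEnoughRootsOfUnity.exists_primitiveRoot Ω (l ^ m)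
  choose ζ hζ using hex
  have hζ0 : ∀ m, ζ m ≠ 0 := fun m => (hζ m).ne_zero (pow_ne_zero m hl.ne_zero)
  have hNe : ∀ m, NeZero (l ^ m) := fun m => ⟨pow_ne_zero m hl.ne_zero⟩
  obtain ⟨σ, hσe, hσ⟩ := exists_not_inverting hS h hl hζ (hζ0 k₀) (hc _ (hζ k₀)) (by
    intro t ht
    refine he t (IsPrimitiveRoot.of_map_of_injective (f := algebraMap F₀ Ω) ?_
      (algebraMap F₀ Ω).injective)
    rw [ht]
    exact hζ k₀)
  have hpow : ∀ {a b : ℕ} {u v : Ω}, a ≤ b → IsPrimitiveRoot v (l ^ b) → u ^ l ^ a = 1 →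
      σ v = v⁻¹ → σ u = u⁻¹ := by
    intro a b u v hab hv hu hσv
    have hu' : u ^ l ^ b = 1 := by
      obtain ⟨d, rfl⟩ := Nat.exists_eq_add_of_le hab
      rw [pow_add, pow_mul, hu, one_pow]
    have := hNe b
    obtain ⟨i, -, rfl⟩ := hv.eq_pow_of_pow_eq_one hu'
    rw [map_pow, hσv, inv_pow]
  classical
  have hmin : ∀ j, j < Nat.find hσ → σ (ζ j) = (ζ j)⁻¹ := fun j hj =>
    not_not.1 (Nat.find_min hσ hj)
  have hspec := Nat.find_spec hσ
  obtain ⟨k, hk⟩ : ∃ k, Nat.find hσ = k + 1 := by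
    refine ⟨Nat.find hσ - 1, ?_⟩
    have : Nat.find hσ ≠ 0 := by
      intro h0
      rw [h0] at hspec
      exact hspec (hpow (Nat.zero_le k₀) (hζ k₀) (hζ 0).pow_eq_one hσe)
    omega
  rw [hk] at hspec hmin
  have hk₀ : k₀ ≤ k := by
    by_contra! hlt
    exact hspec (hpow hlt (hζ k₀) (hζ _).pow_eq_one hσe)
  have hσk := hmin k k.lt_succ_self
  let s : Ω ≃ₐ[F₀] Ω := σ ^ 2
  have hs : ∀ v, s v = σ (σ v) := fun v => by simp [s, sq]
  let K : IntermediateField F₀ Ω := IntermediateField.fixedField (Subgroup.zpowers s)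
  have hsK : ∀ v ∈ K, s v = v := fun v hv => hv ⟨s, Subgroup.mem_zpowers s⟩
  let sK : Ω →ₐ[K] Ω := { s.toAlgHom.toRingHom with commutes' := fun v => hsK v v.2 }
  set n := l ^ k with hn
  have hn0 : n ≠ 0 := pow_ne_zero k hl.ne_zero
  have hnΩ : (n : Ω) ≠ 0 := by rw [hn, Nat.cast_pow]; exact pow_ne_zero _ hlΩ
  let B : Submonoid Ω :=
    { carrier := {b | b ≠ 0 ∧ ∃ x : F₀, algebraMap F₀ Ω x = b ^ n}
      one_mem' := ⟨one_ne_zero, 1, by simp⟩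
      mul_mem' := by
        rintro a b ⟨ha, x, hx⟩ ⟨hb, y, hy⟩
        exact ⟨mul_ne_zero ha hb, x * y, by rw [map_mul, hx, hy, mul_pow]⟩ }
  let M := (IntermediateField.adjoin K (B : Set Ω)).restrictScalars F₀
  have hBM : ∀ b ∈ B, b ∈ M := fun b hb => IntermediateField.subset_adjoin K _ hb
  have hζM : ζ k ∈ M :=
    hBM _ ⟨hζ0 k, 1, by rw [map_one, hn, (hζ k).pow_eq_one]⟩
  refine ⟨M, k, ⟨ζ k, hζM⟩, hk₀, ?_, ?_, ?_⟩
  · exact IsPrimitiveRoot.of_map_of_injective (f := M.val) (hζ k) Subtype.val_injective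
  · intro x
    have : NeZero ((n : ℕ) : Ω) := ⟨hnΩ⟩
    obtain ⟨a, ha⟩ := IsSepClosed.exists_pow_nat_eq (algebraMap F₀ Ω x) n
    by_cases hx : x = 0
    · exact ⟨0, by rw [hx, map_zero, ← hn, zero_pow hn0]⟩
    · have ha0 : a ≠ 0 := by
        rintro rfl
        rw [zero_pow hn0] at ha
        exact hx ((map_eq_zero _).1 ha.symm)
      exact ⟨⟨a, hBM a ⟨ha0, x, ha.symm⟩⟩, Subtype.ext ha⟩
  · rintro ⟨z, hz⟩ ⟨e, heM⟩ he' hze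
    have hze : z ^ n = e := congrArg Subtype.val hze
    have he' : IsPrimitiveRoot e (l ^ k₀) := he'.map_of_injective (f := M.val)
      Subtype.val_injective
    have he0 : e ≠ 0 := he'.ne_zero (pow_ne_zero _ hl.ne_zero)
    have hz0 : z ≠ 0 := by
      rintro rfl
      exact he0 (by rw [← hze, zero_pow hn0])
    have hσe' : σ e = e⁻¹ := hpow hk₀ (hζ k) he'.pow_eq_one hσk
    have hzA : z ∈ Algebra.adjoin K (B : Set Ω) := by
      have h1 : z ∈ (IntermediateField.adjoin K (B : Set Ω)).toSubalgebra := hz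
      rwa [IntermediateField.adjoin_toSubalgebra_of_isAlgebraic] at h1
      rintro b ⟨hb, x, hx⟩
      refine IsAlgebraic.of_pow (Nat.pos_of_ne_zero hn0) ?_
      rw [← hx, IsScalarTower.algebraMap_apply F₀ K Ω]
      exact isAlgebraic_algebraMap _
    obtain ⟨b, ⟨hb0, x, hx⟩, κ, hκ, hzκ⟩ := exists_eigenvector_of_mem_adjoin (s := sK) hnΩ
      (hζ k) (by
        change s (ζ k) = ζ k
        rw [hs, hσk, map_inv₀, hσk, inv_inv]) (B := B) (by
        rintro b ⟨hb, x, hx⟩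
        refine ⟨hb, ?_⟩
        change s (b ^ n) = b ^ n
        rw [← hx, AlgEquiv.commutes]) hzA hz0 (by
        change s (z ^ n) = z ^ n
        rw [hze, hs, hσe', map_inv₀, hσe', inv_inv])
    have hκ : σ (σ κ) = κ := by rw [← hs]; exact hκ
    have hκ0 : κ ≠ 0 := by rintro rfl; exact hz0 (by rw [hzκ, mul_zero])
    have hσκ0 : σ κ ≠ 0 := (map_ne_zero σ).2 hκ0
    have hx0 : algebraMap F₀ Ω x ≠ 0 := by rw [hx]; exact pow_ne_zero _ hb0
    have e1 : e = algebraMap F₀ Ω x * κ ^ n := by rw [← hze, hzκ, mul_pow, hx]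
    have e2 : e⁻¹ = algebraMap F₀ Ω x * σ κ ^ n := by
      rw [← hσe', e1, map_mul, AlgEquiv.commutes, map_pow]
    have hη : (κ / σ κ) ^ n = e ^ 2 := by
      have : e ^ 2 = e / e⁻¹ := by field_simp
      rw [this]
      nth_rw 1 [e1]
      rw [e2, div_pow]
      field_simp
    have hprim : IsPrimitiveRoot (κ / σ κ) (l ^ (k + 1)) := by
      have he2 := hsq e he'
      rw [← hη] at he2
      have : Fact l.Prime := ⟨hl⟩
      rw [IsPrimitiveRoot.iff_orderOf]
      refine orderOf_eq_prime_pow (fun h1 => ?_) ?_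
      · rw [← hn] at h1
        exact he2.ne_one hl.one_lt h1
      · rw [pow_succ, pow_mul, ← hn, he2.pow_eq_one]
    refine hspec (hpow le_rfl hprim (hζ _).pow_eq_one ?_)
    rw [map_div₀, hκ, inv_div]

end KummerField

end CyclicDilog

namespace PreBloch

section FinitelyGenerated

universe u v

variable {F : Type u} [Field F]

/-- The five-term relators with arguments in a subfield already account for any relation. -/
theorem exists_finite_of_mem_closure {z : FreeAbelianGroup {x : F // x ≠ 0 ∧ x ≠ 1}}
    (hz : z ∈ AddSubgroup.closure (fiveTermSet F)) :
    ∃ S : Set F, S.Finite ∧ ∀ (E : Subfield F), S ⊆ E →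
      ∀ {A : Type v} [AddCommGroup A] (b : E → A), IsFiveTerm b →
        ∀ g : FreeAbelianGroup {x : F // x ≠ 0 ∧ x ≠ 1} →+ A,
          (∀ (x : E) (hx : (x : F) ≠ 0 ∧ (x : F) ≠ 1), g (of ⟨x, hx⟩) = b x) → g z = 0 := by
  induction hz using AddSubgroup.closure_induction with
  | zero => exact ⟨∅, Set.finite_empty, fun _ _ _ _ _ _ g _ => map_zero g⟩
  | neg x _ ih =>
    obtain ⟨S, hS, h⟩ := ih
    refine ⟨S, hS, fun E hE A _ b hb g hg => ?_⟩
    rw [map_neg, h E hE b hb g hg, neg_zero]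
  | add x y _ _ ihx ihy =>
    obtain ⟨S, hS, h⟩ := ihx
    obtain ⟨T, hT, h'⟩ := ihy
    refine ⟨S ∪ T, hS.union hT, fun E hE A _ b hb g hg => ?_⟩
    rw [map_add, h E (Set.subset_union_left.trans hE) b hb g hg,
      h' E (Set.subset_union_right.trans hE) b hb g hg, add_zero]
  | mem z hz =>
    obtain ⟨x, y, hx, hy, hxy, h1, h2, h3, rfl⟩ := hz
    refine ⟨{x, y}, by simp, fun E hE A _ b hb g hg => ?_⟩
    have hxE : x ∈ E := hE (by simp)
    have hyE : y ∈ E := hE (by simp)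
    lift x to E using hxE
    lift y to E using hyE
    have hn : ∀ {t : E}, (t : F) ≠ 0 ∧ (t : F) ≠ 1 → t ≠ 0 ∧ t ≠ 1 := fun ht =>
      ⟨fun h => ht.1 (by rw [h]; rfl), fun h => ht.2 (by rw [h]; rfl)⟩
    have := hb x y (hn hx).1 (hn hx).2 (hn hy).1 (hn hy).2 (fun h => hxy (by rw [h]))
    have e1 := hg (y / x) h1
    have e2 := hg ((1 - x⁻¹) / (1 - y⁻¹)) h2
    have e3 := hg ((1 - x) / (1 - y)) h3
    rw [← hg x hx, ← hg y hy, ← e1, ← e2, ← e3] at this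
    rw [map_add, map_sub, map_add, map_sub]
    exact this

theorem closure_preimage_eq_top (S : Set F) :
    Subfield.closure ((Subfield.closure S).subtype ⁻¹' S) = ⊤ := by
  rw [eq_top_iff]
  rintro ⟨y, hy⟩ -
  have h : Subfield.closure S ≤ (Subfield.closure ((Subfield.closure S).subtype ⁻¹' S)).map
      (Subfield.closure S).subtype :=
    Subfield.closure_le.2 fun s hs =>
      ⟨⟨s, Subfield.subset_closure hs⟩, Subfield.subset_closure hs, rfl⟩
  obtain ⟨w, hw, rfl⟩ := h hy
  exact hw

theorem exists_hom_extending (E : Subfield F) {A : Type*} [AddCommGroup A] (b : E → A) :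
    ∃ g : FreeAbelianGroup {x : F // x ≠ 0 ∧ x ≠ 1} →+ A,
      ∀ (x : E) (hx : (x : F) ≠ 0 ∧ (x : F) ≠ 1), g (of ⟨x, hx⟩) = b x := by
  classical
  refine ⟨lift fun t => if ht : (t : F) ∈ E then b ⟨t, ht⟩ else 0, fun x hx => ?_⟩
  rw [lift_apply_of, dif_pos x.2]

/-- To see that a multiple of `[x] + [1 - x]` does not vanish, it suffices to detect it over all
finitely generated subfields. -/
theorem smul_add_one_sub_ne_zero {d : ℤ} {x : F} (hx : x ≠ 0 ∧ x ≠ 1)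
    (hx' : 1 - x ≠ 0 ∧ 1 - x ≠ 1)
    (H : ∀ (E : Subfield F) (S : Set E), S.Finite → Subfield.closure S = ⊤ →
      ∃ (A : Type v) (_ : AddCommGroup A) (b : E → A), IsFiveTerm b ∧
        ∀ t : E, t ≠ 0 → t ≠ 1 → d • (b t + b (1 - t)) ≠ 0) :
    d • (pb x hx + pb (1 - x) hx') ≠ 0 := by
  intro h0
  have h1 : d • (of (⟨x, hx⟩ : {x : F // x ≠ 0 ∧ x ≠ 1}) + of ⟨1 - x, hx'⟩) ∈
      AddSubgroup.closure (fiveTermSet F) := by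
    rw [← QuotientAddGroup.eq_zero_iff]
    exact (map_zsmul (QuotientAddGroup.mk' (AddSubgroup.closure (fiveTermSet F))) _ _).trans h0
  obtain ⟨S, hS, h⟩ := exists_finite_of_mem_closure.{u, v} h1
  have hT : insert x S ⊆ Subfield.closure (insert x S) := Subfield.subset_closure
  obtain ⟨A, _, b, hb, hb'⟩ := H (Subfield.closure (insert x S))
    ((Subfield.closure (insert x S)).subtype ⁻¹' insert x S)
    ((hS.insert x).preimage Subtype.val_injective.injOn)
    (closure_preimage_eq_top (insert x S))
  generalize Subfield.closure (insert x S) = E at hT b hb hb'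
  have hxE : x ∈ E := hT (Set.mem_insert _ _)
  obtain ⟨g, hg⟩ := exists_hom_extending E b
  have h2 := h E ((Set.subset_insert _ _).trans hT) b hb g hg
  lift x to E using hxE
  rw [map_zsmul, map_add, hg x hx] at h2
  have h3 := hg (1 - x) hx'
  refine hb' x (fun h => hx.1 (by rw [h]; rfl)) (fun h => hx.2 (by rw [h]; rfl)) ?_
  rw [← h3]
  exact h2

end FinitelyGenerated

end PreBloch

namespace CyclicDilog

open PreBloch

universe u

variable {F₀ : Type u} [Field F₀] {S : Set F₀}

theorem exists_detecting_two_smul (hS : S.Finite) (h : Subfield.closure S = ⊤)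
    (hω : ∀ ω : F₀, ω ^ 2 ≠ ω - 1) :
    ∃ (A : Type u) (_ : AddCommGroup A) (b : F₀ → A), IsFiveTerm b ∧
      ∀ t : F₀, t ≠ 0 → t ≠ 1 → (2 : ℤ) • (b t + b (1 - t)) ≠ 0 := by
  have h3 : (3 : F₀) ≠ 0 := fun h3 => hω (-1) (by linear_combination h3)
  have hsum : ∀ {E : Type u} [Field E] {e : E}, IsPrimitiveRoot e (3 ^ 1) →
      e ^ 2 + e + 1 = 0 := by
    intro E _ e he
    have h1 : (e - 1) * (e ^ 2 + e + 1) = 0 := by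
      have := he.pow_eq_one
      linear_combination this
    exact (mul_eq_zero.1 h1).resolve_left (sub_ne_zero.2 (he.ne_one (by norm_num)))
  obtain ⟨M, k, ζ, hk, hζ, hroot, hno⟩ := exists_kummer_field (k₀ := 1) (c := -1) hS h
    Nat.prime_three (by exact_mod_cast h3)
    (fun e he => by
      have := hsum he
      have := he.ne_zero (by norm_num)
      field_simp
      rw [map_neg, map_one]
      linear_combination hsum he)
    (fun e he => by
      rw [pow_one] at he
      exact he.pow_of_coprime 2 (by norm_num))
    (fun t ht => hω (-t) (by linear_combination hsum ht))
  obtain ⟨k, rfl⟩ := Nat.exists_eq_add_of_le' hk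
  have h3M : (3 : M) ≠ 0 := by
    rw [← map_ofNat (algebraMap F₀ M)]
    exact (map_ne_zero _).2 h3
  obtain ⟨b, hb⟩ := exists_isFiveTerm_two_smul_ne_zero hζ h3M hroot
    (fun z => hno z _ (hζ.pow (by positivity) (by rw [pow_add])))
  exact ⟨_, _, b, hb⟩

theorem exists_detecting_three_smul (hS : S.Finite) (h : Subfield.closure S = ⊤)
    (h2 : (2 : F₀) ≠ 0) (hi : ∀ i : F₀, i ^ 2 ≠ -1) :
    ∃ (A : Type u) (_ : AddCommGroup A) (b : F₀ → A), IsFiveTerm b ∧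
      ∀ t : F₀, t ≠ 0 → t ≠ 1 → (3 : ℤ) • (b t + b (1 - t)) ≠ 0 := by
  have hsq : ∀ {E : Type u} [Field E] {e : E}, IsPrimitiveRoot e (2 ^ 2) → e ^ 2 = -1 := by
    intro E _ e he
    exact (he.pow (by norm_num) (by norm_num : 2 ^ 2 = 2 * 2)).eq_neg_one_of_two_right
  obtain ⟨M, k, ζ, hk, hζ, hroot, hno⟩ := exists_kummer_field (k₀ := 2) (c := 0) hS h
    Nat.prime_two (by exact_mod_cast h2)
    (fun e he => by
      have := he.ne_zero (by norm_num)
      field_simp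
      rw [map_zero, hsq he]
      ring)
    (fun e he => he.pow (by norm_num) (by norm_num))
    (fun t ht => hi t (hsq ht))
  obtain ⟨k, rfl⟩ := Nat.exists_eq_add_of_le' hk
  have h2M : (2 : M) ≠ 0 := by
    rw [← map_ofNat (algebraMap F₀ M)]
    exact (map_ne_zero _).2 h2
  obtain ⟨b, hb⟩ := exists_isFiveTerm_three_smul_ne_zero hζ h2M hroot
    (fun z i hi => hno z i (by
      have : Fact (Nat.Prime 2) := ⟨Nat.prime_two⟩
      rw [IsPrimitiveRoot.iff_orderOf]
      refine orderOf_eq_prime_pow (n := 1) (fun h1 => ?_) ?_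
      · rw [pow_one, hi] at h1
        exact h2M (by linear_combination -h1)
      · linear_combination (i ^ 2 - 1) * hi))
  exact ⟨_, _, b, hb⟩

end CyclicDilog

open PreBloch CyclicDilog

/-- `3 c_F = 0` iff `char F = 2` or `√-1 ∈ F`; `2 c_F = 0` iff `F` contains `ω` with
`ω² = ω - 1` (a primitive sixth root of unity when `char F ∉ {2,3}`; `ω = -1` works in
characteristic 3). -/
theorem cF_torsion_iff (F : Type*) [Field F]
    (h4 : ∃ a b c d : F, a ≠ b ∧ a ≠ c ∧ a ≠ d ∧ b ≠ c ∧ b ≠ d ∧ c ≠ d)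
    (x : F) (hx : x ≠ 0 ∧ x ≠ 1) (hx' : 1 - x ≠ 0 ∧ 1 - x ≠ 1) :
    ((3 : ℤ) • (pb x hx + pb (1 - x) hx') = 0 ↔
        ringChar F = 2 ∨ ∃ i : F, i ^ 2 = -1) ∧
      ((2 : ℤ) • (pb x hx + pb (1 - x) hx') = 0 ↔
        ∃ ω : F, ω ^ 2 = ω - 1) := by
  have hchar : ringChar F = 2 ↔ (2 : F) = 0 := by
    constructor
    · intro h
      have := (ringChar.spec F 2).2 (by rw [h])
      exact_mod_cast this
    · intro h
      have h1 : ringChar F ∣ 2 := (ringChar.spec F 2).1 (by exact_mod_cast h)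
      exact ((Nat.dvd_prime Nat.prime_two).1 h1).resolve_left CharP.ringChar_ne_one
  refine ⟨⟨fun h => ?_, fun h => ?_⟩, ⟨fun h => ?_, fun h => ?_⟩⟩
  · by_contra! H
    rw [Ne, hchar] at H
    refine smul_add_one_sub_ne_zero hx hx' (fun E S hS hE => exists_detecting_three_smul hS hE
      (fun h => H.1 (congrArg Subtype.val h)) fun i hi => H.2 i (congrArg Subtype.val hi)) h
  · rw [pb_eq_gen, pb_eq_gen]
    by_cases h2 : (2 : F) = 0
    · exact isFiveTerm_gen.three_smul_of_two_eq_zero h4 h2 hx.1 hx.2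
    · obtain ⟨i, hi⟩ := h.resolve_left (fun h => h2 (hchar.1 h))
      rw [isFiveTerm_gen.add_one_sub hx.1 hx.2 (y := -1) (by simp)
        (fun h => h2 (by linear_combination -h))]
      exact isFiveTerm_gen.three_smul_of_sq_eq_neg_one h4 h2 hi
  · by_contra! H
    refine smul_add_one_sub_ne_zero hx hx' (fun E S hS hE => exists_detecting_two_smul hS hE
      fun ω hω => H ω (congrArg Subtype.val hω)) h
  · obtain ⟨ω, hω⟩ := h
    rw [pb_eq_gen, pb_eq_gen, isFiveTerm_gen.add_one_sub hx.1 hx.2 (y := ω)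
      (by rintro rfl; simp at hω) (by rintro rfl; simp at hω)]
    exact isFiveTerm_gen.two_smul_of_sq h4 hω
end

section
/- Let F be a number field, let n be the number of roots of unity contained in F, and set m = 1 if F contains a square root of −1 and m = 2 otherwise. Then there is an isomorphism of abelian groups ∧̃²F* ≅ ℤ/m ⊕ (⊕_{i∈ℕ} ℤ/n) ⊕ (⊕_{i∈ℕ} ℤ), where both direct sums are over a countably infinite index set. -/
open TensorProduct

/-- The subgroup of `F* ⊗ F*` generated by the elements `x ⊗ (-x)`. -/
noncomputable def negTensorSub (F : Type*) [Field F] :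
    AddSubgroup (TensorProduct ℤ (Additive Fˣ) (Additive Fˣ)) :=
  AddSubgroup.closure
    { z | ∃ x : Fˣ, z = Additive.ofMul x ⊗ₜ[ℤ] Additive.ofMul (-x) }

/-- The group `∧̃² F*`. -/
abbrev TildeWedge2 (F : Type*) [Field F] :=
  TensorProduct ℤ (Additive Fˣ) (Additive Fˣ) ⧸ negTensorSub F

/-- The elements `x ⊗ (x + ε)` generate the relations of the exterior square twisted by `ε`. -/
def twistedRelations {A : Type*} [AddCommGroup A] (ε : A) : AddSubgroup (A ⊗[ℤ] A) :=
  AddSubgroup.closure {z | ∃ x : A, z = x ⊗ₜ[ℤ] (x + ε)}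

/-- An isomorphism matching `ε` and `ε'` identifies the twisted exterior squares. -/
noncomputable def twistedSquareCongr {A B : Type*} [AddCommGroup A] [AddCommGroup B] (e : A ≃+ B)
    {ε : A} {ε' : B} (h : e ε = ε') :
    (A ⊗[ℤ] A) ⧸ twistedRelations ε ≃+ (B ⊗[ℤ] B) ⧸ twistedRelations ε' :=
  QuotientAddGroup.congr _ _
    (TensorProduct.congr e.toIntLinearEquiv e.toIntLinearEquiv).toAddEquiv (by
      rw [twistedRelations, AddMonoidHom.map_closure, twistedRelations]
      congr 1
      ext z
      constructor
      · rintro ⟨_, ⟨x, rfl⟩, rfl⟩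
        exact ⟨e x, by simp [← h]⟩
      · rintro ⟨y, rfl⟩
        exact ⟨_, ⟨e.symm y, rfl⟩, by simp [← h]⟩)

section Bilinear

variable {A T : Type*} [AddCommGroup A] [AddCommGroup T] {ε : A} {q : A →+ A →+ T}

theorem antisymm_of_twisted (hq : ∀ x, q x (x + ε) = 0) (x y : A) : q x y = -q y x := by
  have h := hq (x + y)
  have hx := hq x
  have hy := hq y
  simp only [map_add, AddMonoidHom.add_apply] at h hx hy
  rw [eq_neg_iff_add_eq_zero]
  calc q x y + q y x = (q x x + q y x + (q x y + q y y) + (q x ε + q y ε))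
      - (q x x + q x ε) - (q y y + q y ε) := by abel
    _ = 0 := by rw [h, hx, hy]; simp

end Bilinear

/-- The class of `x ⊗ y` in the twisted exterior square, as a biadditive map. -/
noncomputable def twistedMk {A : Type*} [AddCommGroup A] (ε : A) :
    A →+ A →+ (A ⊗[ℤ] A) ⧸ twistedRelations ε :=
  AddMonoidHom.mk' (fun x ↦ AddMonoidHom.mk'
    (fun y ↦ ((x ⊗ₜ[ℤ] y : A ⊗[ℤ] A) : (A ⊗[ℤ] A) ⧸ twistedRelations ε))
    fun y z ↦ by rw [TensorProduct.tmul_add]; rfl)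
    fun x y ↦ by ext z; simp [TensorProduct.add_tmul]

theorem twistedMk_self_add {A : Type*} [AddCommGroup A] (ε x : A) :
    twistedMk ε x (x + ε) = 0 :=
  (QuotientAddGroup.eq_zero_iff _).2 (AddSubgroup.subset_closure ⟨x, rfl⟩)

theorem twistedSquare_hom_ext {A T : Type*} [AddCommGroup A] [AddCommGroup T] {ε : A}
    {f g : (A ⊗[ℤ] A) ⧸ twistedRelations ε →+ T}
    (h : ∀ x y, f (twistedMk ε x y) = g (twistedMk ε x y)) : f = g := by
  refine QuotientAddGroup.addMonoidHom_ext _ (AddMonoidHom.ext fun z ↦ ?_)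
  induction z with
  | zero => simp
  | tmul x y => exact h x y
  | add x y hx hy => rw [map_add, map_add, hx, hy]

/-- The homomorphism out of the twisted exterior square induced by a biadditive map. -/
noncomputable def twistedLift {A T : Type*} [AddCommGroup A] [AddCommGroup T] {ε : A}
    (q : A →+ A →+ T) (hq : ∀ x, q x (x + ε) = 0) : (A ⊗[ℤ] A) ⧸ twistedRelations ε →+ T :=
  QuotientAddGroup.lift _ (TensorProduct.liftAddHom q fun r x y ↦ by simp) (by
    rw [twistedRelations, AddSubgroup.closure_le]
    rintro _ ⟨x, rfl⟩
    exact hq x)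

theorem twistedLift_mk {A T : Type*} [AddCommGroup A] [AddCommGroup T] {ε : A}
    (q : A →+ A →+ T) (hq : ∀ x, q x (x + ε) = 0) (x y : A) :
    twistedLift q hq (twistedMk ε x y) = q x y := rfl

section Model

variable (ι : Type*) [LinearOrder ι] (k m : ℕ)

/-- The coordinates of `x ∧ y` for `x` and `y` in `ℤ/2k ⊕ ℤ^(ι)`. -/
noncomputable def wedgeCoords (hm : m ∣ 2 * k) :
    ZMod (2 * k) × (ι →₀ ℤ) →+ ZMod (2 * k) × (ι →₀ ℤ) →+
      ZMod m × (ι →₀ ZMod (2 * k)) × ({p : ι × ι | p.1 < p.2} →₀ ℤ) :=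
  let c : (ι →₀ ℤ) →+ (ι →₀ ZMod (2 * k)) :=
    Finsupp.mapRange.addMonoidHom (Int.castAddHom (ZMod (2 * k)))
  AddMonoidHom.mk' (fun x ↦ AddMonoidHom.mk' (fun y ↦
    (ZMod.castHom hm _ x.1 * ZMod.castHom hm _ y.1,
      x.1 • c y.2 - y.1 • c x.2 + (k : ZMod (2 * k)) • (c x.2 * c y.2),
      Finsupp.lsubtypeDomain (R := ℤ) {p : ι × ι | p.1 < p.2}
        (finsuppTensorFinsupp' ℤ ι ι (x.2 ⊗ₜ y.2) - finsuppTensorFinsupp' ℤ ι ι (y.2 ⊗ₜ x.2))))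
    fun y z ↦ by
      refine Prod.ext ?_ (Prod.ext ?_ ?_)
      · simp [mul_add, -ZMod.castHom_apply]
      · ext i; simp [c]; ring
      · ext ⟨⟨i, j⟩, h⟩
        simp [Finsupp.lsubtypeDomain_apply, finsuppTensorFinsupp'_apply_apply]; ring)
    fun x y ↦ by
      ext z : 1
      refine Prod.ext ?_ (Prod.ext ?_ ?_)
      · simp [add_mul, -ZMod.castHom_apply]
      · ext i; simp [c]; ring
      · ext ⟨⟨i, j⟩, h⟩
        simp [Finsupp.lsubtypeDomain_apply, finsuppTensorFinsupp'_apply_apply]; ring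

variable {ι k m}

theorem wedgeCoords_fst (hm : m ∣ 2 * k) (x y : ZMod (2 * k) × (ι →₀ ℤ)) :
    (wedgeCoords ι k m hm x y).1 = ZMod.castHom hm _ x.1 * ZMod.castHom hm _ y.1 := rfl

theorem wedgeCoords_snd_fst (hm : m ∣ 2 * k) (x y : ZMod (2 * k) × (ι →₀ ℤ)) (i : ι) :
    (wedgeCoords ι k m hm x y).2.1 i = x.1 * y.2 i - y.1 * x.2 i + k * (x.2 i * y.2 i) := by
  simp [wedgeCoords]

theorem wedgeCoords_snd_snd (hm : m ∣ 2 * k) (x y : ZMod (2 * k) × (ι →₀ ℤ))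
    (p : {p : ι × ι | p.1 < p.2}) :
    (wedgeCoords ι k m hm x y).2.2 p = x.2 p.1.1 * y.2 p.1.2 - y.2 p.1.1 * x.2 p.1.2 := by
  obtain ⟨⟨i, j⟩, h⟩ := p
  simp [wedgeCoords, Finsupp.lsubtypeDomain_apply, finsuppTensorFinsupp'_apply_apply]

theorem wedgeCoords_self_add (hm : m ∣ 2 * k) (hm1 : Even k → m = 1) (hm2 : ¬ Even k → m = 2)
    (x : ZMod (2 * k) × (ι →₀ ℤ)) :
    wedgeCoords ι k m hm x (x + ((k : ZMod (2 * k)), 0)) = 0 := by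
  refine Prod.ext ?_ (Prod.ext ?_ ?_)
  · rw [wedgeCoords_fst]
    by_cases hk : Even k
    · obtain rfl := hm1 hk
      exact Subsingleton.elim _ _
    · obtain rfl := hm2 hk
      have : ((k : ℕ) : ZMod 2) = 1 := ZMod.natCast_eq_one_iff_odd.2 (Nat.not_even_iff_odd.1 hk)
      rw [Prod.fst_add, map_add, map_natCast, this, Prod.fst_zero]
      generalize ZMod.castHom hm (ZMod 2) x.1 = a
      revert a
      decide
  · ext i
    rw [wedgeCoords_snd_fst]
    obtain ⟨j, hj⟩ := Int.even_mul_pred_self (x.2 i)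
    have h2 : (k : ZMod (2 * k)) * 2 = 0 := by
      have := ZMod.natCast_self (2 * k)
      rw [Nat.cast_mul, Nat.cast_ofNat] at this
      linear_combination this
    have hj' := congrArg (Int.cast : ℤ → ZMod (2 * k)) hj
    push_cast at hj'
    simp only [Prod.fst_add, Prod.snd_add, add_zero, Prod.snd_zero, Prod.fst_zero,
      Finsupp.coe_zero, Pi.zero_apply]
    linear_combination (k : ZMod (2 * k)) * hj' + j * h2
  · ext p
    rw [wedgeCoords_snd_snd]
    simp only [Prod.snd_add, add_zero, Prod.snd_zero, Finsupp.coe_zero, Pi.zero_apply]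
    ring

/-- The homomorphism from `ℤ/n` sending `1` to an element killed by `n`. -/
noncomputable def zmodHom {T : Type*} [AddCommGroup T] {n : ℕ} (t : T) (h : n • t = 0) :
    ZMod n →+ T :=
  ZMod.lift n ⟨zmultiplesHom T t, by simpa using h⟩

@[simp]
theorem zmodHom_one {T : Type*} [AddCommGroup T] {n : ℕ} (t : T) (h : n • t = 0) :
    zmodHom t h 1 = t := by
  have := ZMod.lift_coe n ⟨zmultiplesHom T t, by simpa using h⟩ 1
  simpa [zmodHom] using this

theorem zmodHom_natCast {T : Type*} [AddCommGroup T] {n : ℕ} (t : T) (h : n • t = 0) (j : ℕ) :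
    zmodHom t h j = j • t := by
  rw [← nsmul_one, map_nsmul, zmodHom_one]

theorem zmod_hom_ext {T : Type*} [AddCommGroup T] {n : ℕ} {f g : ZMod n →+ T} (h : f 1 = g 1) :
    f = g := by
  refine AddMonoidHom.ext fun a ↦ ?_
  obtain ⟨j, rfl⟩ := ZMod.intCast_surjective a
  rw [← zsmul_one, map_zsmul, map_zsmul, h]

/-- The generator of the torsion part of the model. -/
def torsGen (ι : Type*) (n : ℕ) : ZMod n × (ι →₀ ℤ) := (1, 0)

/-- The `i`-th generator of the free part of the model. -/
noncomputable def freeGen {ι : Type*} (n : ℕ) (i : ι) : ZMod n × (ι →₀ ℤ) :=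
  (0, Finsupp.single i 1)

theorem prod_hom_ext {A B T : Type*} [AddCommGroup A] [AddCommGroup B] [AddCommGroup T]
    {f g : A × B →+ T} (h : f.comp (.inl A B) = g.comp (.inl A B))
    (h' : f.comp (.inr A B) = g.comp (.inr A B)) : f = g := by
  rw [← AddMonoidHom.coprod_unique f, h, h', AddMonoidHom.coprod_unique]

theorem model_hom_ext {ι T : Type*} [AddCommGroup T] {n : ℕ} {f g : ZMod n × (ι →₀ ℤ) →+ T}
    (h : f (torsGen ι n) = g (torsGen ι n)) (h' : ∀ i, f (freeGen n i) = g (freeGen n i)) :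
    f = g := by
  refine prod_hom_ext (zmod_hom_ext h) (Finsupp.addHom_ext' fun i ↦ ?_)
  exact AddMonoidHom.ext_int (h' i)

theorem nsmul_torsGen (ι : Type*) (n j : ℕ) : j • torsGen ι n = ((j : ZMod n), 0) := by
  simp [torsGen]

theorem nsmul_torsGen_self (ι : Type*) (n : ℕ) : n • torsGen ι n = 0 := by
  rw [nsmul_torsGen, ZMod.natCast_self]; rfl

theorem nsmul_twisted_torsGen {κ T : Type*} [AddCommGroup T]
    {q : ZMod (2 * k) × (κ →₀ ℤ) →+ ZMod (2 * k) × (κ →₀ ℤ) →+ T}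
    (hq : ∀ x, q x (x + ((k : ZMod (2 * k)), 0)) = 0)
    (hm1 : Even k → m = 1) (hm2 : ¬ Even k → m = 2) :
    m • q (torsGen κ (2 * k)) (torsGen κ (2 * k)) = 0 := by
  set t := q (torsGen κ (2 * k)) (torsGen κ (2 * k)) with ht
  have h1 : (2 * k) • t = 0 := by
    rw [ht, ← map_nsmul, nsmul_torsGen_self, map_zero]
  have h2 : (1 + k) • t = 0 := by
    rw [← hq (torsGen κ (2 * k)), ← nsmul_torsGen, map_add, map_nsmul, ← ht, add_nsmul, one_nsmul]
  by_cases hk : Even k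
  · obtain ⟨j, rfl⟩ := hk
    rw [hm1 ⟨j, rfl⟩]
    calc 1 • t = (1 + 2 * j) • (1 + (j + j)) • t - (1 + j) • (2 * (j + j)) • t := by module
      _ = 0 := by rw [h1, h2]; simp
  · rw [hm2 hk]
    calc 2 • t = 2 • (1 + k) • t - (2 * k) • t := by module
      _ = 0 := by rw [h1, h2]; simp

/-- The homomorphism with prescribed values on the generators of the model exterior square. -/
noncomputable def wedgeOfCoords {T : Type*} [AddCommGroup T]
    (q : ZMod (2 * k) × (ι →₀ ℤ) →+ ZMod (2 * k) × (ι →₀ ℤ) →+ T)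
    (hq : ∀ x, q x (x + ((k : ZMod (2 * k)), 0)) = 0)
    (hm1 : Even k → m = 1) (hm2 : ¬ Even k → m = 2) :
    ZMod m × (ι →₀ ZMod (2 * k)) × ({p : ι × ι | p.1 < p.2} →₀ ℤ) →+ T :=
  (zmodHom _ (nsmul_twisted_torsGen hq hm1 hm2)).coprod
    ((Finsupp.liftAddHom fun i ↦ zmodHom (q (torsGen ι (2 * k)) (freeGen _ i)) (by
        rw [← AddMonoidHom.nsmul_apply, ← map_nsmul, nsmul_torsGen_self, map_zero]; rfl)).coprod
      (Finsupp.liftAddHom fun p ↦ zmultiplesHom T (q (freeGen _ p.1.1) (freeGen _ p.1.2))))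

theorem wedgeCoords_torsGen_torsGen (hm : m ∣ 2 * k) :
    wedgeCoords ι k m hm (torsGen ι _) (torsGen ι _) = (1, 0, 0) := by
  refine Prod.ext ?_ (Prod.ext (Finsupp.ext fun i ↦ ?_) (Finsupp.ext fun p ↦ ?_))
  · simp [wedgeCoords_fst, torsGen, -ZMod.castHom_apply]
  · simp [wedgeCoords_snd_fst, torsGen]
  · simp [wedgeCoords_snd_snd, torsGen]

theorem wedgeCoords_torsGen_freeGen (hm : m ∣ 2 * k) (i : ι) :
    wedgeCoords ι k m hm (torsGen ι _) (freeGen _ i) = (0, Finsupp.single i 1, 0) := by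
  refine Prod.ext ?_ (Prod.ext (Finsupp.ext fun j ↦ ?_) (Finsupp.ext fun p ↦ ?_))
  · simp [wedgeCoords_fst, torsGen, freeGen, -ZMod.castHom_apply]
  · by_cases h : i = j <;> simp [wedgeCoords_snd_fst, torsGen, freeGen, h]
  · simp [wedgeCoords_snd_snd, torsGen, freeGen]

theorem wedgeCoords_freeGen_self (hm : m ∣ 2 * k) (i : ι) :
    wedgeCoords ι k m hm (freeGen _ i) (freeGen _ i) = (0, Finsupp.single i (k : ZMod _), 0) := by
  refine Prod.ext ?_ (Prod.ext (Finsupp.ext fun j ↦ ?_) (Finsupp.ext fun p ↦ ?_))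
  · simp [wedgeCoords_fst, freeGen, -ZMod.castHom_apply]
  · by_cases h : i = j <;> simp [wedgeCoords_snd_fst, freeGen, h]
  · simp [wedgeCoords_snd_snd, freeGen]

theorem wedgeCoords_freeGen_freeGen (hm : m ∣ 2 * k) {i j : ι} (hij : i < j) :
    wedgeCoords ι k m hm (freeGen _ i) (freeGen _ j) =
      (0, 0, Finsupp.single ⟨(i, j), hij⟩ 1) := by
  refine Prod.ext ?_ (Prod.ext (Finsupp.ext fun l ↦ ?_) (Finsupp.ext fun p ↦ ?_))
  · simp [wedgeCoords_fst, freeGen, -ZMod.castHom_apply]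
  · have : ((Finsupp.single i 1 : ι →₀ ℤ) l) * ((Finsupp.single j 1 : ι →₀ ℤ) l) = 0 := by
      simp only [Finsupp.single_apply]
      split_ifs with h1 h2
      · exact absurd (h1.trans h2.symm) hij.ne
      all_goals simp
    rw [wedgeCoords_snd_fst]
    simp only [freeGen, ← Int.cast_mul, this]
    simp
  · obtain ⟨⟨a, b⟩, hab⟩ := p
    simp only [Set.mem_ofPred_eq] at hab
    simp only [wedgeCoords_snd_snd, freeGen, Finsupp.single_apply, Subtype.mk.injEq,
      Prod.mk.injEq]
    grind

theorem wedgeOfCoords_wedgeCoords {T : Type*} [AddCommGroup T]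
    (q : ZMod (2 * k) × (ι →₀ ℤ) →+ ZMod (2 * k) × (ι →₀ ℤ) →+ T)
    (hq : ∀ x, q x (x + ((k : ZMod (2 * k)), 0)) = 0) (hm : m ∣ 2 * k)
    (hm1 : Even k → m = 1) (hm2 : ¬ Even k → m = 2) (x y : ZMod (2 * k) × (ι →₀ ℤ)) :
    wedgeOfCoords q hq hm1 hm2 (wedgeCoords ι k m hm x y) = q x y := by
  have hc := antisymm_of_twisted (wedgeCoords_self_add (ι := ι) hm hm1 hm2)
  have hanti := antisymm_of_twisted hq
  have htf (i) : wedgeOfCoords q hq hm1 hm2 (wedgeCoords ι k m hm (torsGen ι _) (freeGen _ i)) =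
      q (torsGen ι _) (freeGen _ i) := by
    rw [wedgeCoords_torsGen_freeGen]
    simp [wedgeOfCoords]
  have hff {i j} (hij : i < j) :
      wedgeOfCoords q hq hm1 hm2 (wedgeCoords ι k m hm (freeGen _ i) (freeGen _ j)) =
        q (freeGen _ i) (freeGen _ j) := by
    rw [wedgeCoords_freeGen_freeGen hm hij]
    simp [wedgeOfCoords]
  suffices (AddMonoidHom.compHom (wedgeOfCoords q hq hm1 hm2)).comp (wedgeCoords ι k m hm) = q from
    DFunLike.congr_fun (DFunLike.congr_fun this x) y
  refine model_hom_ext (model_hom_ext ?_ fun i ↦ ?_) fun i ↦ model_hom_ext ?_ fun j ↦ ?_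
  all_goals simp only [AddMonoidHom.comp_apply, AddMonoidHom.compHom_apply_apply]
  · rw [wedgeCoords_torsGen_torsGen]
    simp [wedgeOfCoords]
  · exact htf i
  · rw [hc, map_neg, htf, ← hanti]
  · rcases lt_trichotomy i j with hij | rfl | hij
    · exact hff hij
    · have h := hq (freeGen _ i)
      rw [map_add, ← nsmul_torsGen, map_nsmul, hanti _ (torsGen _ _), smul_neg,
        ← sub_eq_add_neg, sub_eq_zero] at h
      rw [wedgeCoords_freeGen_self, h]
      simp [wedgeOfCoords, zmodHom_natCast]
    · rw [hc, map_neg, hff hij, ← hanti]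

/-- The twisted exterior square of `ℤ/2k ⊕ ℤ^(ι)`, twisted by the element of order two. -/
noncomputable def twistedSquareModel (hm : m ∣ 2 * k) (hm1 : Even k → m = 1)
    (hm2 : ¬ Even k → m = 2) :
    (((ZMod (2 * k) × (ι →₀ ℤ)) ⊗[ℤ] (ZMod (2 * k) × (ι →₀ ℤ))) ⧸
        twistedRelations (A := ZMod (2 * k) × (ι →₀ ℤ)) ((k : ZMod (2 * k)), 0)) ≃+
      ZMod m × (ι →₀ ZMod (2 * k)) × ({p : ι × ι | p.1 < p.2} →₀ ℤ) :=
  AddMonoidHom.toAddEquiv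
    (twistedLift (wedgeCoords ι k m hm) (wedgeCoords_self_add hm hm1 hm2))
    (wedgeOfCoords (twistedMk _) (twistedMk_self_add _) hm1 hm2)
    (twistedSquare_hom_ext (wedgeOfCoords_wedgeCoords _ (twistedMk_self_add _) hm hm1 hm2))
    (by
      refine prod_hom_ext (zmod_hom_ext ?_) (prod_hom_ext
        (Finsupp.addHom_ext' fun i ↦ zmod_hom_ext ?_)
        (Finsupp.addHom_ext' fun p ↦ AddMonoidHom.ext_int ?_))
      · simp [wedgeOfCoords, twistedLift_mk, wedgeCoords_torsGen_torsGen]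
      · simp [wedgeOfCoords, twistedLift_mk, wedgeCoords_torsGen_freeGen]
      · simp [wedgeOfCoords, twistedLift_mk, wedgeCoords_freeGen_freeGen hm p.2])

end Model

/-- A family of finitely supported functions with pairwise distinct leading terms is linearly
independent. -/
theorem linearIndependent_of_triangular {R ι : Type*} [CommRing R] [IsDomain R] [LinearOrder ι]
    (s : Set ι) (b : s → ι →₀ R) (hb : ∀ i, b i i ≠ 0)
    (hb0 : ∀ (i : s) (j : ι), (i : ι) < j → b i j = 0) :
    LinearIndependent R b := by
  rw [linearIndependent_iff]
  intro l hl
  by_contra hne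
  have hs : l.support.Nonempty := Finsupp.support_nonempty_iff.2 hne
  have h0 := DFunLike.congr_fun hl (l.support.max' hs : ι)
  rw [Finsupp.linearCombination_apply, Finsupp.sum, Finsupp.finsetSum_apply,
    Finset.sum_eq_single (l.support.max' hs)] at h0
  · exact mul_ne_zero (Finsupp.mem_support_iff.1 (l.support.max'_mem hs)) (hb _) h0
  · intro i hi hit
    have : i < l.support.max' hs := lt_of_le_of_ne (l.support.le_max' i hi) hit
    simp [hb0 i _ (Subtype.coe_lt_coe.2 this)]
  · exact fun h ↦ absurd (l.support.max'_mem hs) h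

/-- A submodule of a free module with well-ordered basis over a principal ideal domain is free. -/
theorem free_submodule_finsupp {R ι : Type*} [CommRing R] [IsDomain R] [IsPrincipalIdealRing R]
    [LinearOrder ι] [WellFoundedLT ι] (N : Submodule R (ι →₀ R)) : Module.Free R N := by
  classical
  let L (i : ι) : Submodule R (ι →₀ R) := N ⊓ ⨅ j, ⨅ (_ : i < j), LinearMap.ker (Finsupp.lapply j)
  have hL {i : ι} {x : ι →₀ R} : x ∈ L i ↔ x ∈ N ∧ ∀ j, i < j → x j = 0 := by simp [L]
  let I (i : ι) : Ideal R := (L i).map (Finsupp.lapply i)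
  choose d hd using fun i ↦ (IsPrincipalIdealRing.principal (I i)).principal
  have hmem (i) : ∃ x ∈ L i, x i = d i ∧ (d i = 0 → x = 0) := by
    by_cases h : d i = 0
    · exact ⟨0, zero_mem _, by simp [h]⟩
    have : d i ∈ I i := by rw [hd]; exact Submodule.mem_span_singleton_self _
    simpa [I, h] using this
  choose b hbL hbd hb using hmem
  have hbN (i) : b i ∈ N := (hL.1 (hbL i)).1
  have hb0 {i j} (h : i < j) : b i j = 0 := (hL.1 (hbL i)).2 j h
  let v : {i // d i ≠ 0} → N := fun i ↦ ⟨b i, hbN i⟩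
  have hli : LinearIndependent R v :=
    LinearIndependent.of_comp N.subtype (linearIndependent_of_triangular {i | d i ≠ 0} _
      (fun i ↦ (hbd i).trans_ne i.2) fun i j hij ↦ hb0 hij)
  have hred (x : N) (hx : ∀ i, (x : ι →₀ R) i ≠ 0 → (x : ι →₀ R) ∈ L i →
      x ∈ Submodule.span R (Set.range v)) : x ∈ Submodule.span R (Set.range v) := by
    by_cases h0 : x = 0
    · rw [h0]
      exact zero_mem _
    · have hs : (x : ι →₀ R).support.Nonempty :=
        Finsupp.support_nonempty_iff.2 (by simpa using h0)
      refine hx _ (Finsupp.mem_support_iff.1 (Finset.max'_mem _ hs)) (hL.2 ⟨x.2, fun j hj ↦ ?_⟩)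
      by_contra hne
      exact absurd (Finset.le_max' _ j (Finsupp.mem_support_iff.2 hne)) (not_le.2 hj)
  have key (i : ι) : ∀ x : N, (x : ι →₀ R) ∈ L i → x ∈ Submodule.span R (Set.range v) := by
    induction i using WellFoundedLT.induction with
    | ind i ih =>
    intro x hx
    have hxi : (x : ι →₀ R) i ∈ I i := ⟨x, hx, rfl⟩
    rw [hd, Submodule.mem_span_singleton] at hxi
    obtain ⟨c, hc⟩ := hxi
    set y : N := ⟨b i, hbN i⟩
    have hy : y ∈ Submodule.span R (Set.range v) := by
      by_cases hdi : d i = 0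
      · rw [show y = 0 from Subtype.ext (hb i hdi)]
        exact zero_mem _
      · exact Submodule.subset_span ⟨⟨i, hdi⟩, rfl⟩
    rw [← sub_add_cancel x (c • y)]
    refine add_mem (hred _ fun j hj hjL ↦ ih j ?_ _ hjL) (Submodule.smul_mem _ c hy)
    refine lt_of_le_of_ne (not_lt.1 fun hij ↦ hj ?_) fun hij ↦ hj ?_
    · simp [y, (hL.1 hx).2 j hij, hb0 hij]
    · simp [y, hij, hbd, ← hc]
  exact Module.Free.of_basis (Module.Basis.mk hli fun x _ ↦ hred x fun i _ ↦ key i x)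

theorem exists_equiv_ker_prod {R M P : Type*} [Ring R] [AddCommGroup M] [Module R M]
    [AddCommGroup P] [Module R P] [Module.Projective R P] (f : M →ₗ[R] P)
    (hf : Function.Surjective f) : Nonempty (M ≃ₗ[R] LinearMap.ker f × P) := by
  obtain ⟨s, hs⟩ := f.exists_rightInverse_of_surjective (LinearMap.range_eq_top.2 hf)
  exact ⟨(lequivProdOfRightSplitExact (LinearMap.ker f).injective_subtype
    (Submodule.range_subtype _) hs).symm⟩

open IsDedekindDomain NumberField

section Valuations

variable (F : Type*) [Field F] [NumberField F]

theorem finite_valuationOfNeZero_ne_one (x : Fˣ) :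
    {v : HeightOneSpectrum (𝓞 F) | v.valuationOfNeZero x ≠ 1}.Finite := by
  refine ((HeightOneSpectrum.Support.finite (𝓞 F) (x : F)).union
    (HeightOneSpectrum.Support.finite (𝓞 F) (x⁻¹ : F))).subset fun v hv ↦ ?_
  have h : v.valuation F (x : F) ≠ 1 := by
    rw [← HeightOneSpectrum.valuationOfNeZero_eq]
    exact_mod_cast hv
  rcases h.lt_or_gt with h | h
  · right
    simp only [HeightOneSpectrum.Support, Set.mem_ofPred_eq, map_inv₀]
    exact (one_lt_inv₀ (by simp [zero_lt_iff])).2 h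
  · exact Or.inl h

/-- The divisor of an element of a number field. -/
noncomputable def divisorHom : Additive Fˣ →+ (HeightOneSpectrum (𝓞 F) →₀ ℤ) where
  toFun x := Finsupp.ofSupportFinite
    (fun v ↦ Multiplicative.toAdd (v.valuationOfNeZero x.toMul)) (by
      simpa [Function.support] using! finite_valuationOfNeZero_ne_one F x.toMul)
  map_zero' := by ext v; simp [Finsupp.ofSupportFinite]
  map_add' x y := by
    ext v
    exact congrArg Multiplicative.toAdd (map_mul v.valuationOfNeZero x.toMul y.toMul)

theorem divisorHom_apply (x : Additive Fˣ) (v : HeightOneSpectrum (𝓞 F)) :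
    divisorHom F x v = Multiplicative.toAdd (v.valuationOfNeZero x.toMul) := rfl

theorem divisorHom_eq_zero_iff (x : Additive Fˣ) :
    divisorHom F x = 0 ↔ x.toMul ∈ (Units.map (algebraMap (𝓞 F) F : 𝓞 F →* F)).range := by
  constructor
  · intro h
    have hv (v : HeightOneSpectrum (𝓞 F)) : v.valuation F (x.toMul : F) = 1 := by
      rw [← HeightOneSpectrum.valuationOfNeZero_eq]
      have := DFunLike.congr_fun h v
      rw [divisorHom_apply] at this
      exact_mod_cast Multiplicative.toAdd.injective this
    obtain ⟨a, ha⟩ := HeightOneSpectrum.mem_integers_of_valuation_le_one F (x.toMul : F)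
      fun v ↦ (hv v).le
    obtain ⟨b, hb⟩ := HeightOneSpectrum.mem_integers_of_valuation_le_one F ((x.toMul)⁻¹ : F)
      fun v ↦ by rw [map_inv₀, hv, inv_one]
    have hab : a * b = 1 := by
      apply FaithfulSMul.algebraMap_injective (𝓞 F) F
      rw [map_mul, ha, hb, map_one, mul_inv_cancel₀ x.toMul.ne_zero]
    exact ⟨⟨a, b, hab, mul_comm a b ▸ hab⟩, Units.ext ha⟩
  · rintro ⟨u, hu⟩
    ext v
    rw [divisorHom_apply, ← hu, HeightOneSpectrum.valuation_of_unit_eq]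
    rfl

theorem not_isUnit_natCast_ringOfIntegers {p : ℕ} (hp : p.Prime) : ¬ IsUnit (p : 𝓞 F) := by
  rw [NumberField.isUnit_iff_norm, RingOfIntegers.coe_norm,
    show ((p : 𝓞 F) : F) = (p : F) from map_natCast (algebraMap (𝓞 F) F) p, Algebra.norm_natCast,
    abs_of_nonneg (by positivity)]
  exact (one_lt_pow₀ (by exact_mod_cast hp.one_lt) Module.finrank_pos.ne').ne'

theorem infinite_heightOneSpectrum : Infinite (HeightOneSpectrum (𝓞 F)) := by
  have hex (p : Nat.Primes) : ∃ v : HeightOneSpectrum (𝓞 F), ((p : ℕ) : 𝓞 F) ∈ v.asIdeal := by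
    obtain ⟨M, hM, hpM⟩ := exists_max_ideal_of_mem_nonunits
      (not_isUnit_natCast_ringOfIntegers F p.2)
    exact ⟨⟨M, hM.isPrime, fun h ↦ p.2.ne_zero (by simpa [h] using hpM)⟩, hpM⟩
  choose v hv using hex
  refine Infinite.of_injective v fun p q hpq ↦ ?_
  by_contra hne
  have hcop : IsCoprime ((p : ℕ) : ℤ) ((q : ℕ) : ℤ) :=
    Nat.isCoprime_iff_coprime.2 ((Nat.coprime_primes p.2 q.2).2 fun h ↦ hne (Subtype.ext h))
  obtain ⟨a, b, hab⟩ := hcop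
  refine (v p).isPrime.ne_top ((Ideal.eq_top_iff_one _).2 ?_)
  have := congrArg (Int.cast : ℤ → 𝓞 F) hab
  push_cast at this
  rw [← this]
  exact add_mem (Ideal.mul_mem_left _ _ (hv p)) (Ideal.mul_mem_left _ _ (hpq ▸ hv q))

theorem exists_divisorHom_ne_zero (v : HeightOneSpectrum (𝓞 F)) : ∃ x, divisorHom F x v ≠ 0 := by
  obtain ⟨a, hav, ha⟩ := Submodule.exists_mem_ne_zero_of_ne_bot v.ne_bot
  have ha' : algebraMap (𝓞 F) F a ≠ 0 := by simpa using ha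
  refine ⟨Additive.ofMul (Units.mk0 _ ha'), fun h ↦ ?_⟩
  have h1 : v.valuation F (algebraMap (𝓞 F) F a) < 1 := by
    rw [HeightOneSpectrum.valuation_lt_one_iff_mem]
    exact hav
  refine h1.ne ?_
  rw [← Units.val_mk0 ha', ← HeightOneSpectrum.valuationOfNeZero_eq]
  rw [divisorHom_apply] at h
  exact_mod_cast Multiplicative.toAdd.injective h

theorem not_finite_range_divisorHom :
    ¬ Module.Finite ℤ (LinearMap.range (divisorHom F).toIntLinearMap) := by
  intro h
  obtain ⟨s, hs⟩ := Module.Finite.iff_fg.1 h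
  have hU : (⋃ y ∈ s, (y.support : Set (HeightOneSpectrum (𝓞 F)))) = Set.univ := by
    refine Set.eq_univ_of_forall fun v ↦ ?_
    by_contra hv
    simp only [Set.mem_iUnion, Finset.mem_coe, Finsupp.mem_support_iff, not_exists, not_not] at hv
    obtain ⟨x, hx⟩ := exists_divisorHom_ne_zero F v
    have hle : Submodule.span ℤ (s : Set (HeightOneSpectrum (𝓞 F) →₀ ℤ)) ≤
        LinearMap.ker (Finsupp.lapply v) := Submodule.span_le.2 fun y hy ↦ hv y hy
    rw [hs] at hle
    exact hx (hle ⟨x, rfl⟩)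
  have := infinite_heightOneSpectrum F
  refine Set.infinite_univ (α := HeightOneSpectrum (𝓞 F)) ?_
  rw [← hU]
  exact s.finite_toSet.biUnion fun y _ ↦ y.support.finite_toSet

theorem range_divisorHom_equiv :
    Nonempty (LinearMap.range (divisorHom F).toIntLinearMap ≃ₗ[ℤ] (ℕ →₀ ℤ)) := by
  set P := LinearMap.range (divisorHom F).toIntLinearMap with hP
  let : LinearOrder (HeightOneSpectrum (𝓞 F)) := WellOrderingRel.isWellOrder.linearOrder
  have : WellFoundedLT (HeightOneSpectrum (𝓞 F)) := WellOrderingRel.isWellOrder.toIsWellFounded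
  have : Module.Free ℤ P := free_submodule_finsupp P
  have : Countable F := (Module.finBasis ℚ F).equivFun.injective.countable
  have : Countable (Additive Fˣ) :=
    (Units.val_injective.comp Additive.toMul.injective : Function.Injective fun x : Additive Fˣ ↦
      (x.toMul : F)).countable
  have : Countable P := (LinearMap.surjective_rangeRestrict (divisorHom F).toIntLinearMap).countable
  let b := Module.Free.chooseBasis ℤ P
  have : Countable (Module.Free.ChooseBasisIndex ℤ P) := b.injective.countable
  have : Infinite (Module.Free.ChooseBasisIndex ℤ P) := by
    refine not_finite_iff_infinite.1 fun h ↦ not_finite_range_divisorHom F ?_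
    exact Module.Finite.of_basis b
  obtain ⟨e⟩ := nonempty_denumerable (Module.Free.ChooseBasisIndex ℤ P)
  exact ⟨b.repr.trans (Finsupp.domLCongr (Denumerable.eqv _))⟩

theorem units_ringOfIntegers_equiv : Nonempty (Additive (𝓞 F)ˣ ≃+
    ZMod (Units.torsionOrder F) × (Fin (Units.rank F) → ℤ)) := by
  let f : Additive (Units.torsion F) × (Fin (Units.rank F) → ℤ) →+ Additive (𝓞 F)ˣ :=
    (Units.torsion F).subtype.toAdditive.coprod (Fintype.linearCombination ℤ
      fun i ↦ Additive.ofMul (Units.fundSystem F i)).toAddMonoidHom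
  have hf (y) : (f y).toMul = y.1.toMul * ∏ i, Units.fundSystem F i ^ y.2 i := by
    simp [f, Fintype.linearCombination_apply, toMul_sum]
  have hbij : Function.Bijective f := by
    refine Function.bijective_iff_existsUnique f |>.2 fun x ↦ ?_
    obtain ⟨y, hy, huniq⟩ := Units.exist_unique_eq_mul_prod F x.toMul
    exact ⟨(Additive.ofMul y.1, y.2), (hf _).trans hy.symm,
      fun z hz ↦ huniq (z.1.toMul, z.2) (by rw [← hz]; exact hf z)⟩
  exact ⟨(AddEquiv.ofBijective f hbij).symm.trans
    ((zmodAddCyclicAddEquiv inferInstance).symm.prodCongr (AddEquiv.refl _))⟩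

/-- The structure of the multiplicative group of a number field. -/
theorem units_equiv : Nonempty (Additive Fˣ ≃+ ZMod (Units.torsionOrder F) × (ℕ →₀ ℤ)) := by
  obtain ⟨eP⟩ := range_divisorHom_equiv F
  have := Module.Free.of_equiv eP.symm
  obtain ⟨e⟩ := exists_equiv_ker_prod (divisorHom F).toIntLinearMap.rangeRestrict
    (LinearMap.surjective_rangeRestrict _)
  obtain ⟨eU⟩ := units_ringOfIntegers_equiv F
  have hinj : Function.Injective (Units.map (algebraMap (𝓞 F) F : 𝓞 F →* F)) :=
    Units.map_injective (FaithfulSMul.algebraMap_injective (𝓞 F) F)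
  have ek : Additive (𝓞 F)ˣ ≃+ LinearMap.ker (divisorHom F).toIntLinearMap.rangeRestrict :=
    AddEquiv.ofBijective ((Units.map (algebraMap (𝓞 F) F : 𝓞 F →* F)).toAdditive.codRestrict
      (LinearMap.ker (divisorHom F).toIntLinearMap.rangeRestrict) fun u ↦ by
        rw [LinearMap.ker_rangeRestrict]
        exact (divisorHom_eq_zero_iff F _).2 ⟨u.toMul, rfl⟩) (by
      constructor
      · intro u w h
        exact hinj (congrArg Subtype.val h)
      · rintro ⟨x, hx⟩
        rw [LinearMap.ker_rangeRestrict] at hx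
        obtain ⟨u, hu⟩ := (divisorHom_eq_zero_iff F _).1 hx
        exact ⟨Additive.ofMul u, Subtype.ext hu⟩)
  obtain ⟨_⟩ := nonempty_denumerable (Fin (Units.rank F) ⊕ ℕ)
  have e3 : (Fin (Units.rank F) → ℤ) × (ℕ →₀ ℤ) ≃+ (ℕ →₀ ℤ) :=
    (((Finsupp.linearEquivFunOnFinite ℤ ℤ _).symm.toAddEquiv.prodCongr (AddEquiv.refl _)).trans
      Finsupp.sumFinsuppAddEquivProdFinsupp.symm).trans
        (Finsupp.domCongr (Denumerable.eqv (Fin (Units.rank F) ⊕ ℕ)))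
  exact ⟨e.toAddEquiv.trans (((ek.symm.trans eU).prodCongr eP.toAddEquiv).trans
    (AddEquiv.prodAssoc.trans ((AddEquiv.refl _).prodCongr e3)))⟩

end Valuations

section RootsOfUnity

variable {F : Type*} [Field F] {ι : Type*}

theorem card_torsion_of_equiv {N : ℕ} [NeZero N] (φ : Additive Fˣ ≃+ ZMod N × (ι →₀ ℤ)) :
    Nat.card {x : Fˣ // ∃ k : ℕ, 0 < k ∧ x ^ k = 1} = N := by
  have hφ (x : Fˣ) : (∃ k : ℕ, 0 < k ∧ x ^ k = 1) ↔ (φ (Additive.ofMul x)).2 = 0 := by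
    constructor
    · rintro ⟨k, hk, hx⟩
      have h := congrArg (fun y ↦ (φ (Additive.ofMul y)).2) hx
      simpa [hk.ne'] using h
    · intro h
      refine ⟨N, NeZero.pos N, Additive.ofMul.injective (φ.injective ?_)⟩
      rw [ofMul_pow, map_nsmul, ofMul_one, map_zero]
      exact Prod.ext (by simp) (by simp [h])
  let e : {x : Fˣ // ∃ k : ℕ, 0 < k ∧ x ^ k = 1} ≃ ZMod N :=
    { toFun x := (φ (Additive.ofMul x.1)).1
      invFun a := ⟨(φ.symm (a, 0)).toMul, (hφ _).2 (by simp)⟩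
      left_inv x := by
        refine Subtype.ext (Additive.ofMul.injective (φ.injective ?_))
        rw [ofMul_toMul, AddEquiv.apply_symm_apply]
        exact Prod.ext rfl ((hφ _).1 x.2).symm
      right_inv a := by simp }
  rw [Nat.card_congr e, Nat.card_zmod]

theorem equiv_neg_one [CharZero F] {k : ℕ} (φ : Additive Fˣ ≃+ ZMod (2 * k) × (ι →₀ ℤ)) :
    φ (Additive.ofMul (-1)) = ((k : ZMod (2 * k)), 0) := by
  set z := φ (Additive.ofMul (-1)) with hz
  have h2 : 2 • z = 0 := by
    rw [hz, ← map_nsmul, ← ofMul_pow, neg_one_sq, ofMul_one, map_zero]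
  have hz0 : z ≠ 0 := by
    rw [hz, ne_eq, map_eq_zero_iff φ φ.injective, ofMul_eq_zero]
    intro h
    have := congrArg Units.val h
    norm_num at this
  have hs : z.2 = 0 := by simpa using congrArg Prod.snd h2
  refine Prod.ext ?_ hs
  have hf : z.1 ≠ 0 := fun h ↦ hz0 (Prod.ext h hs)
  obtain ⟨a, ha⟩ := ZMod.intCast_surjective z.1
  have h2a : ((2 * a : ℤ) : ZMod (2 * k)) = 0 := by
    simpa [ha] using congrArg Prod.fst h2
  rw [← ha, ne_eq, ZMod.intCast_zmod_eq_zero_iff_dvd] at hf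
  rw [ZMod.intCast_zmod_eq_zero_iff_dvd] at h2a
  push_cast at h2a hf
  obtain ⟨c, rfl⟩ := (mul_dvd_mul_iff_left two_ne_zero).1 h2a
  rcases Int.even_or_odd' c with ⟨j, rfl | rfl⟩
  · exact absurd ⟨j, by ring⟩ hf
  · have hk := ZMod.natCast_self (2 * k)
    push_cast at hk
    rw [← ha]
    push_cast
    linear_combination j * hk

theorem exists_sq_eq_neg_one_iff [CharZero F] {k : ℕ}
    (φ : Additive Fˣ ≃+ ZMod (2 * k) × (ι →₀ ℤ)) : (∃ i : F, i ^ 2 = -1) ↔ Even k := by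
  constructor
  · rintro ⟨i, hi⟩
    have hi0 : i ≠ 0 := by
      rintro rfl
      norm_num at hi
    have h : 2 • φ (Additive.ofMul (Units.mk0 i hi0)) = ((k : ZMod (2 * k)), 0) := by
      rw [← equiv_neg_one φ, ← map_nsmul, ← ofMul_pow]
      congr 2
      exact Units.ext hi
    have h1 := congrArg (fun z ↦ ZMod.castHom (dvd_mul_right 2 k) (ZMod 2) z.1) h
    simp only [Prod.smul_fst, map_nsmul, map_natCast] at h1
    rw [← ZMod.natCast_eq_zero_iff_even, ← h1, two_nsmul]
    exact CharTwo.add_self_eq_zero _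
  · rintro ⟨j, rfl⟩
    refine ⟨((φ.symm ((j : ZMod (2 * (j + j))), 0)).toMul : Fˣ), ?_⟩
    have h : φ.symm ((j : ZMod (2 * (j + j))), 0) + φ.symm ((j : ZMod (2 * (j + j))), 0) =
        Additive.ofMul (-1) := by
      rw [← map_add, AddEquiv.symm_apply_eq, equiv_neg_one]
      simp
    have := congrArg (fun x : Additive Fˣ ↦ (x.toMul : F)) h
    simpa [sq] using this

theorem negTensorSub_eq_twistedRelations :
    negTensorSub F = twistedRelations (Additive.ofMul (-1 : Fˣ)) := by
  have h (x : Fˣ) : Additive.ofMul (-x) = Additive.ofMul x + Additive.ofMul (-1) := by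
    rw [← ofMul_mul, mul_neg_one]
  rw [negTensorSub, twistedRelations]
  congr 1
  ext z
  exact ⟨fun ⟨x, hx⟩ ↦ ⟨Additive.ofMul x, by rw [hx, h]⟩,
    fun ⟨x, hx⟩ ↦ ⟨x.toMul, by rw [hx, h x.toMul, ofMul_toMul]⟩⟩

end RootsOfUnity

/-- For a number field `F` with exactly `n` roots of unity, and `m = 1` if `√-1 ∈ F`,
`m = 2` otherwise, there is an isomorphism
`∧̃² F* ≅ ℤ/m ⊕ (⊕_{i∈ℕ} ℤ/n) ⊕ (⊕_{i∈ℕ} ℤ)`. -/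
theorem tildeWedge2_structure (F : Type*) [Field F] [NumberField F] (n m : ℕ)
    (hn : n = Nat.card {x : Fˣ // ∃ k : ℕ, 0 < k ∧ x ^ k = 1})
    (hm1 : (∃ i : F, i ^ 2 = -1) → m = 1)
    (hm2 : ¬(∃ i : F, i ^ 2 = -1) → m = 2) :
    Nonempty (TildeWedge2 F ≃+ (ZMod m × (ℕ →₀ ZMod n) × (ℕ →₀ ℤ))) := by
  obtain ⟨φ⟩ := units_equiv F
  obtain ⟨k, hk⟩ := even_iff_two_dvd.1 (Units.even_torsionOrder F)
  rw [card_torsion_of_equiv φ] at hn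
  rw [hk] at hn φ
  subst hn
  rw [exists_sq_eq_neg_one_iff φ] at hm1 hm2
  have hm : m ∣ 2 * k := by
    by_cases h : Even k
    · rw [hm1 h]
      exact one_dvd _
    · rw [hm2 h]
      exact dvd_mul_right 2 k
  have : Infinite {p : ℕ × ℕ | p.1 < p.2} :=
    Infinite.of_injective (fun i : ℕ ↦ ⟨(i, i + 1), i.lt_succ_self⟩) fun i j h ↦
      congrArg (fun p ↦ p.1.1) h
  obtain ⟨_⟩ := nonempty_denumerable {p : ℕ × ℕ | p.1 < p.2}
  exact ⟨(QuotientAddGroup.quotientAddEquivOfEq negTensorSub_eq_twistedRelations).trans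
    ((twistedSquareCongr φ (equiv_neg_one φ)).trans ((twistedSquareModel hm hm1 hm2).trans
      ((AddEquiv.refl _).prodCongr ((AddEquiv.refl _).prodCongr
        (Finsupp.domCongr (Denumerable.eqv {p : ℕ × ℕ | p.1 < p.2}))))))⟩
end

section
/- Let F be a CM field with complex conjugation c, and for a matrix M over F write M* for the matrix obtained by applying c to every entry and then transposing. Let A be a 2×2 matrix over F with A* = A such that for every embedding σ : F → ℂ the matrix σ(A) (apply σ entrywise) is a positive definite Hermitian matrix. Let P ∈ GL₂(O_F) and set A' = P* A P. If det A' = det A, then det P is a root of unity; and if moreover det P = w² for some unit w of O_F, then Q := w⁻¹ P lies in SL₂(O_F) and A' = Q* A Q. -/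
open NumberField Matrix
open scoped ComplexOrder

/-- For `c` a complex conjugation on `F`, an element has relative norm `1` exactly when
all its complex absolute values are `1`. -/
lemma conj_mul_self_eq_one_iff {F : Type*} [Field F] [NumberField F] {c : F →+* F}
    (hc : ∀ (σ : F →+* ℂ) (a : F), σ (c a) = starRingEnd ℂ (σ a)) (x : F) :
    c x * x = 1 ↔ ∀ σ : F →+* ℂ, ‖σ x‖ = 1 := by
  have key (σ : F →+* ℂ) : σ (c x * x) = ((‖σ x‖ ^ 2 : ℝ) : ℂ) := by
    rw [map_mul, hc, Complex.conj_mul', Complex.ofReal_pow]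
  constructor
  · intro h σ
    have h1 : ‖σ x‖ ^ 2 = 1 := by
      have := key σ
      rw [h, map_one] at this
      exact_mod_cast this.symm
    exact (pow_eq_one_iff_of_nonneg (norm_nonneg _) two_ne_zero).1 h1
  · intro h
    obtain ⟨σ⟩ : Nonempty (F →+* ℂ) := inferInstance
    apply σ.injective
    rw [key, h σ, map_one]
    simp

/-- Scaling `P` by an element of relative norm `1` does not change the action of `P` on
Hermitian forms. -/
lemma conjTranspose_smul_mul_mul_smul {F n : Type*} [Field F] [Fintype n]
    (c : F →+* F) {u : F} (hu : c u * u = 1) (A P : Matrix n n F) :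
    ((u • P).map c)ᵀ * A * (u • P) = (P.map c)ᵀ * A * P := by
  have h : (u • P).map c = c u • P.map c := by ext; simp
  rw [h, transpose_smul, Matrix.smul_mul, Matrix.smul_mul, Matrix.mul_smul, smul_smul, hu,
    one_smul]

/-- Let `F` be a CM field with complex conjugation `c`, `A` a 2×2 Hermitian matrix over
`F` (w.r.t. `c`) which is positive definite at every complex embedding, and
`P ∈ GL₂(O_F)`; set `A' = P* A P`. If `det A' = det A` then `det P` is a root of unity;
and if moreover `det P = w²` for a unit `w` of `O_F`, then `Q := w⁻¹ P` has determinant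
`1` (i.e. lies in `SL₂(O_F)`) and `A' = Q* A Q`. -/
theorem cm_equivalent_perfect_forms (F : Type*) [Field F] [NumberField F]
    (hreal : IsEmpty (F →+* ℝ))
    (c : F →+* F)
    (hc : ∀ (σ : F →+* ℂ) (a : F), σ (c a) = starRingEnd ℂ (σ a))
    (A : Matrix (Fin 2) (Fin 2) F)
    (hA : (A.map c)ᵀ = A)
    (hpos : ∀ σ : F →+* ℂ, (A.map σ).PosDef)
    (P : Matrix (Fin 2) (Fin 2) (𝓞 F)) (hP : IsUnit P.det)
    (A' : Matrix (Fin 2) (Fin 2) F)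
    (hA' : A' = ((P.map (algebraMap (𝓞 F) F)).map c)ᵀ * A * (P.map (algebraMap (𝓞 F) F)))
    (hdet : A'.det = A.det) :
    (∃ k : ℕ, 0 < k ∧ P.det ^ k = 1) ∧
      ∀ w : (𝓞 F)ˣ, P.det = (w : 𝓞 F) ^ 2 →
        ∀ Q : Matrix (Fin 2) (Fin 2) (𝓞 F), Q = ((w⁻¹ : (𝓞 F)ˣ) : 𝓞 F) • P →
          Q.det = 1 ∧
            A' = ((Q.map (algebraMap (𝓞 F) F)).map c)ᵀ * A * (Q.map (algebraMap (𝓞 F) F)) := by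
  have hdetA : A.det ≠ 0 := by
    obtain ⟨σ⟩ : Nonempty (F →+* ℂ) := inferInstance
    intro h
    have h' : σ A.det ≠ 0 := by
      rw [RingHom.map_det]
      exact (hpos σ).det_pos.ne'
    exact h' (by rw [h, map_zero])
  have hd : c (P.det : F) * P.det = 1 := by
    have hPdet : (P.map (algebraMap (𝓞 F) F)).det = (P.det : F) :=
      (RingHom.map_det (algebraMap (𝓞 F) F) P).symm
    have hcdet : ((P.map (algebraMap (𝓞 F) F)).map c).det = c (P.det : F) := by
      rw [← hPdet]
      exact (RingHom.map_det c _).symm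
    rw [hA', det_mul, det_mul, det_transpose, hPdet, hcdet] at hdet
    apply mul_right_cancel₀ hdetA
    linear_combination hdet
  have hnorm := (conj_mul_self_eq_one_iff hc _).1 hd
  refine ⟨?_, ?_⟩
  · obtain ⟨k, hk, h⟩ := Embeddings.pow_eq_one_of_norm_eq_one F ℂ P.det.isIntegral_coe hnorm
    exact ⟨k, hk, RingOfIntegers.ext (by exact_mod_cast h)⟩
  · rintro w hw Q rfl
    have hwu : (((w⁻¹ : (𝓞 F)ˣ) : 𝓞 F) : F) * ((w : 𝓞 F) : F) = 1 := by
      rw [← map_mul, Units.inv_mul, map_one]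
    have hwnorm : c ((w : 𝓞 F) : F) * ((w : 𝓞 F) : F) = 1 := by
      refine (conj_mul_self_eq_one_iff hc _).2 fun σ ↦ ?_
      have h := hnorm σ
      have hw' : (P.det : F) = ((w : 𝓞 F) : F) ^ 2 := by
        rw [hw]
        exact map_pow (algebraMap (𝓞 F) F) _ 2
      rw [hw', map_pow, norm_pow] at h
      exact (pow_eq_one_iff_of_nonneg (norm_nonneg _) two_ne_zero).1 h
    have hu : c (((w⁻¹ : (𝓞 F)ˣ) : 𝓞 F) : F) * (((w⁻¹ : (𝓞 F)ˣ) : 𝓞 F) : F) = 1 := by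
      have h := congrArg c hwu
      rw [map_mul, map_one] at h
      calc _ = c (((w⁻¹ : (𝓞 F)ˣ) : 𝓞 F) : F) * (((w⁻¹ : (𝓞 F)ˣ) : 𝓞 F) : F) *
            (c ((w : 𝓞 F) : F) * ((w : 𝓞 F) : F)) := by rw [hwnorm, mul_one]
        _ = (c (((w⁻¹ : (𝓞 F)ˣ) : 𝓞 F) : F) * c ((w : 𝓞 F) : F)) *
            ((((w⁻¹ : (𝓞 F)ˣ) : 𝓞 F) : F) * ((w : 𝓞 F) : F)) := by ring
        _ = 1 := by rw [h, hwu, mul_one]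
    refine ⟨?_, ?_⟩
    · rw [det_smul, Fintype.card_fin, hw, ← mul_pow, Units.inv_mul, one_pow]
    · have hQ : (((w⁻¹ : (𝓞 F)ˣ) : 𝓞 F) • P).map (algebraMap (𝓞 F) F) =
          (((w⁻¹ : (𝓞 F)ˣ) : 𝓞 F) : F) • P.map (algebraMap (𝓞 F) F) := by
        ext; simp
      rw [hA', hQ, conjTranspose_smul_mul_mul_smul c hu]
end
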